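/- Let (C, D) be an ST-pair inside an algebraic triangulated category T. Then the map φ : silt(C) → SMC(D) sending a basic silting object M of C to the set of simple objects of the heart T_M^0 is a bijection between the set of isomorphism classes of basic silting objects of C and the set of isomorphism classes of simple-minded collections of D. -/

import Mathlib

open CategoryTheory Limits Pretriangulated

namespace STPaper

variable {T : Type*} [Category T] [Preadditive T] [HasZeroObject T]
  [HasShift T ℤ] [∀ n : ℤ, (CategoryTheory.shiftFunctor T n).Additive] [Pretriangulated T]

/-- The shift of a class of objects. -/
def shSet (S : Set T) (n : ℤ) : Set T := (CategoryTheory.shiftFunctor T n).obj '' S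

/-- The class `Y₁ ∗ Y₂`: objects `Z` fitting in a distinguished triangle
`Y₁ → Z → Y₂ → ΣY₁` with `Y₁ ∈ 𝒴₁` and `Y₂ ∈ 𝒴₂`. -/
def star (Y₁ Y₂ : Set T) : Set T :=
  {Z | ∃ (A B : T) (f : A ⟶ Z) (g : Z ⟶ B) (h : B ⟶ A⟦(1:ℤ)⟧),
    (Triangle.mk f g h ∈ distTriang T) ∧ A ∈ Y₁ ∧ B ∈ Y₂}

/-- The extension closure of a class of objects. -/
inductive filt (S : Set T) : T → Prop
  | of {X : T} (h : X ∈ S) : filt S X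
  | zero {X : T} (h : IsZero X) : filt S X
  | ext {A Z B : T} (f : A ⟶ Z) (g : Z ⟶ B) (h : B ⟶ A⟦(1:ℤ)⟧)
      (hT : Triangle.mk f g h ∈ distTriang T) (hA : filt S A) (hB : filt S B) : filt S Z

/-- The thick subcategory generated by a class of objects. -/
inductive thick (S : Set T) : T → Prop
  | of {X : T} (h : X ∈ S) : thick S X
  | zero {X : T} (h : IsZero X) : thick S X
  | shift {X : T} (hX : thick S X) (n : ℤ) : thick S (X⟦n⟧)
  | ext {A Z B : T} (f : A ⟶ Z) (g : Z ⟶ B) (h : B ⟶ A⟦(1:ℤ)⟧)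
      (hT : Triangle.mk f g h ∈ distTriang T) (hA : thick S A) (hB : thick S B) : thick S Z
  | smd {X Y : T} (i : X ⟶ Y) (r : Y ⟶ X) (hir : i ≫ r = 𝟙 X) (hY : thick S Y) : thick S X

/-- Two classes of objects coincide up to isomorphism. -/
def isoEq (S L : Set T) : Prop :=
  (∀ X ∈ S, ∃ Y ∈ L, Nonempty (X ≅ Y)) ∧ (∀ Y ∈ L, ∃ X ∈ S, Nonempty (X ≅ Y))

/-- A simple-minded collection. -/
structure IsSMC (S : Set T) : Prop where
  negVanish : ∀ X ∈ S, ∀ Y ∈ S, ∀ n : ℤ, n < 0 → ∀ f : X ⟶ Y⟦n⟧, f = 0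
  nonzero : ∀ X ∈ S, ¬ IsZero X
  endo : ∀ X ∈ S, ∀ f : X ⟶ X, f = 0 ∨ IsIso f
  noHom : ∀ X ∈ S, ∀ Y ∈ S, X ≠ Y → ∀ f : X ⟶ Y, f = 0
  generates : ∀ X : T, thick S X

/-- `T^{𝒮,≤0}` for a collection `S`. -/
def leS (S : Set T) : Set T :=
  {X | ∀ n : ℤ, 0 < n → ∀ Y ∈ S, ∀ f : X⟦n⟧ ⟶ Y, f = 0}

/-- `Σ^{0}Filt(S) ∗ Σ^{-1}Filt(S) ∗ ⋯ ∗ Σ^{-l}Filt(S)`. -/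
def geChainS (S : Set T) : ℕ → Set T
  | 0 => {X | filt S X}
  | (l+1) => star (geChainS S l) (shSet {X | filt S X} (-(l+1 : ℤ)))

/-- `T^{𝒮,≥0}`. -/
def geS (S : Set T) : Set T := ⋃ l, geChainS S l

/-- `Σ^{l}Filt(S) ∗ Σ^{l-1}Filt(S) ∗ ⋯ ∗ Filt(S)`. -/
def leChainS (S : Set T) : ℕ → Set T
  | 0 => {X | filt S X}
  | (l+1) => star (shSet {X | filt S X} (l+1 : ℤ)) (leChainS S l)

/-- A `t`-structure `(Le, Ge) = (T^{≤0}, T^{≥0})` on `T`. -/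
structure IsTStr (Le Ge : Set T) : Prop where
  le_shift : ∀ X ∈ Le, X⟦(1:ℤ)⟧ ∈ Le
  ge_shift : ∀ X ∈ Ge, X⟦(-1:ℤ)⟧ ∈ Ge
  hom_zero : ∀ X ∈ Le, ∀ Y ∈ Ge, ∀ f : X ⟶ Y⟦(-1:ℤ)⟧, f = 0
  exhaust : ∀ Z : T, Z ∈ star Le (shSet Ge (-1))

/-- The heart of a pair of classes. -/
def heart (Le Ge : Set T) : Set T := Le ∩ Ge

/-- A bounded `t`-structure. -/
structure IsBoundedTStr (Le Ge : Set T) : Prop where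
  toIsTStr : IsTStr Le Ge
  bddRight : ∀ X : T, ∃ n : ℤ, X⟦n⟧ ∈ Le
  bddLeft : ∀ X : T, ∃ n : ℤ, X⟦n⟧ ∈ Ge

/-- A simple object of the heart `H`: a nonzero object such that in any distinguished
triangle `A → X → B → ΣA` with `A, B ∈ H`, one of `A`, `B` vanishes. -/
def heartSimple (H : Set T) (X : T) : Prop :=
  X ∈ H ∧ ¬ IsZero X ∧ ∀ (A B : T) (f : A ⟶ X) (g : X ⟶ B) (h : B ⟶ A⟦(1:ℤ)⟧),
    (Triangle.mk f g h ∈ distTriang T) → A ∈ H → B ∈ H → IsZero A ∨ IsZero B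

/-- An algebraic `t`-structure: a bounded `t`-structure whose heart is a length category,
i.e. every object of the heart is a finite iterated extension of simple objects of the heart. -/
def IsAlgTStr (Le Ge : Set T) : Prop :=
  IsBoundedTStr Le Ge ∧ ∀ X ∈ heart Le Ge, filt {Y | heartSimple (heart Le Ge) Y} X


section Silting

variable (T) in
/-- A Krull–Schmidt category: every object is a finite biproduct of objects with local
endomorphism rings. -/
def IsKrullSchmidt [HasFiniteBiproducts T] : Prop :=
  ∀ X : T, ∃ (n : ℕ) (f : Fin n → T),
    (∀ i, IsLocalRing (End (f i))) ∧ Nonempty (X ≅ ⨁ f)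

/-- `X` belongs to `add M`: it is a direct summand of a finite direct sum of copies of `M`. -/
def addObj [HasFiniteBiproducts T] (M : T) (X : T) : Prop :=
  ∃ (n : ℕ) (i : X ⟶ ⨁ (fun _ : Fin n => M)) (r : (⨁ (fun _ : Fin n => M)) ⟶ X),
    i ≫ r = 𝟙 X

/-- The subcategory `add M`. -/
def addSet [HasFiniteBiproducts T] (M : T) : Set T := {X | addObj M X}

/-- A silting object of `T`. -/
def IsSiltingObj (M : T) : Prop :=
  (∀ n : ℤ, 0 < n → ∀ f : M ⟶ M⟦n⟧, f = 0) ∧ ∀ X : T, thick {M} X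

/-- A basic object: it has no repeated (nonzero) direct summand. -/
def IsBasic [HasBinaryBiproducts T] (M : T) : Prop :=
  ¬ ∃ (X Y : T), ¬ IsZero X ∧ Nonempty (M ≅ (X ⊞ X) ⊞ Y)

/-- A silting subcategory of `T`. -/
structure IsSiltingSubcat [HasBinaryBiproducts T] (M : Set T) : Prop where
  isoClosed : ∀ {X Y : T}, (X ≅ Y) → X ∈ M → Y ∈ M
  zeroMem : ∀ X : T, IsZero X → X ∈ M
  sumMem : ∀ X ∈ M, ∀ Y ∈ M, (X ⊞ Y) ∈ M
  smdMem : ∀ (X Y : T) (i : X ⟶ Y) (r : Y ⟶ X), i ≫ r = 𝟙 X → Y ∈ M → X ∈ M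
  presilting : ∀ X ∈ M, ∀ Y ∈ M, ∀ n : ℤ, 0 < n → ∀ f : X ⟶ Y⟦n⟧, f = 0
  generates : ∀ X : T, thick M X

/-- `T_{ℳ,≤0} = {X | Hom(ℳ, Σ^{>0} X) = 0}`. -/
def leM (M : Set T) : Set T :=
  {X | ∀ n : ℤ, 0 < n → ∀ Y ∈ M, ∀ f : Y ⟶ X⟦n⟧, f = 0}

/-- `Σ^l ℳ ∗ Σ^{l-1} ℳ ∗ ⋯ ∗ ℳ`. -/
def geChainM (M : Set T) : ℕ → Set T
  | 0 => M
  | (l+1) => star (shSet M (l+1 : ℤ)) (geChainM M l)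

/-- `T_{ℳ,≥0} = ⋃_{l ≥ 0} Σ^l ℳ ∗ ⋯ ∗ ℳ`. -/
def geM (M : Set T) : Set T := ⋃ l, geChainM M l

/-- `ℳ ∗ Σℳ ∗ ⋯ ∗ Σ^l ℳ`. -/
def leChainM (M : Set T) : ℕ → Set T
  | 0 => M
  | (l+1) => star (leChainM M l) (shSet M (l+1 : ℤ))

/-- A co-`t`-structure `(Ge, Le) = (T_{≥0}, T_{≤0})` on `T`. -/
structure IsCotStr [HasBinaryBiproducts T] (Ge Le : Set T) : Prop where
  isoGe : ∀ {X Y : T}, (X ≅ Y) → X ∈ Ge → Y ∈ Ge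
  zeroGe : ∀ X : T, IsZero X → X ∈ Ge
  sumGe : ∀ X ∈ Ge, ∀ Y ∈ Ge, (X ⊞ Y) ∈ Ge
  smdGe : ∀ (X Y : T) (i : X ⟶ Y) (r : Y ⟶ X), i ≫ r = 𝟙 X → Y ∈ Ge → X ∈ Ge
  isoLe : ∀ {X Y : T}, (X ≅ Y) → X ∈ Le → Y ∈ Le
  zeroLe : ∀ X : T, IsZero X → X ∈ Le
  sumLe : ∀ X ∈ Le, ∀ Y ∈ Le, (X ⊞ Y) ∈ Le
  smdLe : ∀ (X Y : T) (i : X ⟶ Y) (r : Y ⟶ X), i ≫ r = 𝟙 X → Y ∈ Le → X ∈ Le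
  ge_shift : ∀ X ∈ Ge, X⟦(-1:ℤ)⟧ ∈ Ge
  le_shift : ∀ X ∈ Le, X⟦(1:ℤ)⟧ ∈ Le
  hom_zero : ∀ X ∈ Ge, ∀ Y ∈ Le, ∀ f : X⟦(-1:ℤ)⟧ ⟶ Y, f = 0
  exhaust : ∀ Z : T, Z ∈ star (shSet Ge (-1)) Le

/-- A bounded co-`t`-structure. -/
structure IsBoundedCot [HasBinaryBiproducts T] (Ge Le : Set T) : Prop where
  toCot : IsCotStr Ge Le
  bddGe : ∀ X : T, ∃ n : ℤ, X⟦n⟧ ∈ Ge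
  bddLe : ∀ X : T, ∃ n : ℤ, X⟦n⟧ ∈ Le

end Silting

section K0

variable (T) in
/-- Relations defining the Grothendieck group of the triangulated category `T`. -/
def triRel : Set (FreeAbelianGroup T) :=
  {x | ∃ Tr : Triangle T, (Tr ∈ distTriang T) ∧
    x = FreeAbelianGroup.of Tr.obj₂ - FreeAbelianGroup.of Tr.obj₁ - FreeAbelianGroup.of Tr.obj₃}

variable (T) in
/-- The Grothendieck group `K₀(T)` of the triangulated category `T`. -/
abbrev K0 : Type _ := FreeAbelianGroup T ⧸ AddSubgroup.closure (triRel T)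

/-- The class of an object of `T` in `K₀(T)`. -/
def K0mk (X : T) : K0 T := QuotientAddGroup.mk (FreeAbelianGroup.of X)

/-- An indecomposable object: nonzero, and it admits no nontrivial idempotent endomorphism. -/
def Indec (X : T) : Prop :=
  ¬ IsZero X ∧ ∀ e : X ⟶ X, e ≫ e = e → e = 0 ∨ e = 𝟙 X

/-- `ι` is a complete set of representatives of the isomorphism classes of indecomposable
objects of `ℳ`. -/
def IndReps (M : Set T) (ι : Set T) : Prop :=
  (∀ X ∈ ι, X ∈ M ∧ Indec X) ∧
  (∀ Y, Y ∈ M → Indec Y → ∃ X ∈ ι, Nonempty (X ≅ Y)) ∧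
  (∀ X ∈ ι, ∀ Y ∈ ι, X ≠ Y → IsEmpty (X ≅ Y))

/-- Relations defining the Grothendieck group of the heart `H`, coming from distinguished
triangles of `T` all of whose vertices lie in `H` (i.e. short exact sequences in `H`). -/
def heartRel (H : Set T) : Set (FreeAbelianGroup ↥H) :=
  {x | ∃ (A Z B : ↥H) (f : (A : T) ⟶ (Z : T)) (g : (Z : T) ⟶ (B : T))
    (h : (B : T) ⟶ (A : T)⟦(1:ℤ)⟧), (Triangle.mk f g h ∈ distTriang T) ∧
      x = FreeAbelianGroup.of Z - FreeAbelianGroup.of A - FreeAbelianGroup.of B}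

/-- The Grothendieck group `K₀(H)` of a heart `H ⊆ T`. -/
abbrev K0Heart (H : Set T) : Type _ := FreeAbelianGroup ↥H ⧸ AddSubgroup.closure (heartRel H)

/-- The class of an object of `H` in `K₀(H)`. -/
def K0Hmk {H : Set T} (X : ↥H) : K0Heart H := QuotientAddGroup.mk (FreeAbelianGroup.of X)

end K0

section STTriple

variable (R : Type*) [CommRing R] [IsArtinianRing R] [CategoryTheory.Linear R T]

/-- The aisle `T_M^{≤ n} = {X | Hom(M, Σ^{> n} X) = 0}`. -/
def tleMn (M : T) (n : ℤ) : Set T :=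
  {X | ∀ k : ℤ, n < k → ∀ f : M ⟶ X⟦k⟧, f = 0}

/-- The co-aisle `T_M^{≥ n} = {X | Hom(M, Σ^{< n} X) = 0}`. -/
def tgeMn (M : T) (n : ℤ) : Set T :=
  {X | ∀ k : ℤ, k < n → ∀ f : M ⟶ X⟦k⟧, f = 0}

/-- The heart `T_M^0` of the `t`-structure associated with a silting object `M`. -/
def heartM (M : T) : Set T := tleMn M 0 ∩ tgeMn M 0

/-- An ST-triple `(C, D, M)` inside `T` (over the commutative artinian base ring `R`). -/
structure IsSTTriple (C D : Set T) (M : T) : Prop where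
  thickC : ∀ X : T, thick C X → X ∈ C
  thickD : ∀ X : T, thick D X → X ∈ D
  memC : M ∈ C
  presilting : ∀ n : ℤ, 0 < n → ∀ f : M ⟶ M⟦n⟧, f = 0
  generates : ∀ X : T, X ∈ C ↔ thick {M} X
  finLength : ∀ X : T, IsFiniteLength R (M ⟶ X)
  tstr : IsTStr (tleMn M 0) (tgeMn M 0)
  exhaustT : ∀ X : T, ∃ n : ℤ, X ∈ tleMn M n
  eqD : ∀ X : T, X ∈ D ↔ ∃ n : ℤ, X ∈ tgeMn M n

variable {R}

/-- `S` is a direct sum of a complete set of representatives of the simple objects of the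
heart `H`. -/
def IsSumOfSimples [HasFiniteBiproducts T] (H : Set T) (S : T) : Prop :=
  ∃ (n : ℕ) (f : Fin n → T),
    (∀ i, heartSimple H (f i)) ∧
    (∀ Y : T, heartSimple H Y → ∃ i, Nonempty (f i ≅ Y)) ∧
    (∀ i j, i ≠ j → IsEmpty (f i ≅ f j)) ∧ Nonempty (S ≅ ⨁ f)

/-- `S` is a complete set of representatives of the isomorphism classes of simple objects
of the heart of the `t`-structure associated with `M`. -/
def heartSimplesReps (M : T) (S : Set T) : Prop :=
  (∀ X ∈ S, heartSimple (heartM M) X) ∧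
  (∀ Y : T, heartSimple (heartM M) Y → ∃ X ∈ S, Nonempty (X ≅ Y)) ∧
  (∀ X ∈ S, ∀ Y ∈ S, X ≠ Y → IsEmpty (X ≅ Y))

/-- A simple-minded collection of the (thick) subcategory `D ⊆ T`. -/
structure IsSMCof (D : Set T) (S : Set T) : Prop where
  subset : S ⊆ D
  negVanish : ∀ X ∈ S, ∀ Y ∈ S, ∀ n : ℤ, n < 0 → ∀ f : X ⟶ Y⟦n⟧, f = 0
  nonzero : ∀ X ∈ S, ¬ IsZero X
  endo : ∀ X ∈ S, ∀ f : X ⟶ X, f = 0 ∨ IsIso f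
  noHom : ∀ X ∈ S, ∀ Y ∈ S, X ≠ Y → ∀ f : X ⟶ Y, f = 0
  generates : ∀ X : T, X ∈ D ↔ thick S X

/-- A silting object of the (thick) subcategory `C ⊆ T`. -/
def IsSiltingOfC (C : Set T) (M : T) : Prop :=
  M ∈ C ∧ (∀ n : ℤ, 0 < n → ∀ f : M ⟶ M⟦n⟧, f = 0) ∧ ∀ X : T, X ∈ C ↔ thick {M} X

end STTriple

set_option linter.unusedSectionVars false
set_option linter.unusedVariables false
set_option linter.unusedSimpArgs false
universe w


/-- distinguished triangle, unbundled -/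
abbrev DT {A Z B : T} (f : A ⟶ Z) (g : Z ⟶ B) (h : B ⟶ A⟦(1:ℤ)⟧) : Prop :=
  Triangle.mk f g h ∈ distTriang T

lemma DT.rot {A Z B : T} {f : A ⟶ Z} {g : Z ⟶ B} {h : B ⟶ A⟦(1:ℤ)⟧} (H : DT f g h) :
    DT g h (-f⟦(1:ℤ)⟧') := rot_of_distTriang _ H

lemma DT.irot {A Z B : T} {f : A ⟶ Z} {g : Z ⟶ B} {h : B ⟶ A⟦(1:ℤ)⟧} (H : DT f g h) :
    ∃ (u : B⟦(-1:ℤ)⟧ ⟶ A) (v : Z ⟶ B⟦(-1:ℤ)⟧⟦(1:ℤ)⟧), DT u f v :=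
  ⟨_, _, inv_rot_of_distTriang _ H⟩

lemma DT.of_iso {A Z B A' Z' B' : T} {f : A ⟶ Z} {g : Z ⟶ B} {h : B ⟶ A⟦(1:ℤ)⟧}
    {f' : A' ⟶ Z'} {g' : Z' ⟶ B'} {h' : B' ⟶ A'⟦(1:ℤ)⟧} (H' : DT f' g' h')
    (a : A ≅ A') (b : Z ≅ Z') (c : B ≅ B') (e1 : f ≫ b.hom = a.hom ≫ f')
    (e2 : g ≫ c.hom = b.hom ≫ g') (e3 : h ≫ a.hom⟦(1:ℤ)⟧' = c.hom ≫ h') : DT f g h :=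
  isomorphic_distinguished _ H' _ (Triangle.isoMk _ _ a b c e1 e2 e3)

lemma DT.unit {A Z B : T} {f : A ⟶ Z} {g : Z ⟶ B} {h : B ⟶ A⟦(1:ℤ)⟧} (u : ℤˣ)
    (H : DT (u • f) (u • g) (u • h)) : DT f g (u • h) := by
  rcases Int.units_eq_one_or u with rfl | rfl
  · simpa only [one_smul] using H
  · have e : Z ≅ Z := ⟨-𝟙 Z, -𝟙 Z, by simp, by simp⟩
    exact H.of_iso (Iso.refl _) ⟨-𝟙 Z, -𝟙 Z, by simp, by simp⟩ (Iso.refl _)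
      (by simp) (by simp) (by simp)

lemma DT.sh {A Z B : T} {f : A ⟶ Z} {g : Z ⟶ B} {h : B ⟶ A⟦(1:ℤ)⟧} (H : DT f g h) (k : ℤ) :
    DT (f⟦k⟧') (g⟦k⟧') (k.negOnePow • h⟦k⟧' ≫ (shiftFunctorComm T 1 k).hom.app A) :=
  DT.unit _ (Triangle.shift_distinguished _ H k)

lemma DT.zero12 {A Z B : T} {f : A ⟶ Z} {g : Z ⟶ B} {h : B ⟶ A⟦(1:ℤ)⟧} (H : DT f g h) :
    f ≫ g = 0 := comp_distTriang_mor_zero₁₂ _ H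
lemma DT.zero23 {A Z B : T} {f : A ⟶ Z} {g : Z ⟶ B} {h : B ⟶ A⟦(1:ℤ)⟧} (H : DT f g h) :
    g ≫ h = 0 := comp_distTriang_mor_zero₂₃ _ H
/-- maps into Z killed by g lift to A -/
lemma DT.lift {A Z B : T} {f : A ⟶ Z} {g : Z ⟶ B} {h : B ⟶ A⟦(1:ℤ)⟧} (H : DT f g h)
    {X : T} (x : X ⟶ Z) (hx : x ≫ g = 0) : ∃ y : X ⟶ A, y ≫ f = x := by
  obtain ⟨y, hy⟩ := Triangle.coyoneda_exact₂ _ H x hx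
  exact ⟨y, hy.symm⟩
/-- maps out of Z killed by f extend to B -/
lemma DT.desc {A Z B : T} {f : A ⟶ Z} {g : Z ⟶ B} {h : B ⟶ A⟦(1:ℤ)⟧} (H : DT f g h)
    {X : T} (x : Z ⟶ X) (hx : f ≫ x = 0) : ∃ y : B ⟶ X, g ≫ y = x := by
  obtain ⟨y, hy⟩ := Triangle.yoneda_exact₂ _ H x hx
  exact ⟨y, hy.symm⟩

lemma exists_cone {A Z : T} (f : A ⟶ Z) : ∃ (B : T) (g : Z ⟶ B) (h : B ⟶ A⟦(1:ℤ)⟧), DT f g h :=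
  distinguished_cocone_triangle f
lemma exists_fib {Z B : T} (g : Z ⟶ B) : ∃ (A : T) (f : A ⟶ Z) (h : B ⟶ A⟦(1:ℤ)⟧), DT f g h :=
  distinguished_cocone_triangle₁ g
lemma exists_mid {B A : T} (h : B ⟶ A⟦(1:ℤ)⟧) :
    ∃ (Z : T) (f : A ⟶ Z) (g : Z ⟶ B), DT f g h :=
  distinguished_cocone_triangle₂ h

lemma DT.tr3 {A Z B A' Z' B' : T} {f : A ⟶ Z} {g : Z ⟶ B} {h : B ⟶ A⟦(1:ℤ)⟧} (H : DT f g h)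
    {f' : A' ⟶ Z'} {g' : Z' ⟶ B'} {h' : B' ⟶ A'⟦(1:ℤ)⟧} (H' : DT f' g' h')
    (a : A ⟶ A') (b : Z ⟶ Z') (e : f ≫ b = a ≫ f') :
    ∃ c : B ⟶ B', g ≫ c = b ≫ g' ∧ h ≫ a⟦(1:ℤ)⟧' = c ≫ h' :=
  complete_distinguished_triangle_morphism _ _ H H' a b e

lemma DT.tr3' {A Z B A' Z' B' : T} {f : A ⟶ Z} {g : Z ⟶ B} {h : B ⟶ A⟦(1:ℤ)⟧} (H : DT f g h)
    {f' : A' ⟶ Z'} {g' : Z' ⟶ B'} {h' : B' ⟶ A'⟦(1:ℤ)⟧} (H' : DT f' g' h')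
    (b : Z ⟶ Z') (c : B ⟶ B') (e : g ≫ c = b ≫ g') :
    ∃ a : A ⟶ A', f ≫ b = a ≫ f' ∧ h ≫ a⟦(1:ℤ)⟧' = c ≫ h' :=
  complete_distinguished_triangle_morphism₁ _ _ H H' b c e

/-- zero map in a triangle gives retract -/
lemma DT.retr_of_g_zero {A Z B : T} {f : A ⟶ Z} {g : Z ⟶ B} {h : B ⟶ A⟦(1:ℤ)⟧} (H : DT f g h)
    (hg : g = 0) : ∃ r : Z ⟶ A, r ≫ f = 𝟙 Z :=
  H.lift (𝟙 Z) (by simp [hg])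

/-- A cohomological functor -/
structure CohF (T : Type*) [Category T] [Preadditive T] [HasZeroObject T]
  [HasShift T ℤ] [∀ n : ℤ, (CategoryTheory.shiftFunctor T n).Additive] [Pretriangulated T] where
  obj : T → Type w
  grp : ∀ X, AddCommGroup (obj X)
  map : ∀ {X Y : T}, (X ⟶ Y) → (obj X →+ obj Y)
  map_id : ∀ {X : T} (x : obj X), map (𝟙 X) x = x
  map_comp : ∀ {X Y Z : T} (f : X ⟶ Y) (g : Y ⟶ Z) (x : obj X), map (f ≫ g) x = map g (map f x)
  map_add : ∀ {X Y : T} (f g : X ⟶ Y) (x : obj X), map (f + g) x = map f x + map g x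
  exact : ∀ {A Z B : T} (f : A ⟶ Z) (g : Z ⟶ B) (h : B ⟶ A⟦(1:ℤ)⟧),
    DT f g h → ∀ x, map g x = 0 → ∃ y, map f y = x

namespace CohF

instance (F : CohF.{w} T) (X : T) : AddCommGroup (F.obj X) := F.grp X

variable (F : CohF.{w} T)

/-- the map as additive map of morphisms -/
def mapHom {X Y : T} (x : F.obj X) : (X ⟶ Y) →+ F.obj Y :=
  AddMonoidHom.mk' (fun f => F.map f x) (fun f g => F.map_add f g x)

lemma mapHom_apply {X Y : T} (x : F.obj X) (f : X ⟶ Y) : F.mapHom x f = F.map f x := rfl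

@[simp] lemma map_zero' {X Y : T} (x : F.obj X) : F.map (0 : X ⟶ Y) x = 0 :=
  (F.mapHom x).map_zero
lemma map_neg' {X Y : T} (f : X ⟶ Y) (x : F.obj X) : F.map (-f) x = - F.map f x :=
  (F.mapHom x).map_neg f
lemma map_sub' {X Y : T} (f g : X ⟶ Y) (x : F.obj X) : F.map (f - g) x = F.map f x - F.map g x :=
  (F.mapHom x).map_sub f g

lemma map_inv {X Y : T} (e : X ≅ Y) (x : F.obj X) : F.map e.inv (F.map e.hom x) = x := by
  rw [← F.map_comp, e.hom_inv_id, F.map_id]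
lemma map_hom {X Y : T} (e : X ≅ Y) (x : F.obj Y) : F.map e.hom (F.map e.inv x) = x := by
  rw [← F.map_comp, e.inv_hom_id, F.map_id]

lemma map_comp_zero {X Y Z : T} (f : X ⟶ Y) (g : Y ⟶ Z) (h : f ≫ g = 0) (x : F.obj X) :
    F.map g (F.map f x) = 0 := by rw [← F.map_comp, h, F.map_zero']

/-- vanishing in degree k -/
def van (X : T) (k : ℤ) : Prop := ∀ x : F.obj (X⟦k⟧), x = 0

/-- vanishing -/
def vn (X : T) : Prop := ∀ x : F.obj X, x = 0

lemma vn_retr {X Y : T} (i : X ⟶ Y) (r : Y ⟶ X) (h : i ≫ r = 𝟙 X) (H : F.vn Y) : F.vn X := by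
  intro x
  rw [← F.map_id x, ← h, F.map_comp, H (F.map i x), map_zero]

lemma vn_iso {X Y : T} (e : X ≅ Y) (H : F.vn Y) : F.vn X := F.vn_retr e.hom e.inv e.hom_inv_id H

lemma vn_zero {X : T} (h : IsZero X) : F.vn X := by
  intro x
  rw [← F.map_id x, h.eq_of_src (𝟙 X) 0, F.map_zero']

lemma vn_mid {A Z B : T} {f : A ⟶ Z} {g : Z ⟶ B} {h : B ⟶ A⟦(1:ℤ)⟧} (H : DT f g h)
    (hA : F.vn A) (hB : F.vn B) : F.vn Z := by
  intro x
  obtain ⟨y, rfl⟩ := F.exact f g h H x (hB _)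
  rw [hA y, map_zero]

lemma van_iso {X Y : T} (e : X ≅ Y) (k : ℤ) (H : F.van Y k) : F.van X k :=
  F.vn_iso ((shiftFunctor T k).mapIso e) H

lemma van_retr {X Y : T} (i : X ⟶ Y) (r : Y ⟶ X) (h : i ≫ r = 𝟙 X) (k : ℤ) (H : F.van Y k) :
    F.van X k :=
  F.vn_retr (i⟦k⟧') (r⟦k⟧') (by rw [← Functor.map_comp, h, CategoryTheory.Functor.map_id]) H

lemma van_zero {X : T} (h : IsZero X) (k : ℤ) : F.van X k :=
  F.vn_zero (Functor.map_isZero _ h)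

lemma van_shift (X : T) (a k : ℤ) : F.van (X⟦a⟧) k ↔ F.van X (a + k) :=
  ⟨F.vn_iso ((shiftFunctorAdd T a k).app X), F.vn_iso ((shiftFunctorAdd T a k).app X).symm⟩

lemma van_shift' (X : T) (a k m : ℤ) (h : a + k = m) : F.van (X⟦a⟧) k ↔ F.van X m := by
  subst h; exact F.van_shift X a k

lemma van_zero_iff (X : T) : F.van X 0 ↔ F.vn X :=
  ⟨F.vn_iso ((shiftFunctorZero T ℤ).app X).symm, F.vn_iso ((shiftFunctorZero T ℤ).app X)⟩

lemma vn_shift_iff (X : T) (a : ℤ) : F.vn (X⟦a⟧) ↔ F.van X a := Iff.rfl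

section
variable {F}
variable {A Z B : T} {f : A ⟶ Z} {g : Z ⟶ B} {h : B ⟶ A⟦(1:ℤ)⟧}

lemma van_mid (H : DT f g h) (k : ℤ) (hA : F.van A k) (hB : F.van B k) : F.van Z k :=
  F.vn_mid (H.sh k) hA hB

lemma van_three (H : DT f g h) (k : ℤ) (hZ : F.van Z k) (hA : F.van A (k+1)) : F.van B k :=
  van_mid H.rot k hZ ((F.van_shift' _ _ _ _ (by ring)).2 hA)

lemma van_one (H : DT f g h) (k : ℤ) (hZ : F.van Z k) (hB : F.van B (k-1)) : F.van A k := by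
  obtain ⟨u, v, H'⟩ := H.irot
  exact van_mid H' k ((F.van_shift' _ _ _ _ (by ring)).2 hB) hZ

/-- injectivity of f -/
lemma inj_f (H : DT f g h) (k : ℤ) (hB : F.van B (k-1)) (y : F.obj (A⟦k⟧))
    (hy : F.map (f⟦k⟧') y = 0) : y = 0 := by
  obtain ⟨u, v, H'⟩ := H.irot
  obtain ⟨w, rfl⟩ := F.exact _ _ _ (H'.sh k) y hy
  have : F.van (B⟦(-1:ℤ)⟧) k := (F.van_shift' _ _ _ _ (by ring)).2 hB
  rw [this w, map_zero]

lemma inj_g (H : DT f g h) (k : ℤ) (hA : F.van A k) (y : F.obj (Z⟦k⟧))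
    (hy : F.map (g⟦k⟧') y = 0) : y = 0 := by
  obtain ⟨w, rfl⟩ := F.exact _ _ _ (H.sh k) y hy
  rw [hA w, map_zero]

lemma surj_g (H : DT f g h) (k : ℤ) (hA : F.van A (k+1)) (x : F.obj (B⟦k⟧)) :
    ∃ y, F.map (g⟦k⟧') y = x := by
  refine F.exact _ _ _ (H.rot.sh k) x ?_
  have : F.van (A⟦(1:ℤ)⟧) k := (F.van_shift' _ _ _ _ (by ring)).2 hA
  exact this _

lemma surj_f (H : DT f g h) (k : ℤ) (hB : F.van B k) (x : F.obj (Z⟦k⟧)) :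
    ∃ y, F.map (f⟦k⟧') y = x := F.exact _ _ _ (H.sh k) x (hB _)

end

/-- action of the center -/
instance mod (X : T) : Module (CatCenter T) (F.obj X) where
  smul z x := F.map (z.app X) x
  one_smul x := F.map_id x
  mul_smul a b x := by
    change F.map ((a * b).app X) x = F.map (a.app X) (F.map (b.app X) x)
    rw [CatCenter.mul_app', F.map_comp]
  smul_zero z := map_zero _
  smul_add z x y := _root_.map_add _ x y
  add_smul a b x := by
    change F.map ((a + b).app X) x = F.map (a.app X) x + F.map (b.app X) x
    rw [← F.map_add]; rfl
  zero_smul x := F.map_zero' x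

lemma smul_def {X : T} (z : CatCenter T) (x : F.obj X) : z • x = F.map (z.app X) x := rfl

/-- linear version of map -/
def lmap {X Y : T} (f : X ⟶ Y) : F.obj X →ₗ[CatCenter T] F.obj Y where
  toFun := F.map f
  map_add' x y := _root_.map_add _ x y
  map_smul' z x := by
    change F.map f (F.map (z.app X) x) = F.map (z.app Y) (F.map f x)
    rw [← F.map_comp, ← F.map_comp, z.naturality]

@[simp] lemma lmap_apply {X Y : T} (f : X ⟶ Y) (x : F.obj X) : F.lmap f x = F.map f x := rfl

/-- length -/
noncomputable def len (X : T) : ℕ∞ := Module.length (CatCenter T) (F.obj X)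

/-- finite length -/
def FL (X : T) : Prop := F.len X ≠ ⊤

end CohF

/-- a natural transformation of cohomological functors, as linear map -/
def natL (F G : CohF.{w} T) (φ : ∀ X, F.obj X →+ G.obj X)
    (hφ : ∀ {X Y : T} (f : X ⟶ Y) (x : F.obj X), φ Y (F.map f x) = G.map f (φ X x)) (X : T) :
    F.obj X →ₗ[CatCenter T] G.obj X where
  toFun := φ X
  map_add' x y := map_add _ x y
  map_smul' z x := hφ (z.app X) x

/-- Hom functor -/
def homF (N : T) : CohF T where
  obj X := N ⟶ X
  grp X := inferInstance
  map f := AddMonoidHom.mk' (fun x => x ≫ f) (fun a b => Preadditive.add_comp _ _ _ _ _ _)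
  map_id x := Category.comp_id x
  map_comp f g x := (Category.assoc _ _ _).symm
  map_add f g x := Preadditive.comp_add _ _ _ _ _ _
  exact f g h H x hx := H.lift x hx

@[simp] lemma homF_map {N X Y : T} (f : X ⟶ Y) (x : N ⟶ X) : (homF N).map f x = x ≫ f := rfl

/-- shifted functor -/
noncomputable def shiftF (F : CohF.{w} T) (k : ℤ) : CohF.{w} T where
  obj X := F.obj (X⟦k⟧)
  grp X := inferInstance
  map f := F.map (f⟦k⟧')
  map_id x := by rw [CategoryTheory.Functor.map_id, F.map_id]
  map_comp f g x := by rw [Functor.map_comp, F.map_comp]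
  map_add f g x := by rw [Functor.map_add, F.map_add]
  exact f g h H x hx := F.exact _ _ _ (H.sh k) x hx

/-- Hom(X, Y[k]) = 0 -/
def V (X Y : T) (k : ℤ) : Prop := ∀ f : X ⟶ Y⟦k⟧, f = 0

lemma V_iff_van (X Y : T) (k : ℤ) : V X Y k ↔ (homF X).van Y k := Iff.rfl

/-- Hom(X,Y) = 0 -/
def V0 (X Y : T) : Prop := ∀ f : X ⟶ Y, f = 0

lemma V0_iff_vn (X Y : T) : V0 X Y ↔ (homF X).vn Y := Iff.rfl

lemma V0_shift (X Y : T) (a : ℤ) : V0 (X⟦a⟧) (Y⟦a⟧) ↔ V0 X Y := by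
  constructor
  · intro H f
    apply (shiftFunctor T a).map_injective
    rw [H (f⟦a⟧'), Functor.map_zero]
  · intro H f
    obtain ⟨g, rfl⟩ := (shiftFunctor T a).map_surjective f
    rw [H g, Functor.map_zero]

lemma V0_iso_src {X X' Y : T} (e : X ≅ X') (h : V0 X Y) : V0 X' Y := by
  intro f
  rw [← Category.id_comp f, ← e.inv_hom_id, Category.assoc, h (e.hom ≫ f), comp_zero]

lemma V0_iso_tgt {X Y Y' : T} (e : Y ≅ Y') (h : V0 X Y) : V0 X Y' := 
  (homF X).vn_iso e.symm h

lemma V_tgt (X Y : T) (b k m : ℤ) (h : b + k = m) : V X (Y⟦b⟧) k ↔ V X Y m :=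
  (homF X).van_shift' Y b k m h

lemma V_src (X Y : T) (a k m : ℤ) (h : m + a = k) : V (X⟦a⟧) Y k ↔ V X Y m := by
  subst h
  have e := (shiftFunctorAdd T m a).app Y
  change V0 _ _ ↔ V0 _ _
  rw [← V0_shift X (Y⟦m⟧) a]
  exact ⟨V0_iso_tgt e, V0_iso_tgt e.symm⟩

lemma V_zero_iff (X Y : T) : V X Y 0 ↔ V0 X Y := (homF X).van_zero_iff Y

lemma V0_src (X Y : T) (a m : ℤ) (h : m + a = 0) : V0 (X⟦a⟧) Y ↔ V X Y m := by
  rw [← V_zero_iff, V_src X Y a 0 m h]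

section
variable {A Z B : T} {f : A ⟶ Z} {g : Z ⟶ B} {h : B ⟶ A⟦(1:ℤ)⟧}

lemma V0_mid' (H : DT f g h) (Y : T) (hA : V0 A Y) (hB : V0 B Y) : V0 Z Y := by
  intro x
  obtain ⟨y, rfl⟩ := H.desc x (hA _)
  rw [hB y, comp_zero]

lemma V_mid' (H : DT f g h) (Y : T) (k : ℤ) (hA : V A Y k) (hB : V B Y k) : V Z Y k :=
  V0_mid' H _ hA hB

lemma V_three' (H : DT f g h) (Y : T) (k : ℤ) (hZ : V Z Y k) (hA : V A Y (k-1)) : V B Y k :=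
  V_mid' H.rot Y k hZ ((V_src _ _ _ _ _ (by ring)).2 hA)

lemma V_one' (H : DT f g h) (Y : T) (k : ℤ) (hZ : V Z Y k) (hB : V B Y (k+1)) : V A Y k := by
  obtain ⟨u, v, H'⟩ := H.irot
  exact V_mid' H' Y k ((V_src _ _ _ _ _ (by ring)).2 hB) hZ

lemma V_mid (H : DT f g h) (X : T) (k : ℤ) (hA : V X A k) (hB : V X B k) : V X Z k :=
  CohF.van_mid (F := homF X) H k hA hB
lemma V_three (H : DT f g h) (X : T) (k : ℤ) (hZ : V X Z k) (hA : V X A (k+1)) : V X B k :=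
  CohF.van_three (F := homF X) H k hZ hA
lemma V_one (H : DT f g h) (X : T) (k : ℤ) (hZ : V X Z k) (hB : V X B (k-1)) : V X A k :=
  CohF.van_one (F := homF X) H k hZ hB
end

lemma V_iso_src {X X' : T} (e : X ≅ X') (Y : T) (k : ℤ) (h : V X Y k) : V X' Y k :=
  V0_iso_src e h

lemma V_retr_src {X Y : T} (i : X ⟶ Y) (r : Y ⟶ X) (h : i ≫ r = 𝟙 X) (Z : T) (k : ℤ)
    (H : V Y Z k) : V X Z k := by
  intro f
  rw [← Category.id_comp f, ← h, Category.assoc, H (r ≫ f), comp_zero]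

lemma V_zero_src {X : T} (h : IsZero X) (Y : T) (k : ℤ) : V X Y k := fun f => h.eq_of_src _ _

lemma isZero_of_id {X : T} (h : V0 X X) : IsZero X := (IsZero.iff_id_eq_zero X).2 (h _)


lemma fl_transfer {R R' M M' : Type*} [Ring R] [Ring R'] [AddCommGroup M] [AddCommGroup M']
    [Module R M] [Module R' M'] (e : M' →+ M) (he : Function.Injective e)
    (hr : ∀ r : R, ∃ r' : R', ∀ m, e (r' • m) = r • e m) (h : IsFiniteLength R M) :
    IsFiniteLength R' M' := by
  rw [isFiniteLength_iff_isNoetherian_isArtinian] at h ⊢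
  let G : Submodule R' M' → Submodule R M := fun K =>
    { carrier := e '' K
      add_mem' := by
        rintro _ _ ⟨a, ha, rfl⟩ ⟨b, hb, rfl⟩
        exact ⟨a + b, K.add_mem ha hb, map_add _ _ _⟩
      zero_mem' := ⟨0, K.zero_mem, map_zero _⟩
      smul_mem' := by
        rintro r _ ⟨a, ha, rfl⟩
        obtain ⟨r', h'⟩ := hr r
        exact ⟨r' • a, K.smul_mem _ ha, h' a⟩ }
  have hG : StrictMono G := by
    intro K L hKL
    rw [SetLike.lt_iff_le_and_exists] at hKL ⊢
    obtain ⟨h1, x, hx, hx'⟩ := hKL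
    refine ⟨fun _ ⟨a, ha, hh⟩ => ⟨a, h1 ha, hh⟩, e x, ⟨x, hx, rfl⟩, ?_⟩
    rintro ⟨a, ha, hh⟩
    exact hx' (he hh ▸ ha)
  obtain ⟨h1, h2⟩ := h
  have h1' : WellFoundedGT (Submodule R M) := (isNoetherian_iff' ).1 h1
  have h2' : WellFoundedLT (Submodule R M) := h2
  exact ⟨isNoetherian_iff'.2 hG.wellFoundedGT, (hG.wellFoundedLT : WellFoundedLT _)⟩

lemma length_le_exact {R M N P : Type*} [Ring R] [AddCommGroup M] [AddCommGroup N]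
    [AddCommGroup P] [Module R M] [Module R N] [Module R P] (f : M →ₗ[R] N) (g : N →ₗ[R] P)
    (h : ∀ x, g x = 0 → ∃ y, f y = x) :
    Module.length R N ≤ Module.length R M + Module.length R P := by
  have e1 : Module.length R N = Module.length R (LinearMap.ker g) +
      Module.length R (LinearMap.range g) :=
    Module.length_eq_add_of_exact (LinearMap.ker g).subtype g.rangeRestrict
      Subtype.val_injective g.surjective_rangeRestrict (by
        intro x
        constructor
        · intro hx
          exact ⟨⟨x, congrArg Subtype.val hx⟩, rfl⟩
        · rintro ⟨y, rfl⟩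
          exact Subtype.ext y.2)
  rw [e1]
  refine add_le_add ?_ (Module.length_le_of_injective (LinearMap.range g).subtype
    Subtype.val_injective)
  have e2 : LinearMap.ker g ≤ LinearMap.range f := fun x hx => by
    obtain ⟨y, rfl⟩ := h x hx
    exact ⟨y, rfl⟩
  exact (Module.length_le_of_injective (Submodule.inclusion e2)
    (Submodule.inclusion_injective e2)).trans
    (Module.length_le_of_surjective f.rangeRestrict f.surjective_rangeRestrict)

namespace CohF
variable (F : CohF.{w} T)

lemma len_mid {A Z B : T} {f : A ⟶ Z} {g : Z ⟶ B} {h : B ⟶ A⟦(1:ℤ)⟧} (H : DT f g h) :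
    F.len Z ≤ F.len A + F.len B := length_le_exact (F.lmap f) (F.lmap g) (F.exact f g h H)

lemma FL_mid {A Z B : T} {f : A ⟶ Z} {g : Z ⟶ B} {h : B ⟶ A⟦(1:ℤ)⟧} (H : DT f g h)
    (hA : F.FL A) (hB : F.FL B) : F.FL Z :=
  ne_top_of_le_ne_top (WithTop.add_ne_top.2 ⟨hA, hB⟩) (F.len_mid H)

lemma len_retr {X Y : T} (i : X ⟶ Y) (r : Y ⟶ X) (h : i ≫ r = 𝟙 X) : F.len X ≤ F.len Y :=
  Module.length_le_of_surjective (F.lmap r) (fun x => ⟨F.map i x, by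
    rw [lmap_apply, ← F.map_comp, h, F.map_id]⟩)

lemma FL_retr {X Y : T} (i : X ⟶ Y) (r : Y ⟶ X) (h : i ≫ r = 𝟙 X) (H : F.FL Y) : F.FL X :=
  ne_top_of_le_ne_top H (F.len_retr i r h)

lemma FL_iso {X Y : T} (e : X ≅ Y) (H : F.FL Y) : F.FL X := F.FL_retr e.hom e.inv e.hom_inv_id H

lemma len_eq_zero {X : T} : F.len X = 0 ↔ F.vn X := by
  rw [len, Module.length_eq_zero_iff]
  exact ⟨fun h x => Subsingleton.elim _ _, fun h => ⟨fun a b => (h a).trans (h b).symm⟩⟩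

lemma FL_vn {X : T} (h : F.vn X) : F.FL X := by
  rw [FL, F.len_eq_zero.2 h]; exact ENat.zero_ne_top

lemma FL.noeth {F : CohF.{w} T} {X : T} (h : F.FL X) : IsNoetherian (CatCenter T) (F.obj X) :=
  (isFiniteLength_iff_isNoetherian_isArtinian.1 (Module.length_ne_top_iff.1 h)).1
lemma FL.artin {F : CohF.{w} T} {X : T} (h : F.FL X) : IsArtinian (CatCenter T) (F.obj X) :=
  (isFiniteLength_iff_isNoetherian_isArtinian.1 (Module.length_ne_top_iff.1 h)).2
end CohF

/-- precomposition -/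
def preL {A B : T} (f : A ⟶ B) (Y : T) : (homF B).obj Y →ₗ[CatCenter T] (homF A).obj Y :=
  natL (homF B) (homF A) (fun X => AddMonoidHom.mk' (fun x => f ≫ x)
    (fun a b => Preadditive.comp_add _ _ _ _ _ _)) (fun g x => (Category.assoc _ _ _).symm) Y

lemma preL_apply {A B : T} (f : A ⟶ B) (Y : T) (x : B ⟶ Y) : preL f Y x = f ≫ x := rfl

/-- all homs from N have finite length -/
def FLs (N : T) : Prop := ∀ X, (homF N).FL X

lemma FL_mid' {A Z B : T} {f : A ⟶ Z} {g : Z ⟶ B} {h : B ⟶ A⟦(1:ℤ)⟧} (H : DT f g h) (Y : T)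
    (hA : (homF A).FL Y) (hB : (homF B).FL Y) : (homF Z).FL Y :=
  ne_top_of_le_ne_top (WithTop.add_ne_top.2 ⟨hB, hA⟩)
    (length_le_exact (preL g Y) (preL f Y) (fun x hx => H.desc x hx))

lemma len_retr_src {X Y : T} (i : X ⟶ Y) (r : Y ⟶ X) (h : i ≫ r = 𝟙 X) (Z : T) :
    (homF X).len Z ≤ (homF Y).len Z :=
  Module.length_le_of_surjective (preL i Z) (fun (x : X ⟶ Z) => ⟨(r ≫ x : Y ⟶ Z), by
    change i ≫ r ≫ x = x
    rw [← Category.assoc, h, Category.id_comp]⟩)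

lemma FL_retr_src {X Y : T} (i : X ⟶ Y) (r : Y ⟶ X) (h : i ≫ r = 𝟙 X) (Z : T)
    (H : (homF Y).FL Z) : (homF X).FL Z := ne_top_of_le_ne_top H (len_retr_src i r h Z)

/-- conjugate central element -/
noncomputable def centSh (z : CatCenter T) (n : ℤ) : CatCenter T :=
  { app := fun X => (shiftFunctor T n).preimage (z.app (X⟦n⟧))
    naturality := fun X Y f => by
      apply (shiftFunctor T n).map_injective
      simp only [Functor.id_obj, Functor.id_map, Functor.map_comp, Functor.map_preimage]
      exact z.naturality _ }

lemma centSh_app (z : CatCenter T) (n : ℤ) (X : T) :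
    ((centSh z n).app X)⟦n⟧' = z.app (X⟦n⟧) := (shiftFunctor T n).map_preimage _

lemma FL_shift (N : T) (n : ℤ) (X : T) (h : (homF N).FL (X⟦-n⟧)) : (homF (N⟦n⟧)).FL X := by
  have u := ((shiftFunctorCompIsoId T n (-n) (by ring)).app N).symm
  refine Module.length_ne_top_iff.2 (fl_transfer (R := CatCenter T) (M := (homF N).obj (X⟦-n⟧))
    (AddMonoidHom.mk' (fun x : N⟦n⟧ ⟶ X => (u.hom ≫ x⟦-n⟧' : N ⟶ X⟦-n⟧))
      (fun (a b : N⟦n⟧ ⟶ X) => by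
        change u.hom ≫ (shiftFunctor T (-n)).map (a + b : N⟦n⟧ ⟶ X) = _
        rw [Functor.map_add, Preadditive.comp_add]; rfl)) ?_ ?_ (Module.length_ne_top_iff.1 h))
  · rw [injective_iff_map_eq_zero]
    intro (a : N⟦n⟧ ⟶ X) ha
    have ha' : u.hom ≫ (shiftFunctor T (-n)).map (a : N⟦n⟧ ⟶ X) = 0 := ha
    apply (shiftFunctor T (-n)).map_injective
    change (shiftFunctor T (-n)).map (a : N⟦n⟧ ⟶ X) = (shiftFunctor T (-n)).map (0 : N⟦n⟧ ⟶ X)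
    rw [Functor.map_zero, ← cancel_epi u.hom, ha', comp_zero]
  · intro r
    refine ⟨centSh r (-n), fun (m : N⟦n⟧ ⟶ X) => ?_⟩
    change u.hom ≫ (shiftFunctor T (-n)).map ((m : N⟦n⟧ ⟶ X) ≫ (centSh r (-n)).app X) =
      (u.hom ≫ (shiftFunctor T (-n)).map (m : N⟦n⟧ ⟶ X)) ≫ r.app _
    rw [Functor.map_comp, centSh_app, Category.assoc]

lemma FLs_thick {S : Set T} (h : ∀ s ∈ S, FLs s) {N : T} (hN : thick S N) : FLs N := by
  induction hN with
  | of hX => exact h _ hX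
  | zero hX => exact fun X => (homF _).FL_vn (fun x => hX.eq_of_src _ _)
  | shift hX n ih => exact fun X => FL_shift _ _ _ (ih _)
  | ext f g h hT hA hB iA iB => exact fun X => FL_mid' hT X (iA X) (iB X)
  | smd i r hir hY ih => exact fun X => FL_retr_src i r hir X (ih X)

lemma FLs_of_R {R : Type*} [CommRing R] [CategoryTheory.Linear R T] (M : T)
    (h : ∀ X : T, IsFiniteLength R (M ⟶ X)) : FLs M := by
  intro X
  refine Module.length_ne_top_iff.2 (fl_transfer (R := R) (M := M ⟶ X)
    (AddMonoidHom.mk' (fun x : (homF M).obj X => (x : M ⟶ X)) (fun a b => rfl)) (fun a b h => h) ?_ (h X))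
  intro r
  refine ⟨Linear.toCatCenter R T r, fun (m : M ⟶ X) => ?_⟩
  change (m : M ⟶ X) ≫ (r • 𝟙 X) = r • (m : M ⟶ X)
  rw [Linear.comp_smul, Category.comp_id]

/-! thick -/

lemma thick_iso {S : Set T} {X Y : T} (e : X ≅ Y) (h : thick S X) : thick S Y :=
  thick.smd e.inv e.hom e.inv_hom_id h

lemma thick_trans {S S' : Set T} (h : ∀ s ∈ S, thick S' s) {X : T} (hX : thick S X) :
    thick S' X := by
  induction hX with
  | of hX => exact h _ hX
  | zero hX => exact thick.zero hX
  | shift hX n ih => exact ih.shift n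
  | ext f g h hT hA hB iA iB => exact thick.ext f g h hT iA iB
  | smd i r hir hY ih => exact thick.smd i r hir ih

lemma thick_mono {S S' : Set T} (h : S ⊆ S') {X : T} (hX : thick S X) : thick S' X :=
  thick_trans (fun s hs => thick.of (h hs)) hX

lemma thick_three {S : Set T} {A Z B : T} {f : A ⟶ Z} {g : Z ⟶ B} {h : B ⟶ A⟦(1:ℤ)⟧} (H : DT f g h)
    (hA : thick S A) (hZ : thick S Z) : thick S B := thick.ext _ _ _ H.rot hZ (hA.shift 1)

lemma thick_one {S : Set T} {A Z B : T} {f : A ⟶ Z} {g : Z ⟶ B} {h : B ⟶ A⟦(1:ℤ)⟧} (H : DT f g h)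
    (hZ : thick S Z) (hB : thick S B) : thick S A := by
  obtain ⟨u, v, H'⟩ := H.irot
  exact thick.ext _ _ _ H' (hB.shift (-1)) hZ

lemma thick_fin {S : Set T} {X : T} (h : thick S X) :
    ∃ S₀ ⊆ S, S₀.Finite ∧ thick S₀ X := by
  induction h with
  | @of X hX => exact ⟨{X}, by simpa using hX, Set.finite_singleton _, thick.of rfl⟩
  | zero hX => exact ⟨∅, by simp, Set.finite_empty, thick.zero hX⟩
  | shift hX n ih => obtain ⟨s, h1, h2, h3⟩ := ih; exact ⟨s, h1, h2, h3.shift n⟩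
  | ext f g h hT hA hB iA iB =>
    obtain ⟨s, h1, h2, h3⟩ := iA
    obtain ⟨s', h1', h2', h3'⟩ := iB
    exact ⟨s ∪ s', Set.union_subset h1 h1', h2.union h2',
      thick.ext f g h hT (thick_mono Set.subset_union_left h3)
        (thick_mono Set.subset_union_right h3')⟩
  | smd i r hir hY ih =>
    obtain ⟨s, h1, h2, h3⟩ := ih; exact ⟨s, h1, h2, thick.smd i r hir h3⟩

lemma thick_unshift {S : Set T} {X : T} (n : ℤ) (h : thick S (X⟦n⟧)) : thick S X :=
  thick_iso ((shiftFunctorCompIsoId T n (-n) (by ring)).app X) (h.shift (-n))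

lemma van_thick (F : CohF.{w} T) {S : Set T} (h : ∀ s ∈ S, ∀ k, F.van s k) {X : T}
    (hX : thick S X) : ∀ k, F.van X k := by
  induction hX with
  | of hX => exact h _ hX
  | zero hX => exact F.van_zero hX
  | shift hX n ih => exact fun k => (F.van_shift _ _ _).2 (ih _)
  | ext f g h hT hA hB iA iB => exact fun k => CohF.van_mid hT k (iA k) (iB k)
  | smd i r hir hY ih => exact fun k => F.van_retr i r hir k (ih k)

lemma V_thick_src {S : Set T} {Z : T} (h : ∀ s ∈ S, ∀ k, V s Z k) {X : T}
    (hX : thick S X) : ∀ k, V X Z k := by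
  induction hX with
  | of hX => exact h _ hX
  | zero hX => exact V_zero_src hX Z
  | shift hX n ih => exact fun k => (V_src _ _ _ _ (k - n) (by ring)).2 (ih _)
  | ext f g h hT hA hB iA iB => exact fun k => V_mid' hT Z k (iA k) (iB k)
  | smd i r hir hY ih => exact fun k => V_retr_src i r hir Z k (ih k)

lemma gap {N X : T} (h : thick {N} X) : ∃ b : ℤ, 0 ≤ b ∧ ∀ (Z : T) (j : ℤ),
    (∀ i, j - b ≤ i → i ≤ j + b → V N Z i) → V X Z j := by
  induction h with
  | @of X hX =>
    obtain rfl : X = N := hX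
    exact ⟨0, le_rfl, fun Z j h => h j (by lia) (by lia)⟩
  | zero hX => exact ⟨0, le_rfl, fun Z j h => V_zero_src hX Z j⟩
  | shift hX n ih =>
    obtain ⟨b, hb, h⟩ := ih
    refine ⟨b + |n|, by positivity, fun Z j hh => (V_src _ _ _ _ (j - n) (by ring)).2 (h Z _ ?_)⟩
    intro i h1 h2
    have := abs_le.1 (le_refl |n|)
    exact hh i (by lia) (by lia)
  | ext f g h hT hA hB iA iB =>
    obtain ⟨b, hb, h⟩ := iA
    obtain ⟨b', hb', h'⟩ := iB
    exact ⟨b + b', by lia, fun Z j hh => V_mid' hT Z j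
      (h Z j fun i h1 h2 => hh i (by lia) (by lia)) (h' Z j fun i h1 h2 => hh i (by lia) (by lia))⟩
  | smd i r hir hY ih =>
    obtain ⟨b, hb, h⟩ := ih
    exact ⟨b, hb, fun Z j hh => V_retr_src i r hir Z j (h Z j hh)⟩

/-! sums -/

/-- finite sums of objects of S -/
inductive Sums (S : Set T) : T → Prop
  | zero {X : T} (h : IsZero X) : Sums S X
  | add {B Q : T} (hB : Sums S B) (hQ : Q ∈ S) : Sums S (B ⊞ Q)

lemma biprod_DT (A B : T) : DT (biprod.inl : A ⟶ A ⊞ B) biprod.snd (0 : B ⟶ A⟦(1:ℤ)⟧) :=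
  binaryBiproductTriangle_distinguished A B

lemma Sums.filt {S : Set T} {X : T} (h : Sums S X) : filt S X := by
  induction h with
  | zero h => exact .zero h
  | add hB hQ ih => exact .ext _ _ _ (biprod_DT _ _) ih (.of hQ)

lemma filt.thick {S : Set T} {X : T} (h : filt S X) : thick S X := by
  induction h with
  | of h => exact .of h
  | zero h => exact .zero h
  | ext f g h hT hA hB iA iB => exact .ext f g h hT iA iB

lemma filt_mono {S S' : Set T} (h : S ⊆ S') {X : T} (hX : filt S X) : filt S' X := by
  induction hX with
  | of hX => exact .of (h hX)
  | zero h => exact .zero h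
  | ext f g h hT hA hB iA iB => exact .ext f g h hT iA iB

lemma van_filt (F : CohF.{w} T) {S : Set T} {k : ℤ} (h : ∀ s ∈ S, F.van s k) {X : T}
    (hX : filt S X) : F.van X k := by
  induction hX with
  | of hX => exact h _ hX
  | zero hX => exact F.van_zero hX k
  | ext f g h hT hA hB iA iB => exact CohF.van_mid hT k iA iB

lemma V_filt_src {S : Set T} {k : ℤ} {Z : T} (h : ∀ s ∈ S, V s Z k) {X : T}
    (hX : filt S X) : V X Z k := by
  induction hX with
  | of hX => exact h _ hX
  | zero hX => exact V_zero_src hX Z k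
  | ext f g h hT hA hB iA iB => exact V_mid' hT Z k iA iB

lemma approx_step {N Q X : T} (p : Q ⟶ X) (a : N ⟶ X) (ψ : N ⟶ Q) (z : CatCenter T) :
    biprod.lift ψ (z.app N) ≫ biprod.desc p a = a ≫ z.app X + ψ ≫ p := by
  rw [biprod.lift_desc, ← z.naturality, add_comm]

/-- right approximation of a finitely generated submodule -/
lemma approx (N X : T) (K : Submodule (CatCenter T) ((homF N).obj X)) (hK : K.FG) :
    ∃ (Q : T) (p : Q ⟶ X), Sums {N} Q ∧
      (∀ φ : (homF N).obj X, φ ∈ K → ∃ ψ : N ⟶ Q, ψ ≫ p = φ) ∧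
      (∀ (Y : T) (g : X ⟶ Y), (∀ φ : (homF N).obj X, φ ∈ K → (homF N).map g φ = 0) →
        p ≫ g = 0) := by
  classical
  obtain ⟨s, rfl⟩ := hK
  induction s using Finset.induction_on with
  | empty =>
    refine ⟨Limits.HasZeroObject.zero' T |>.zero, 0, .zero (isZero_zero T), ?_, ?_⟩
    · intro φ hφ
      simp only [Finset.coe_empty, Submodule.span_empty, Submodule.mem_bot] at hφ
      exact ⟨0, by rw [zero_comp]; exact hφ.symm⟩
    · intro Y g _
      rw [zero_comp]
  | insert a s ha ih =>
    obtain ⟨Q, p, hQ, h1, h2⟩ := ih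
    refine ⟨Q ⊞ N, biprod.desc p a, hQ.add rfl, ?_, ?_⟩
    · intro φ hφ
      rw [Finset.coe_insert, Submodule.mem_span_insert] at hφ
      obtain ⟨z, b, hb, e⟩ := hφ
      obtain ⟨ψ, hψ⟩ := h1 b hb
      refine ⟨biprod.lift ψ (z.app N), (approx_step p a ψ z).trans ?_⟩
      rw [hψ]
      exact e.symm
    · intro Y g hg
      have hp := h2 Y g (fun φ hφ => hg φ
        (Submodule.span_mono (by rw [Finset.coe_insert]; exact Set.subset_insert _ _) hφ))
      have ha' := hg a (Submodule.subset_span (by simp))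
      apply biprod.hom_ext'
      · exact (biprod.inl_desc_assoc _ _ _).trans (hp.trans comp_zero.symm)
      · exact (biprod.inr_desc_assoc _ _ _).trans (Eq.trans ha' comp_zero.symm)

lemma approx_all (N X : T) (h : (homF N).FL X) : ∃ (Q : T) (p : Q ⟶ X), Sums {N} Q ∧
    ∀ φ : N ⟶ X, ∃ ψ : N ⟶ Q, ψ ≫ p = φ := by
  have := h.noeth
  obtain ⟨Q, p, hQ, h1, -⟩ := approx N X ⊤ (IsNoetherian.noetherian _)
  exact ⟨Q, p, hQ, fun φ => h1 φ trivial⟩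


namespace CohF
variable {F : CohF.{w} T}

lemma inj_transfer {Z B : T} (g : Z ⟶ B) (k a c : ℤ) (hk : a + c = k)
    (H : ∀ y : F.obj (Z⟦k⟧), F.map (g⟦k⟧') y = 0 → y = 0) (y : F.obj (Z⟦a⟧⟦c⟧))
    (hy : F.map (g⟦a⟧'⟦c⟧') y = 0) : y = 0 := by
  have nat := (shiftFunctorAdd' T a c k hk).inv.naturality g
  have h1 := H (F.map ((shiftFunctorAdd' T a c k hk).inv.app Z) y) (by
    rw [← F.map_comp, ← nat, F.map_comp]
    erw [hy]
    rw [_root_.map_zero])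
  have h2 := F.map_hom ((shiftFunctorAdd' T a c k hk).app Z) y
  rw [← h2]
  erw [h1]
  rw [_root_.map_zero]

lemma van_fib {A Z B : T} {f : A ⟶ Z} {g : Z ⟶ B} {h : B ⟶ A⟦(1:ℤ)⟧} (H : DT f g h) (k : ℤ)
    (hi : ∀ y : F.obj (Z⟦k⟧), F.map (g⟦k⟧') y = 0 → y = 0)
    (hs : ∀ x : F.obj (B⟦k-1⟧), ∃ y, F.map (g⟦k-1⟧') y = x) : F.van A k := by
  rw [← F.van_shift' A 1 (k-1) k (by ring)]
  intro x
  have e1 : F.map ((-f⟦(1:ℤ)⟧')⟦k-1⟧') x = 0 := by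
    apply inj_transfer g k 1 (k-1) (by ring) hi
    rw [← F.map_comp, ← Functor.map_comp, Preadditive.neg_comp, ← Functor.map_comp, H.zero12,
      Functor.map_zero, neg_zero, Functor.map_zero, F.map_zero']
  obtain ⟨y, rfl⟩ := F.exact _ _ _ (H.rot.rot.sh (k-1)) x e1
  obtain ⟨z, rfl⟩ := hs y
  rw [← F.map_comp, ← Functor.map_comp, H.zero23, Functor.map_zero, F.map_zero']

end CohF

section lege
variable {N : T}

lemma le_def {X : T} {n : ℤ} : X ∈ tleMn N n ↔ ∀ k, n < k → V N X k := Iff.rfl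
lemma ge_def {X : T} {n : ℤ} : X ∈ tgeMn N n ↔ ∀ k, k < n → V N X k := Iff.rfl

lemma le_mono {X : T} {n m : ℤ} (h : n ≤ m) (hX : X ∈ tleMn N n) : X ∈ tleMn N m :=
  fun k hk => hX k (by lia)
lemma ge_mono {X : T} {n m : ℤ} (h : m ≤ n) (hX : X ∈ tgeMn N n) : X ∈ tgeMn N m :=
  fun k hk => hX k (by lia)

lemma le_sh {X : T} {n : ℤ} (a m : ℤ) (h : n + a = m) : X⟦a⟧ ∈ tleMn N n ↔ X ∈ tleMn N m := by
  constructor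
  · intro H k hk
    exact (V_tgt N X a (k - a) k (by ring)).1 (H (k-a) (by lia))
  · intro H k hk
    exact (V_tgt N X a k (k + a) (by ring)).2 (H (k+a) (by lia))

lemma ge_sh {X : T} {n : ℤ} (a m : ℤ) (h : n + a = m) : X⟦a⟧ ∈ tgeMn N n ↔ X ∈ tgeMn N m := by
  constructor
  · intro H k hk
    exact (V_tgt N X a (k - a) k (by ring)).1 (H (k-a) (by lia))
  · intro H k hk
    exact (V_tgt N X a k (k + a) (by ring)).2 (H (k+a) (by lia))

lemma le_retr {X Y : T} {n : ℤ} (i : X ⟶ Y) (r : Y ⟶ X) (h : i ≫ r = 𝟙 X) (hY : Y ∈ tleMn N n) :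
    X ∈ tleMn N n := fun k hk => (homF N).van_retr i r h k (hY k hk)
lemma ge_retr {X Y : T} {n : ℤ} (i : X ⟶ Y) (r : Y ⟶ X) (h : i ≫ r = 𝟙 X) (hY : Y ∈ tgeMn N n) :
    X ∈ tgeMn N n := fun k hk => (homF N).van_retr i r h k (hY k hk)
lemma le_iso {X Y : T} {n : ℤ} (e : X ≅ Y) (hY : X ∈ tleMn N n) : Y ∈ tleMn N n :=
  le_retr e.inv e.hom e.inv_hom_id hY
lemma ge_iso {X Y : T} {n : ℤ} (e : X ≅ Y) (hY : X ∈ tgeMn N n) : Y ∈ tgeMn N n :=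
  ge_retr e.inv e.hom e.inv_hom_id hY
lemma le_zero {X : T} (n : ℤ) (h : IsZero X) : X ∈ tleMn N n := fun k _ => (homF N).van_zero h k
lemma ge_zero {X : T} (n : ℤ) (h : IsZero X) : X ∈ tgeMn N n := fun k _ => (homF N).van_zero h k

variable {A Z B : T} {f : A ⟶ Z} {g : Z ⟶ B} {h : B ⟶ A⟦(1:ℤ)⟧}

lemma le_mid (H : DT f g h) {n : ℤ} (hA : A ∈ tleMn N n) (hB : B ∈ tleMn N n) : Z ∈ tleMn N n :=
  fun k hk => V_mid H N k (hA k hk) (hB k hk)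
lemma ge_mid (H : DT f g h) {n : ℤ} (hA : A ∈ tgeMn N n) (hB : B ∈ tgeMn N n) : Z ∈ tgeMn N n :=
  fun k hk => V_mid H N k (hA k hk) (hB k hk)
lemma le_three (H : DT f g h) {n : ℤ} (hZ : Z ∈ tleMn N n) (hA : A ∈ tleMn N (n+1)) :
    B ∈ tleMn N n := fun k hk => V_three H N k (hZ k hk) (hA _ (by lia))
lemma ge_three (H : DT f g h) {n : ℤ} (hZ : Z ∈ tgeMn N n) (hA : A ∈ tgeMn N (n+1)) :
    B ∈ tgeMn N n := fun k hk => V_three H N k (hZ k hk) (hA _ (by lia))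
lemma le_one (H : DT f g h) {n : ℤ} (hZ : Z ∈ tleMn N n) (hB : B ∈ tleMn N (n-1)) :
    A ∈ tleMn N n := fun k hk => V_one H N k (hZ k hk) (hB _ (by lia))
lemma ge_one (H : DT f g h) {n : ℤ} (hZ : Z ∈ tgeMn N n) (hB : B ∈ tgeMn N (n-1)) :
    A ∈ tgeMn N n := fun k hk => V_one H N k (hZ k hk) (hB _ (by lia))
end lege

/-- presilting -/
def Pres (N : T) : Prop := ∀ n : ℤ, 0 < n → V N N n

lemma sums_van {N Q : T} (a k : ℤ) (h : V N N (-a + k)) (hQ : Sums {N⟦-a⟧} Q) : V N Q k := by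
  refine van_filt (homF N) ?_ hQ.filt
  intro s hs
  obtain rfl : s = N⟦-a⟧ := hs
  exact (V_tgt N N (-a) k _ rfl).2 h

lemma coneApx {N : T} (hp : Pres N) (hf : FLs N) (X : T) (a : ℤ) :
    ∃ (Q X' : T) (p : Q ⟶ X) (g : X ⟶ X') (h : X' ⟶ Q⟦(1:ℤ)⟧), DT p g h ∧ Sums {N⟦-a⟧} Q ∧
      V N X' a ∧ ∀ k, a < k → V N Q k := by
  obtain ⟨Q, p, hQ, hφ⟩ := approx_all (N⟦-a⟧) X (FL_shift _ _ _ (hf _))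
  obtain ⟨X', g, h, H⟩ := exists_cone p
  have hV : ∀ k, a < k → V N Q k := fun k hk => sums_van a k (hp _ (by lia)) hQ
  refine ⟨Q, X', p, g, h, H, hQ, ?_, hV⟩
  rw [← V0_src N X' (-a) a (by ring)]
  intro φ
  have h1 : V0 (N⟦-a⟧) (Q⟦(1:ℤ)⟧) := by
    rw [V0_src _ _ (-a) a (by ring), V_tgt _ _ _ _ _ rfl]
    exact hV _ (by lia)
  obtain ⟨ψ, rfl⟩ := H.rot.lift φ (h1 _)
  obtain ⟨χ, rfl⟩ := hφ ψ
  rw [Category.assoc, H.zero12, comp_zero]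

lemma apx {N : T} (hp : Pres N) (hf : FLs N) {X : T} {a : ℤ} (hX : X ∈ tleMn N a) :
    ∃ (Q X' : T) (p : Q ⟶ X) (g : X ⟶ X') (h : X' ⟶ Q⟦(1:ℤ)⟧), DT p g h ∧ Sums {N⟦-a⟧} Q ∧
      X' ∈ tleMn N (a-1) := by
  obtain ⟨Q, X', p, g, h, H, hQ, h1, h2⟩ := coneApx hp hf X a
  refine ⟨Q, X', p, g, h, H, hQ, fun k hk => ?_⟩
  rcases eq_or_lt_of_le (show a ≤ k by lia) with rfl | hk'
  · exact h1
  · exact V_three H N k (hX k hk') (h2 _ (by lia))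

/-- The good package -/
structure Good (D : Set T) (N : T) : Prop where
  pres : Pres N
  fl : FLs N
  hom : ∀ {X Y : T} {a b : ℤ}, X ∈ tleMn N a → Y ∈ tgeMn N b → a < b → V0 X Y
  trunc : ∀ (Z : T) (n : ℤ), ∃ (A B : T) (f : A ⟶ Z) (g : Z ⟶ B) (h : B ⟶ A⟦(1:ℤ)⟧), DT f g h ∧
    A ∈ tleMn N n ∧ B ∈ tgeMn N (n+1)
  bdd : ∀ X : T, ∃ n : ℤ, X ∈ tleMn N n
  eqD : ∀ X : T, X ∈ D ↔ ∃ n : ℤ, X ∈ tgeMn N n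

lemma good_of_ST {R : Type*} [CommRing R] [IsArtinianRing R] [CategoryTheory.Linear R T]
    {C D : Set T} {M : T} (h : IsSTTriple R C D M) : Good D M where
  pres := h.presilting
  fl := FLs_of_R M h.finLength
  bdd := h.exhaustT
  eqD := h.eqD
  hom := by
    intro X Y a b hX hY hab
    rw [← V0_shift X Y a]
    have h1 : X⟦a⟧ ∈ tleMn M 0 := (le_sh a a (by ring)).2 hX
    have h2 : Y⟦a⟧⟦(1:ℤ)⟧ ∈ tgeMn M 0 := by
      rw [ge_sh 1 1 (by ring), ge_sh a (a+1) (by ring)]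
      exact ge_mono (by lia) hY
    exact V0_iso_tgt ((shiftFunctorCompIsoId T (1:ℤ) (-1) (by ring)).app (Y⟦a⟧))
      (h.tstr.hom_zero _ h1 _ h2)
  trunc := by
    intro Z n
    obtain ⟨A, B, f, g, k, H, hA, Y, hY, rfl⟩ := h.tstr.exhaust (Z⟦n⟧)
    have H' := DT.sh (f := f) (g := g) (h := k) H (-n)
    let e := (shiftFunctorCompIsoId T n (-n) (by ring)).app Z
    refine ⟨_, _, (f⟦-n⟧') ≫ e.hom, e.inv ≫ (((g : Z⟦n⟧ ⟶ Y⟦(-1:ℤ)⟧)⟦-n⟧')),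
      (-n).negOnePow • (k⟦-n⟧') ≫ (shiftFunctorComm T 1 (-n)).hom.app A,
      H'.of_iso (Iso.refl _) e.symm (Iso.refl _) ?_ ?_ ?_, ?_, ?_⟩
    · simp
    · simp
    · simp
    · exact (le_sh _ _ (by ring)).2 hA
    · rw [ge_sh (-n) 1 (by ring), ge_sh (-1) 0 (by ring)]
      exact hY

lemma gap_lege {N M : T} (h : thick {N} M) : ∃ b : ℤ, 0 ≤ b ∧
    (∀ X n m, n + b ≤ m → X ∈ tleMn N n → X ∈ tleMn M m) ∧
    (∀ X n m, m + b ≤ n → X ∈ tgeMn N n → X ∈ tgeMn M m) ∧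
    (∀ Z j, (∀ i, j - b ≤ i → i ≤ j + b → V N Z i) → V M Z j) := by
  obtain ⟨b, hb, hg⟩ := gap h
  exact ⟨b, hb, fun X n m hm hX k hk => hg X k fun i h1 h2 => hX i (by lia),
    fun X n m hm hX k hk => hg X k fun i h1 h2 => hX i (by lia), hg⟩

/-- the descending approximation chain -/
lemma chain_le {N : T} (hp : Pres N) (hf : FLs N) {X Y : T} {a b : ℤ} (hX : X ∈ tleMn N a)
    (hY : Y ∈ tgeMn N b) (hab : a < b) (f : X ⟶ Y) (k : ℕ) :
    ∃ (X' : T) (u : X ⟶ X') (f' : X' ⟶ Y), X' ∈ tleMn N (a - k) ∧ u ≫ f' = f := by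
  induction k with
  | zero => exact ⟨X, 𝟙 X, f, by simpa using hX, by simp⟩
  | succ k ih =>
    obtain ⟨X', u, f', h1, rfl⟩ := ih
    obtain ⟨Q, X2, p, g, h, H, hQ, h2⟩ := apx hp hf h1
    have : V0 Q Y := by
      rw [← V_zero_iff]
      refine V_filt_src ?_ hQ.filt
      intro s hs
      obtain rfl : s = N⟦-(a-k)⟧ := hs
      exact (V_src _ _ _ _ (a - k) (by ring)).2 (hY _ (by lia))
    obtain ⟨f2, rfl⟩ := H.desc f' (this _)
    exact ⟨X2, u ≫ g, f2, le_mono (by push_cast; lia) h2, by simp⟩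

lemma trunc_tower {N : T} (hp : Pres N) (hf : FLs N) (Z : T) (n : ℤ) (k : ℕ) :
    ∃ (Z' : T) (u : Z ⟶ Z'), (∀ j, n - k < j → j ≤ n → V N Z' j) ∧
      ∀ j, n < j → Function.Bijective ((homF N).map (u⟦j⟧')) := by
  induction k with
  | zero => 
    refine ⟨Z, 𝟙 Z, fun j h1 h2 => by simp at h1; lia, fun j _ => ?_⟩
    rw [CategoryTheory.Functor.map_id]
    have : ⇑((homF N).map (𝟙 (Z⟦j⟧))) = id := funext fun x => (homF N).map_id x
    rw [this]
    exact Function.bijective_id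
  | succ k ih =>
    obtain ⟨Z1, u, h1, h2⟩ := ih
    obtain ⟨Q, X', p, g, h, H, hQ, h3, h4⟩ := coneApx hp hf Z1 (n - k)
    refine ⟨X', u ≫ g, ?_, ?_⟩
    · intro j hj hj'
      rcases eq_or_lt_of_le (show n - k ≤ j by push_cast at hj; lia) with rfl | hk'
      · exact h3
      · exact V_three H N j (h1 j hk' hj') (h4 _ (by lia))
    · intro j hj
      have e : ⇑((homF N).map ((u ≫ g)⟦j⟧')) =
          (homF N).map (g⟦j⟧') ∘ (homF N).map (u⟦j⟧') := funext fun x => by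
        rw [Functor.map_comp, (homF N).map_comp]; rfl
      rw [e]
      refine Function.Bijective.comp ⟨?_, ?_⟩ (h2 j hj)
      · exact (injective_iff_map_eq_zero _).2
          (CohF.inj_g (F := homF N) H j (h4 j (by lia)))
      · exact CohF.surj_g (F := homF N) H j (h4 _ (by lia))

/-- G -/
lemma good_transfer {D : Set T} {M N : T} (hM : Good D M) (hp : Pres N) (hMN : thick {M} N)
    (hNM : thick {N} M) : Good D N := by
  have hf : FLs N := FLs_thick (S := {M}) (fun s hs => by obtain rfl : s = M := hs; exact hM.fl) hMN
  obtain ⟨b, hb, le1, ge1, gap1⟩ := gap_lege hMN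
  obtain ⟨c, hc, le2, ge2, gap2⟩ := gap_lege hNM
  refine ⟨hp, hf, ?_, ?_, ?_, ?_⟩
  · intro X Y x y hX hY hxy f
    obtain ⟨X', u, f', h1, rfl⟩ := chain_le hp hf hX hY hxy f (2 * c).toNat
    have e : ((2 * c).toNat : ℤ) = 2 * c := Int.toNat_of_nonneg (by lia)
    rw [e] at h1
    have h2 : X' ∈ tleMn M (x - c) := le2 _ _ _ (by lia) h1
    have h3 : Y ∈ tgeMn M (y - c) := ge2 _ _ _ (by lia) hY
    rw [hM.hom h2 h3 (by lia) f', comp_zero]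
  · intro Z n
    obtain ⟨Z', u, h1, h2⟩ := trunc_tower hp hf Z n (2 * b + 2 * c).toNat
    have e : ((2 * b + 2 * c).toNat : ℤ) = 2 * b + 2 * c := Int.toNat_of_nonneg (by lia)
    rw [e] at h1
    obtain ⟨G, W, i, q, δ, H, hG, hW⟩ := hM.trunc Z' (n - c)
    have hG' : G ∈ tleMn M (n - 2 * b - c) := by
      intro j hj
      rcases lt_or_ge (n - c) j with hj' | hj'
      · exact hG j hj'
      · exact V_one H M j (gap2 _ _ fun i h3 h4 => h1 i (by lia) (by lia)) (hW _ (by lia))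
    have hGN : G ∈ tleMn N (n - b - c) := le1 _ _ _ (by lia) hG'
    have hWN : W ∈ tgeMn N (n + 1) := by
      intro j hj
      rcases lt_or_ge j (n + 1 - b - c) with hj' | hj'
      · exact ge1 _ _ _ (by lia) hW j hj'
      · exact V_three H N j (h1 j (by lia) (by lia)) (hGN _ (by lia))
    obtain ⟨U, f, h, H'⟩ := exists_fib (u ≫ q)
    refine ⟨U, W, f, u ≫ q, h, H', ?_, hWN⟩
    have key : ∀ j, n < j → Function.Bijective ((homF N).map ((u ≫ q)⟦j⟧')) := by
      intro j hj
      have e : ⇑((homF N).map ((u ≫ q)⟦j⟧')) =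
          (homF N).map (q⟦j⟧') ∘ (homF N).map (u⟦j⟧') := funext fun x => by
        rw [Functor.map_comp, (homF N).map_comp]; rfl
      rw [e]
      refine Function.Bijective.comp ⟨?_, ?_⟩ (h2 j hj)
      · exact (injective_iff_map_eq_zero _).2
          (CohF.inj_g (F := homF N) H j (hGN j (by lia)))
      · exact CohF.surj_g (F := homF N) H j (hGN _ (by lia))
    intro j hj
    refine CohF.van_fib (F := homF N) H' j ((injective_iff_map_eq_zero _).1 (key j hj).1) ?_
    intro x
    rcases lt_or_ge n (j-1) with hj' | hj'
    · exact (key _ hj').2 x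
    · exact ⟨0, by rw [map_zero]; exact (hWN (j-1) (by lia) x).symm⟩
  · intro X
    obtain ⟨n, hn⟩ := hM.bdd X
    exact ⟨n + b, le1 _ _ _ le_rfl hn⟩
  · intro X
    rw [hM.eqD]
    constructor
    · rintro ⟨n, hn⟩
      exact ⟨n - b, ge1 _ _ _ (by lia) hn⟩
    · rintro ⟨n, hn⟩
      exact ⟨n - c, ge2 _ _ _ (by lia) hn⟩


namespace CohF
variable {F : CohF.{w} T}

lemma inj_zero {Z B : T} (g : Z ⟶ B) (H : ∀ y : F.obj Z, F.map g y = 0 → y = 0)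
    (y : F.obj (Z⟦(0:ℤ)⟧)) (hy : F.map (g⟦(0:ℤ)⟧') y = 0) : y = 0 := by
  have nat := (shiftFunctorZero T ℤ).hom.naturality g
  have h1 := H (F.map ((shiftFunctorZero T ℤ).hom.app Z) y) (by
    have := congrArg (fun q => F.map q y) nat
    simp only [Functor.id_map] at this
    rw [← F.map_comp]
    refine this.symm.trans ?_
    rw [F.map_comp]
    erw [hy]
    rw [_root_.map_zero])
  have h2 := F.map_inv ((shiftFunctorZero T ℤ).app Z) y
  rw [← h2]
  erw [h1]
  rw [_root_.map_zero]

lemma surj_zero {Z B : T} (g : Z ⟶ B) (H : ∀ x : F.obj B, ∃ y, F.map g y = x)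
    (x : F.obj (B⟦(0:ℤ)⟧)) : ∃ y, F.map (g⟦(0:ℤ)⟧') y = x := by
  obtain ⟨y, hy⟩ := H (F.map ((shiftFunctorZero T ℤ).hom.app B) x)
  refine ⟨F.map ((shiftFunctorZero T ℤ).inv.app Z) y, ?_⟩
  have nat := (shiftFunctorZero T ℤ).inv.naturality g
  have := congrArg (fun q => F.map q y) nat
  simp only [Functor.id_map] at this
  rw [← F.map_comp]
  refine this.symm.trans ?_
  rw [F.map_comp, hy]
  exact F.map_inv ((shiftFunctorZero T ℤ).app B) x

lemma len_ses (F : CohF.{w} T) {A Z B : T} {f : A ⟶ Z} {g : Z ⟶ B} {h : B ⟶ A⟦(1:ℤ)⟧} (H : DT f g h)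
    (hA : F.vn (A⟦(1:ℤ)⟧)) (hB : F.vn (B⟦(-1:ℤ)⟧)) : F.len Z = F.len A + F.len B := by
  refine Module.length_eq_add_of_exact (F.lmap f) (F.lmap g) ?_ ?_ ?_
  · refine (injective_iff_map_eq_zero (F.lmap f)).2 fun y hy => ?_
    obtain ⟨u, v, H'⟩ := H.irot
    obtain ⟨w, rfl⟩ := F.exact _ _ _ H' y hy
    rw [hB w, _root_.map_zero]
  · intro x
    exact F.exact _ _ _ H.rot x (hA _)
  · intro x
    constructor
    · exact F.exact _ _ _ H x
    · rintro ⟨y, rfl⟩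
      exact F.map_comp_zero _ _ H.zero12 _
end CohF

lemma DT.isZero1 {A Z B : T} {f : A ⟶ Z} {g : Z ⟶ B} {h : B ⟶ A⟦(1:ℤ)⟧} (H : DT f g h)
    (hA : IsZero A) : IsIso g := (Triangle.isZero₁_iff_isIso₂ _ H).1 hA
lemma DT.isZero3 {A Z B : T} {f : A ⟶ Z} {g : Z ⟶ B} {h : B ⟶ A⟦(1:ℤ)⟧} (H : DT f g h)
    (hA : IsZero B) : IsIso f := (Triangle.isZero₃_iff_isIso₁ _ H).1 hA

open scoped ZeroObject in
lemma filt_iso {S : Set T} {X Y : T} (e : X ≅ Y) (h : filt S X) : filt S Y := by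
  refine filt.ext e.hom (0 : Y ⟶ 0) 0 ?_ h (filt.zero (isZero_zero T))
  exact DT.of_iso (contractible_distinguished X) (Iso.refl _) e.symm (Iso.refl _) (by simp)
    (by simp) (by simp)

lemma filt_shift {S S' : Set T} (k : ℤ) (h : ∀ s ∈ S, s⟦k⟧ ∈ S') {X : T} (hX : filt S X) :
    filt S' (X⟦k⟧) := by
  induction hX with
  | of hs => exact filt.of (h _ hs)
  | zero hz => exact filt.zero (Functor.map_isZero _ hz)
  | ext f g h' hT _ _ ih1 ih2 =>
    exact filt.ext _ _ _ (DT.sh (f := f) (g := g) (h := h') hT k) ih1 ih2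

lemma heart_iso {N X Y : T} (e : X ≅ Y) (h : X ∈ heartM N) : Y ∈ heartM N :=
  ⟨le_iso e h.1, ge_iso e h.2⟩

lemma simple_iso {N X Y : T} (e : X ≅ Y) (h : heartSimple (heartM N) X) :
    heartSimple (heartM N) Y := by
  refine ⟨heart_iso e h.1, fun hz => h.2.1 (hz.of_iso e), fun A B f g k H hA hB => ?_⟩
  refine h.2.2 A B (f ≫ e.inv) (e.hom ≫ g) k ?_ hA hB
  exact DT.of_iso (f' := f) (g' := g) (h' := k) H (Iso.refl _) e (Iso.refl _) (by simp) (by simp)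
    (by simp)

namespace Good
variable {D : Set T} {N : T} (G : Good D N)
include G

lemma zero_of {X : T} (h : ∀ k, V N X k) : IsZero X :=
  isZero_of_id (G.hom (a := 0) (b := 1) (fun k _ => h k) (fun k _ => h k) (by lia))

lemma heart_zero {X : T} (hX : X ∈ heartM N) (h : V0 N X) : IsZero X := by
  refine G.zero_of fun k => ?_
  rcases lt_trichotomy k 0 with hk | rfl | hk
  · exact hX.2 k hk
  · exact (V_zero_iff _ _).2 h
  · exact hX.1 k hk

lemma sums_le {Q : T} (hQ : Sums {N} Q) : Q ∈ tleMn N 0 := by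
  intro k hk
  refine van_filt (homF N) ?_ hQ.filt
  intro s hs
  obtain rfl : s = N := hs
  exact G.pres k hk

lemma quot {X Q : T} (hX : X ∈ heartM N) (p : Q ⟶ X) (hQ : Sums {N} Q) :
    ∃ (A B : T) (f : A ⟶ X) (g : X ⟶ B) (h : B ⟶ A⟦(1:ℤ)⟧), DT f g h ∧ A ∈ heartM N ∧
      B ∈ heartM N ∧ p ≫ g = 0 ∧ (∀ φ : N ⟶ X, φ ≫ g = 0 → ∃ ψ : N ⟶ Q, ψ ≫ p = φ) ∧
      ∀ (Y : T) (h : X ⟶ Y), Y ∈ tgeMn N 0 → p ≫ h = 0 → ∃ h' : B ⟶ Y, g ≫ h' = h := by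
  obtain ⟨K, q, r, H⟩ := exists_cone p
  have hQ0 := G.sums_le hQ
  have hK : K ∈ tleMn N 0 := le_three H hX.1 (le_mono (by lia) hQ0)
  obtain ⟨A', B, i, j, t, H', hA', hB⟩ := G.trunc K (-1)
  have hB0 : B ∈ tleMn N 0 := le_three H' hK (le_mono (by lia) hA')
  have hB : B ∈ tgeMn N 0 := hB
  obtain ⟨A, f, h, H2⟩ := exists_fib (q ≫ j)
  refine ⟨A, B, f, q ≫ j, h, H2, ⟨?_, ?_⟩, ⟨hB0, hB⟩, ?_, ?_, ?_⟩
  · intro k hk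
    refine CohF.van_fib (F := homF N) H2 k (fun y _ => hX.1 k hk y) ?_
    intro x
    obtain ⟨y, rfl⟩ := CohF.surj_g (F := homF N) H' (k-1) (hA' _ (by lia)) x
    obtain ⟨z, rfl⟩ := CohF.surj_g (F := homF N) H (k-1) (hQ0 _ (by lia)) y
    exact ⟨z, by rw [Functor.map_comp, (homF N).map_comp]⟩
  · exact ge_one H2 hX.2 (ge_mono (by lia) hB)
  · rw [← Category.assoc, H.zero12, zero_comp]
  · intro φ hφ
    rw [← Category.assoc] at hφ
    obtain ⟨ψ, hψ⟩ := H'.lift _ hφ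
    have : ψ = 0 := (V_zero_iff _ _).1 (hA' 0 (by lia)) ψ
    rw [this, zero_comp] at hψ
    exact H.lift _ hψ.symm
  · intro Y y hY hpy
    obtain ⟨y', rfl⟩ := H.desc y hpy
    obtain ⟨y2, rfl⟩ := H'.desc y' (G.hom hA' hY (by lia) _)
    exact ⟨y2, by simp⟩

lemma isIso_of_bij {X Y : T} (hX : X ∈ heartM N) (hY : Y ∈ heartM N) (f : X ⟶ Y)
    (hi : ∀ φ : N ⟶ X, φ ≫ f = 0 → φ = 0) (hs : ∀ φ : N ⟶ Y, ∃ ψ : N ⟶ X, ψ ≫ f = φ) :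
    IsIso f := by
  obtain ⟨A, i, h, H⟩ := exists_fib f
  refine H.isZero1 (G.zero_of fun k => ?_)
  refine CohF.van_fib (F := homF N) H k ?_ ?_
  · intro y hy
    rcases lt_trichotomy k 0 with hk | rfl | hk
    · exact hX.2 k hk y
    · exact CohF.inj_zero (F := homF N) f hi y hy
    · exact hX.1 k hk y
  · intro x
    rcases lt_trichotomy (k-1) 0 with hk | hk | hk
    · exact ⟨0, (map_zero _).trans (hY.2 _ hk x).symm⟩
    · generalize k - 1 = m at *
      subst hk
      exact CohF.surj_zero (F := homF N) f hs x
    · exact ⟨0, (map_zero _).trans (hY.1 _ hk x).symm⟩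

lemma schur {X Y : T} (hX : heartSimple (heartM N) X) (hY : heartSimple (heartM N) Y) (f : X ⟶ Y)
    (hf : f ≠ 0) : IsIso f := by
  have inj : ∀ φ : N ⟶ X, φ ≫ f = 0 → φ = 0 := by
    have := (G.fl X).noeth
    obtain ⟨Q, p, hQ, h1, h2⟩ := approx N X (LinearMap.ker ((homF N).lmap f))
      (IsNoetherian.noetherian _)
    have hpf : p ≫ f = 0 := h2 Y f fun φ hφ => hφ
    obtain ⟨A, B, i, g, h, H, hA, hB, e1, e2, e3⟩ := G.quot hX.1 p hQ
    rcases hX.2.2 A B i g h H hA hB with hz | hz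
    · intro φ hφ
      obtain ⟨ψ, rfl⟩ := h1 φ hφ
      obtain ⟨p', rfl⟩ := H.lift p e1
      rw [hz.eq_of_src i 0]; simp
    · obtain ⟨f', rfl⟩ := e3 Y f hY.1.2 hpf
      exact absurd (by rw [hz.eq_of_src f' 0, comp_zero]) hf
  refine G.isIso_of_bij hX.1 hY.1 f inj ?_
  obtain ⟨Q, p, hQ, h1⟩ := approx_all N X (G.fl X)
  obtain ⟨A, B, i, g, h, H, hA, hB, e1, e2, e3⟩ := G.quot hY.1 (p ≫ f) hQ
  rcases hY.2.2 A B i g h H hA hB with hz | hz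
  · exfalso
    refine hX.2.1 (G.heart_zero hX.1 fun φ => inj φ ?_)
    obtain ⟨ψ, rfl⟩ := h1 φ
    obtain ⟨p', hp'⟩ := H.lift _ e1
    rw [Category.assoc, ← hp', hz.eq_of_src i 0]; simp
  · intro φ
    obtain ⟨ψ, rfl⟩ := e2 φ (hz.eq_of_tgt _ _)
    exact ⟨ψ ≫ p, by simp⟩

lemma heart_filt_aux (n : ℕ) : ∀ X : T, X ∈ heartM N → (homF N).len X ≤ n →
    filt {Y | heartSimple (heartM N) Y} X := by
  induction n with
  | zero =>
    intro X hX hn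
    exact filt.zero (G.heart_zero hX ((homF N).len_eq_zero.1 (le_antisymm (by simpa using hn)
      (zero_le))))
  | succ n ih =>
    intro X hX hn
    by_cases hz : IsZero X
    · exact filt.zero hz
    by_cases hs : heartSimple (heartM N) X
    · exact filt.of hs
    simp only [heartSimple, hX, hz, not_false_eq_true, true_and, not_forall] at hs
    obtain ⟨A, B, f, g, h, H, hA, hB, hne⟩ := hs
    push Not at hne
    have e := (homF N).len_ses (f := f) (g := g) (h := h) H (hA.1 1 (by lia)) (hB.2 (-1) (by lia))
    have h1 : (homF N).len A ≠ 0 := fun h => hne.1 (G.heart_zero hA ((homF N).len_eq_zero.1 h))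
    have h2 : (homF N).len B ≠ 0 := fun h => hne.2 (G.heart_zero hB ((homF N).len_eq_zero.1 h))
    rw [e] at hn
    have h3 : (homF N).len A ≠ ⊤ := G.fl A
    have h4 : (homF N).len B ≠ ⊤ := G.fl B
    generalize ea : (homF N).len A = a at *
    generalize eb : (homF N).len B = b at *
    lift a to ℕ using h3
    lift b to ℕ using h4
    norm_cast at h1 h2 hn
    exact filt.ext f g h H (ih A hA (by rw [ea]; norm_cast; lia))
      (ih B hB (by rw [eb]; norm_cast; lia))

lemma heart_filt {X : T} (hX : X ∈ heartM N) : filt {Y | heartSimple (heartM N) Y} X := by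
  obtain ⟨n, hn⟩ := ENat.ne_top_iff_exists.1 (G.fl X)
  exact G.heart_filt_aux n X hX hn.ge

lemma dev_aux (n : ℕ) : ∀ (X : T) (a' a : ℤ), a + 1 - a' ≤ n → X ∈ tgeMn N a' → X ∈ tleMn N a →
    filt {Y | ∃ i, a' ≤ i ∧ i ≤ a ∧ heartSimple (heartM N) (Y⟦i⟧)} X := by
  induction n with
  | zero =>
    intro X a' a h h1 h2
    exact filt.zero (isZero_of_id (G.hom h2 h1 (by simp at h; lia)))
  | succ n ih =>
    intro X a' a h h1 h2
    rcases lt_or_ge a a' with hlt | hle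
    · exact filt.zero (isZero_of_id (G.hom h2 h1 hlt))
    obtain ⟨A, B, f, g, k, H, hA, hB⟩ := G.trunc X a'
    have hA' : A ∈ tgeMn N a' := ge_one H h1 (ge_mono (by lia) hB)
    have hB' : B ∈ tleMn N a := le_three H h2 (le_mono (by lia) hA)
    refine filt.ext f g k H ?_ ?_
    · have : A⟦a'⟧ ∈ heartM N := ⟨(le_sh a' a' (by ring)).2 hA, (ge_sh a' a' (by ring)).2 hA'⟩
      refine filt_iso ((shiftFunctorCompIsoId T a' (-a') (by ring)).app A)
        (filt_shift (-a') ?_ (G.heart_filt this))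
      intro s hs
      exact ⟨a', le_rfl, hle,
        simple_iso ((shiftFunctorCompIsoId T (-a') a' (by ring)).app s).symm hs⟩
    · refine filt_mono ?_ (ih B (a'+1) a (by push_cast at h; lia) hB hB')
      rintro Y ⟨i, hi, hi', hY⟩
      exact ⟨i, by lia, hi', hY⟩

lemma dev {X : T} {a' a : ℤ} (h1 : X ∈ tgeMn N a') (h2 : X ∈ tleMn N a) :
    filt {Y | ∃ i, a' ≤ i ∧ i ≤ a ∧ heartSimple (heartM N) (Y⟦i⟧)} X :=
  G.dev_aux (a + 1 - a').toNat X a' a (Int.self_le_toNat _) h1 h2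

lemma D_iso {X Y : T} (e : X ≅ Y) (h : X ∈ D) : Y ∈ D := by
  rw [G.eqD] at *
  obtain ⟨n, hn⟩ := h
  exact ⟨n, ge_iso e hn⟩

lemma D_thick {S : Set T} (hS : S ⊆ D) {X : T} (h : thick S X) : X ∈ D := by
  induction h with
  | of hs => exact hS hs
  | zero hz => exact (G.eqD _).2 ⟨0, ge_zero 0 hz⟩
  | shift _ n ih =>
    obtain ⟨m, hm⟩ := (G.eqD _).1 ih
    exact (G.eqD _).2 ⟨m - n, (ge_sh n m (by ring)).2 hm⟩
  | ext f g h hT _ _ ih1 ih2 =>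
    obtain ⟨m, hm⟩ := (G.eqD _).1 ih1
    obtain ⟨n, hn⟩ := (G.eqD _).1 ih2
    exact (G.eqD _).2 ⟨min m n, ge_mid (f := f) (g := g) (h := h) hT (ge_mono (min_le_left _ _) hm)
      (ge_mono (min_le_right _ _) hn)⟩
  | smd i r hir _ ih =>
    obtain ⟨m, hm⟩ := (G.eqD _).1 ih
    exact (G.eqD _).2 ⟨m, ge_retr i r hir hm⟩

lemma simple_negV {X Y : T} (hX : X ∈ heartM N) (hY : Y ∈ heartM N) (n : ℤ) (hn : n < 0) :
    V X Y n := G.hom hX.1 ((ge_sh n 0 (by ring : -n + n = 0)).2 hY.2) (by lia)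

lemma smc {S : Set T} (hS : heartSimplesReps N S) : IsSMCof D S where
  subset X hX := (G.eqD X).2 ⟨0, (hS.1 X hX).1.2⟩
  negVanish X hX Y hY n hn := G.simple_negV (hS.1 X hX).1 (hS.1 Y hY).1 n hn
  nonzero X hX := (hS.1 X hX).2.1
  endo X hX f := by
    by_cases hf : f = 0
    · exact Or.inl hf
    · exact Or.inr (G.schur (hS.1 X hX) (hS.1 X hX) f hf)
  noHom X hX Y hY hXY f := by
    by_contra hf
    have := G.schur (hS.1 X hX) (hS.1 Y hY) f hf
    exact (hS.2.2 X hX Y hY hXY).false (asIso f)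
  generates X := by
    constructor
    · intro hX
      obtain ⟨a', h1⟩ := (G.eqD X).1 hX
      obtain ⟨a, h2⟩ := G.bdd X
      refine thick_trans ?_ (filt.thick (G.dev h1 h2))
      rintro Y ⟨i, -, -, hY⟩
      obtain ⟨s, hs, ⟨e⟩⟩ := hS.2.1 _ hY
      exact thick_unshift i (thick_iso e (thick.of hs))
    · exact G.D_thick (fun X hX => (G.eqD X).2 ⟨0, (hS.1 X hX).1.2⟩)

end Good


namespace Good
variable {D : Set T} {N M : T} (G : Good D N)
include G

lemma apx0 {X : T} (hX : X ∈ tleMn N 0) : ∃ (Q X' : T) (p : Q ⟶ X) (g : X ⟶ X')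
    (h : X' ⟶ Q⟦(1:ℤ)⟧), DT p g h ∧ Sums {N} Q ∧ X' ∈ tleMn N (-1) := by
  obtain ⟨Q, p, hQ, hφ⟩ := approx_all N X (G.fl _)
  obtain ⟨X', g, h, H⟩ := exists_cone p
  have hV := G.sums_le hQ
  refine ⟨Q, X', p, g, h, H, hQ, fun k hk => ?_⟩
  rcases eq_or_lt_of_le (show 0 ≤ k by lia) with rfl | hk'
  · refine (V_zero_iff _ _).2 fun φ => ?_
    obtain ⟨ψ, rfl⟩ := H.rot.lift φ (hV 1 (by lia) _)
    obtain ⟨χ, rfl⟩ := hφ ψ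
    rw [Category.assoc, H.zero12, comp_zero]
  · exact V_three H N k (hX k hk') (hV _ (by lia))

lemma le_of_simples_step {X : T} (n : ℕ)
    (h : ∀ L, heartSimple (heartM N) L → ∀ j < 0, V X L j) (hX : X ∈ tleMn N (n+1)) :
    X ∈ tleMn N n := by
  obtain ⟨A, B, f, g, k, H, hA, hB⟩ := G.trunc X n
  have hB' : B ∈ tleMn N (n+1) := le_three H hX (le_mono (by lia) hA)
  have hXB : V0 X B := by
    have := van_filt (homF X) (k := 0) ?_ (G.dev hB hB')
    · exact (V_zero_iff _ _).1 this
    · rintro Y ⟨i, hi, hi', hY⟩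
      exact (V_tgt X Y i (-i) 0 (by ring)).1 (h _ hY (-i) (by lia))
  obtain ⟨y, hy⟩ := H.rot.desc (𝟙 B) (by rw [hXB g, zero_comp])
  have : y = 0 := G.hom (a := n - 1) ((le_sh 1 n (by ring)).2 hA) hB (by lia) y
  have hz : IsZero B := by
    rw [this, comp_zero] at hy
    exact (IsZero.iff_id_eq_zero B).2 hy.symm
  exact le_mid H hA (le_zero _ hz)

lemma le_of_simples {X : T} (h : ∀ L, heartSimple (heartM N) L → ∀ j < 0, V X L j) :
    X ∈ tleMn N 0 := by
  obtain ⟨n, hn⟩ := G.bdd X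
  have : X ∈ tleMn N (n.toNat) := le_mono (Int.self_le_toNat n) hn
  generalize n.toNat = m at this
  induction m with
  | zero => exact this
  | succ m ih => exact ih (G.le_of_simples_step m h (by exact_mod_cast this))

lemma le_sub (GM : Good D M) (h : ∀ L, heartSimple (heartM N) L → heartSimple (heartM M) L)
    {X : T} {n : ℤ} (hX : X ∈ tleMn M n) : X ∈ tleMn N n := by
  rw [← le_sh n n (zero_add n)] at *
  refine G.le_of_simples fun L hL j hj => ?_
  exact GM.hom hX ((ge_sh j 0 (by ring : -j + j = 0)).2 (h L hL).1.2) (by lia)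

lemma le_self : N ∈ tleMn N 0 := G.pres

end Good

/-- closure of `N` under sums and retracts -/
inductive addc (N : T) : T → Prop
  | zero {X : T} (h : IsZero X) : addc N X
  | self : addc N N
  | add {X Y : T} (hX : addc N X) (hY : addc N Y) : addc N (X ⊞ Y)
  | retr {X Y : T} (i : X ⟶ Y) (r : Y ⟶ X) (h : i ≫ r = 𝟙 X) (hY : addc N Y) : addc N X

lemma Sums.addc {N X : T} (h : Sums {N} X) : addc N X := by
  induction h with
  | zero h => exact .zero h
  | add hB hQ ih =>
    obtain rfl := hQ
    exact .add ih .self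

lemma addc.trans {N M X : T} (h : addc N M) (hX : addc M X) : addc N X := by
  induction hX with
  | zero h => exact .zero h
  | self => exact h
  | add _ _ h1 h2 => exact .add h1 h2
  | retr i r h _ ih => exact .retr i r h ih

lemma addc.thick {N X : T} (h : addc N X) : thick {N} X := by
  induction h with
  | zero h => exact .zero h
  | self => exact .of rfl
  | add _ _ h1 h2 => exact .ext _ _ _ (biprod_DT _ _) h1 h2
  | retr i r h _ ih => exact .smd i r h ih

lemma addc.V {N X Z : T} {k : ℤ} (h : addc N X) (hN : V N Z k) : V X Z k := by
  induction h with
  | zero h => exact V_zero_src h _ _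
  | self => exact hN
  | add _ _ h1 h2 => exact V_mid' (biprod_DT _ _) _ _ h1 h2
  | retr i r h _ ih => exact V_retr_src i r h _ _ ih

lemma addc.V' {N X Z : T} {k : ℤ} (h : addc N X) (hN : STPaper.V Z N k) : STPaper.V Z X k := by
  induction h with
  | zero h => exact (homF Z).van_zero h k
  | self => exact hN
  | add _ _ h1 h2 => exact V_mid (biprod_DT _ _) _ _ h1 h2
  | retr i r h _ ih => exact (homF Z).van_retr i r h k ih

lemma addc_of_simples {D : Set T} {M N : T} (GM : Good D M) (GN : Good D N)
    (h : ∀ L, heartSimple (heartM N) L ↔ heartSimple (heartM M) L) : addc N M := by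
  obtain ⟨Q, M', p, g, k, H, hQ, hM'⟩ := GN.apx0 (GN.le_sub GM (fun L => (h L).1) GM.le_self)
  have h1 := GM.le_sub GN (fun L => (h L).2) hM'
  obtain ⟨r, hr⟩ := H.retr_of_g_zero ((V_zero_iff _ _).1 (h1 0 (by lia)) g)
  exact .retr r p hr hQ.addc

/-- retract relation -/
def Ret (A X : T) : Prop := ∃ (i : A ⟶ X) (r : X ⟶ A), i ≫ r = 𝟙 A

lemma Ret.trans {A B X : T} (h1 : Ret A B) (h2 : Ret B X) : Ret A X := by
  obtain ⟨i, r, h⟩ := h1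
  obtain ⟨i', r', h'⟩ := h2
  exact ⟨i ≫ i', r' ≫ r, by rw [Category.assoc, reassoc_of% h', h]⟩
lemma Ret.iso {A B : T} (e : A ≅ B) : Ret A B := ⟨e.hom, e.inv, e.hom_inv_id⟩
lemma Ret.inl (A B : T) : Ret A (A ⊞ B) := ⟨biprod.inl, biprod.fst, by simp⟩
lemma Ret.inr (A B : T) : Ret B (A ⊞ B) := ⟨biprod.inr, biprod.snd, by simp⟩
lemma Ret.refl (A : T) : Ret A A := .iso (Iso.refl A)
lemma Ret.zero {A B : T} (h : Ret A B) (hB : IsZero B) : IsZero A := by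
  obtain ⟨i, r, h⟩ := h
  rw [IsZero.iff_id_eq_zero, ← h, hB.eq_of_src r 0, comp_zero]

section KS

lemma split [IsIdempotentComplete T] {X : T} (e : X ⟶ X) (he : e ≫ e = e) :
    ∃ (A B : T) (i : A ⟶ X) (r : X ⟶ A) (j : B ⟶ X) (s : X ⟶ B), i ≫ r = 𝟙 A ∧ r ≫ i = e ∧
      j ≫ s = 𝟙 B ∧ s ≫ j = 𝟙 X - e ∧ Nonempty (X ≅ A ⊞ B) := by
  obtain ⟨A, i, r, h1, h2⟩ := IsIdempotentComplete.idempotents_split X e he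
  obtain ⟨B, j, s, h3, h4⟩ := IsIdempotentComplete.idempotents_split X (𝟙 X - e) (by simp [he])
  have e1 : i ≫ s = 0 := by
    have : i ≫ s = (i ≫ r ≫ i) ≫ (s ≫ j ≫ s) := by rw [reassoc_of% h1, h3, Category.comp_id]
    rw [this]
    simp only [Category.assoc]
    rw [reassoc_of% h2, reassoc_of% h4]
    simp [reassoc_of% he]
  have e2 : j ≫ r = 0 := by
    have : j ≫ r = (j ≫ s ≫ j) ≫ (r ≫ i ≫ r) := by rw [reassoc_of% h3, h1, Category.comp_id]
    rw [this]
    simp only [Category.assoc]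
    rw [reassoc_of% h4, reassoc_of% h2]
    simp [reassoc_of% he]
  refine ⟨A, B, i, r, j, s, h1, h2, h3, h4, ⟨⟨biprod.lift r s, biprod.desc i j, ?_, ?_⟩⟩⟩
  · rw [biprod.lift_desc, h2, h4]; simp
  · ext <;> simp [h1, h3, e1, e2]

lemma Ret.compl [IsIdempotentComplete T] {A X : T} (h : Ret A X) : ∃ B, Nonempty (X ≅ A ⊞ B) := by
  obtain ⟨i, r, h⟩ := h
  obtain ⟨A', B, i', r', j, s, h1, h2, h3, h4, ⟨e⟩⟩ := split (r ≫ i)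
    (by rw [Category.assoc, reassoc_of% h])
  have a : A ≅ A' := ⟨i ≫ r', i' ≫ r, by rw [Category.assoc, reassoc_of% h2, h, reassoc_of% h],
    by rw [Category.assoc, ← Category.assoc r, ← h2, Category.assoc, h1, reassoc_of% h1]⟩
  exact ⟨B, ⟨e ≪≫ biprod.mapIso a.symm (Iso.refl B)⟩⟩

/-- Fitting -/
lemma fitting {A : T} (hA : Indec A) (hf : (homF A).FL A) (f : A ⟶ A) :
    IsIso f ∨ IsIso (𝟙 A - f) := by
  have := hf.noeth
  have := hf.artin
  obtain ⟨n, hn⟩ := Filter.eventually_atTop.1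
    (LinearMap.eventually_isCompl_ker_pow_range_pow ((homF A).lmap f))
  have hn := hn (n+1) (by lia)
  let fe : End A := f
  let g : A ⟶ A := (fe ^ (n+1) : End A)
  have hpow : ∀ (m : ℕ) (x : A ⟶ A), (((homF A).lmap f) ^ m) x = x ≫ (fe ^ m : End A) := by
    intro m
    induction m with
    | zero => intro x; exact (Category.comp_id x).symm
    | succ m ih =>
      intro x
      refine (LinearMap.congr_fun (pow_succ' ((homF A).lmap f) m) x).trans ?_
      refine (congrArg ((homF A).lmap f) (ih x)).trans ?_
      change (x ≫ (fe ^ m : End A)) ≫ f = _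
      rw [pow_succ', End.mul_def, Category.assoc]
  have hg := hpow (n+1)
  change ∀ x : A ⟶ A, _ = x ≫ g at hg
  have hex0 : ∀ x : (homF A).obj A, ∃ k y : (homF A).obj A,
      ((homF A).lmap f ^ (n+1)) k = 0 ∧ k + ((homF A).lmap f ^ (n+1)) y = x := by
    intro x
    have hx : x ∈ ((homF A).lmap f ^ (n + 1)).ker ⊔ ((homF A).lmap f ^ (n + 1)).range := by
      rw [hn.sup_eq_top]; trivial
    obtain ⟨k, hk, z, ⟨y, rfl⟩, hkz⟩ := Submodule.mem_sup.1 hx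
    exact ⟨k, y, hk, hkz⟩
  have hex : ∃ k y : A ⟶ A, k ≫ g = 0 ∧ k + y ≫ g = 𝟙 A := by
    obtain ⟨k, y, h1, h2⟩ := hex0 (𝟙 A)
    exact ⟨k, y, (hg k).symm.trans h1, (congrArg (fun t : A ⟶ A => HAdd.hAdd (α := A ⟶ A) k t)
      (hg y)).symm.trans h2⟩
  have hdis : ∀ x y : A ⟶ A, x ≫ g = 0 → x = y ≫ g → x = 0 := by
    intro x y h1 h2
    exact Submodule.disjoint_def.1 hn.disjoint x ((hg x).trans h1) ⟨y, (hg y).trans h2.symm⟩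
  obtain ⟨k, y, hk, hky⟩ := hex
  have hy : y ≫ g ≫ g = g := by
    have := congrArg (fun t => t ≫ g) hky
    simpa [hk] using this
  have hgk : g ≫ k = 0 := hdis _ (𝟙 A - g ≫ y) (by rw [Category.assoc, hk, comp_zero]) (by
    rw [Preadditive.sub_comp, Category.assoc, Category.id_comp, eq_sub_iff_add_eq,
      ← Preadditive.comp_add, hky, Category.comp_id])
  have hgyg : g ≫ y ≫ g = g := by
    have := congrArg (fun t => g ≫ t) hky
    simpa [hgk] using this
  have hpw : ∀ m : ℕ, (fe ^ (m+1) : End A) = f ≫ (fe ^ m : End A) ∧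
      (fe ^ (m+1) : End A) = (fe ^ m : End A) ≫ f := fun m => ⟨pow_succ fe m, pow_succ' fe m⟩
  rcases hA.2 (y ≫ g) (by rw [Category.assoc, hgyg]) with h0 | h1
  · right
    have hg0 : g = 0 := by rw [← hy, reassoc_of% h0, zero_comp]
    have : IsNilpotent fe := ⟨n+1, hg0⟩
    have := this.isUnit_one_sub
    exact (isUnit_iff_isIso (𝟙 A - f)).1 this
  · left
    have h2 : g ≫ y = 𝟙 A := by
      have := hdis (𝟙 A - g ≫ y) ((𝟙 A - g ≫ y) ≫ y) ?_ ?_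
      · exact (sub_eq_zero.1 this).symm
      · rw [Preadditive.sub_comp, Category.assoc, hgyg, Category.id_comp, sub_self]
      · rw [Category.assoc, h1, Category.comp_id]
    obtain ⟨q1, q2⟩ := hpw n
    have r1 : f ≫ ((fe ^ n : End A) ≫ y) = 𝟙 A := by
      rw [← Category.assoc, ← q1]; exact h2
    have r2 : (y ≫ (fe ^ n : End A)) ≫ f = 𝟙 A := by
      rw [Category.assoc, ← q2]; exact h1
    have r3 : y ≫ (fe ^ n : End A) = (fe ^ n : End A) ≫ y := by
      rw [← Category.comp_id (y ≫ (fe ^ n : End A)), ← r1, ← Category.assoc, r2, Category.id_comp]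
    exact ⟨_, r1, by rw [← r3, r2]⟩

lemma Indec.ret_biprod {A B Q : T} (hA : Indec A) (hf : (homF A).FL A) (h : Ret A (B ⊞ Q)) :
    Ret A B ∨ Ret A Q := by
  obtain ⟨i, r, h⟩ := h
  have e : 𝟙 A - i ≫ biprod.fst ≫ biprod.inl ≫ r = i ≫ biprod.snd ≫ biprod.inr ≫ r := by
    rw [sub_eq_iff_eq_add, ← Preadditive.comp_add, ← Category.assoc, ← Category.assoc,
      ← Preadditive.add_comp, add_comm, biprod.total, Category.id_comp, h]
  rcases fitting hA hf (i ≫ biprod.fst ≫ biprod.inl ≫ r) with h1 | h1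
  · left
    exact ⟨i ≫ biprod.fst, biprod.inl ≫ r ≫ inv (i ≫ biprod.fst ≫ biprod.inl ≫ r), by
      have := IsIso.hom_inv_id (i ≫ biprod.fst ≫ biprod.inl ≫ r)
      simpa only [Category.assoc] using this⟩
  · right
    rw [e] at h1
    exact ⟨i ≫ biprod.snd, biprod.inr ≫ r ≫ inv (i ≫ biprod.snd ≫ biprod.inr ≫ r), by
      have := IsIso.hom_inv_id (i ≫ biprod.snd ≫ biprod.inr ≫ r)
      simpa only [Category.assoc] using this⟩

lemma Indec.ret_addc {A N X : T} (hA : Indec A) (hf : (homF A).FL A) (hX : addc N X)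
    (h : Ret A X) : Ret A N := by
  induction hX with
  | zero hz => exact absurd (h.zero hz) hA.1
  | self => exact h
  | add _ _ h1 h2 => exact (hA.ret_biprod hf h).elim h1 h2
  | retr i r hr _ ih => exact ih (h.trans ⟨i, r, hr⟩)

lemma len_biprod (F : CohF.{w} T) (A B : T) : F.len (A ⊞ B) = F.len A + F.len B := by
  refine Module.length_eq_add_of_exact (F.lmap biprod.inl) (F.lmap biprod.snd) ?_ ?_ ?_
  · refine Function.LeftInverse.injective (g := F.map biprod.fst) fun x => ?_
    change F.map biprod.fst (F.map biprod.inl x) = x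
    rw [← F.map_comp, biprod.inl_fst, F.map_id]
  · refine Function.RightInverse.surjective (g := F.map biprod.inr) fun x => ?_
    change F.map biprod.snd (F.map biprod.inr x) = x
    rw [← F.map_comp, biprod.inr_snd, F.map_id]
  · intro x
    constructor
    · exact F.exact _ _ _ (biprod_DT A B) x
    · rintro ⟨y, rfl⟩
      exact F.map_comp_zero _ _ (biprod_DT A B).zero12 _

lemma len_iso (F : CohF.{w} T) {X Y : T} (e : X ≅ Y) : F.len X = F.len Y :=
  le_antisymm (F.len_retr e.hom e.inv e.hom_inv_id) (F.len_retr e.inv e.hom e.inv_hom_id)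

lemma Ret.len_ne {A M : T} (h : Ret A M) (hz : ¬ IsZero A) : (homF M).len A ≠ 0 := by
  intro h0
  obtain ⟨i, r, h⟩ := h
  have : r = 0 := (homF M).len_eq_zero.1 h0 r
  exact hz (by rw [IsZero.iff_id_eq_zero, ← h, this, comp_zero])

/-- measure drop -/
lemma len_drop {M X A B : T} (hf : FLs M) (e : X ≅ A ⊞ B) (hA : Ret A M) (hz : ¬ IsZero A) (n : ℕ)
    (h : (homF M).len X ≤ (n+1 : ℕ)) : (homF M).len B ≤ n := by
  rw [len_iso _ e, len_biprod] at h
  have h1 := hA.len_ne hz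
  have h2 : (homF M).len A ≠ ⊤ := hf A
  have h3 : (homF M).len B ≠ ⊤ := hf B
  generalize (homF M).len A = a at *
  generalize (homF M).len B = b at *
  lift a to ℕ using h2
  lift b to ℕ using h3
  norm_cast at *
  lia

variable [IsIdempotentComplete T]

lemma exists_indec {M : T} (hf : FLs M) (n : ℕ) : ∀ X : T, Ret X M → ¬ IsZero X →
    (homF M).len X ≤ n → ∃ A, Indec A ∧ Ret A X := by
  induction n with
  | zero =>
    intro X hX hz h
    exact absurd (le_antisymm (by simpa using h) zero_le) (hX.len_ne hz)
  | succ n ih =>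
    intro X hX hz h
    by_cases hi : Indec X
    · exact ⟨X, hi, .refl X⟩
    simp only [Indec, hz, not_false_eq_true, true_and, not_forall, not_or] at hi
    obtain ⟨e, he, h0, h1⟩ := hi
    obtain ⟨A, B, i, r, j, s, q1, q2, q3, q4, ⟨ψ⟩⟩ := split e he
    have hA : ¬ IsZero A := fun hA => h0 (by rw [← q2, hA.eq_of_src i 0, comp_zero])
    have hB : ¬ IsZero B := fun hB => h1 (by
      have : s ≫ j = 0 := by rw [hB.eq_of_src j 0, comp_zero]
      rw [q4] at this
      exact (sub_eq_zero.1 this).symm)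
    have rA : Ret A X := ⟨i, r, q1⟩
    have rB : Ret B X := ⟨j, s, q3⟩
    obtain ⟨A', hA', hr⟩ := ih B (rB.trans hX) hB (len_drop hf ψ (rA.trans hX) hA n h)
    exact ⟨A', hA', hr.trans rB⟩

lemma exists_indec' {M X : T} (hf : FLs M) (hX : Ret X M) (hz : ¬ IsZero X) :
    ∃ A, Indec A ∧ Ret A X := by
  obtain ⟨n, hn⟩ := ENat.ne_top_iff_exists.1 (hf X)
  exact exists_indec hf n X hX hz hn.ge

lemma Ret.fl {A M : T} (h : Ret A M) (hf : FLs M) : (homF A).FL A := by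
  obtain ⟨i, r, h⟩ := h
  exact FL_retr_src i r h A (hf A)

/-- swap -/
noncomputable def mid4 (A B C E : T) : (A ⊞ B) ⊞ (C ⊞ E) ≅ (A ⊞ C) ⊞ (B ⊞ E) where
  hom := biprod.lift (biprod.map biprod.fst biprod.fst) (biprod.map biprod.snd biprod.snd)
  inv := biprod.lift (biprod.map biprod.fst biprod.fst) (biprod.map biprod.snd biprod.snd)
  hom_inv_id := by ext <;> simp
  inv_hom_id := by ext <;> simp

/-- assoc -/
noncomputable def asc (A B C : T) : A ⊞ (B ⊞ C) ≅ (A ⊞ B) ⊞ C where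
  hom := biprod.lift (biprod.lift biprod.fst (biprod.snd ≫ biprod.fst)) (biprod.snd ≫ biprod.snd)
  inv := biprod.lift (biprod.fst ≫ biprod.fst) (biprod.lift (biprod.fst ≫ biprod.snd) biprod.snd)
  hom_inv_id := by ext <;> simp
  inv_hom_id := by ext <;> simp

lemma basic_contra {M U M' A : T} (hb : IsBasic M) (e : M ≅ U ⊞ M') (hA : ¬ IsZero A)
    (h1 : Ret A U) (h2 : Ret A M') : False := by
  obtain ⟨U', ⟨e1⟩⟩ := h1.compl
  obtain ⟨M'', ⟨e2⟩⟩ := h2.compl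
  exact hb ⟨A, U' ⊞ M'', hA, ⟨e ≪≫ biprod.mapIso e1 e2 ≪≫ mid4 _ _ _ _⟩⟩

lemma ks_aux {M N : T} (hM : FLs M) (hN : FLs N) (bM : IsBasic M) (bN : IsBasic N)
    (hMN : addc N M) (hNM : addc M N) (n : ℕ) : ∀ (U M' N' : T), Nonempty (M ≅ U ⊞ M') →
    Nonempty (N ≅ U ⊞ N') → (homF M).len M' ≤ n → Nonempty (M ≅ N) := by
  induction n with
  | zero =>
    rintro U M' N' ⟨e⟩ ⟨e'⟩ h
    have rM : Ret M' M := (Ret.inr U M').trans (.iso e.symm)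
    have hz : IsZero M' := by
      by_contra hz
      exact rM.len_ne hz (le_antisymm (by simpa using h) zero_le)
    have hz' : IsZero N' := by
      by_contra hz'
      have rN : Ret N' N := (Ret.inr U N').trans (.iso e'.symm)
      obtain ⟨A, hA, hr⟩ := exists_indec' hN rN hz'
      have h1 : Ret A (U ⊞ M') := (hA.ret_addc ((hr.trans rN).fl hN) hNM (hr.trans rN)).trans (.iso e)
      rcases hA.ret_biprod ((hr.trans rN).fl hN) h1 with h2 | h2
      · exact basic_contra bN e' hA.1 h2 hr
      · exact hA.1 (h2.zero hz)
    exact ⟨e ≪≫ biprod.mapIso (Iso.refl U) (hz.iso hz') ≪≫ e'.symm⟩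
  | succ n ih =>
    rintro U M' N' ⟨e⟩ ⟨e'⟩ h
    have rM : Ret M' M := (Ret.inr U M').trans (.iso e.symm)
    by_cases hz : IsZero M'
    · exact ih U M' N' ⟨e⟩ ⟨e'⟩ (by rw [(homF M).len_eq_zero.2 ((homF M).vn_zero hz)]; exact zero_le)
    obtain ⟨A, hA, hr⟩ := exists_indec' hM rM hz
    have hf := (hr.trans rM).fl hM
    rcases hA.ret_biprod hf ((hA.ret_addc hf hMN (hr.trans rM)).trans (.iso e')) with h2 | h2
    · exact (basic_contra bM e hA.1 h2 hr).elim
    obtain ⟨M'', ⟨e1⟩⟩ := hr.compl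
    obtain ⟨N'', ⟨e2⟩⟩ := h2.compl
    exact ih (U ⊞ A) M'' N'' ⟨e ≪≫ biprod.mapIso (Iso.refl U) e1 ≪≫ asc _ _ _⟩
      ⟨e' ≪≫ biprod.mapIso (Iso.refl U) e2 ≪≫ asc _ _ _⟩ (len_drop hM e1 (hr.trans rM) hA.1 n h)

open scoped ZeroObject in
lemma ks {M N : T} (hM : FLs M) (hN : FLs N) (bM : IsBasic M) (bN : IsBasic N)
    (hMN : addc N M) (hNM : addc M N) : Nonempty (M ≅ N) := by
  obtain ⟨n, hn⟩ := ENat.ne_top_iff_exists.1 (hM M)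
  have e : ∀ X : T, X ≅ (0 : T) ⊞ X := fun X =>
    ⟨biprod.inr, biprod.snd, by simp, by ext <;> simp⟩
  exact ks_aux hM hN bM bN hMN hNM n 0 M N ⟨e M⟩ ⟨e N⟩ hn.ge

lemma exists_basic_aux {N : T} (hN : FLs N) (n : ℕ) : ∀ N', Ret N' N → addc N' N →
    (homF N).len N' ≤ n → ∃ N'', Ret N'' N ∧ addc N'' N ∧ IsBasic N'' := by
  induction n with
  | zero =>
    intro N' hr ha hn
    refine ⟨N', hr, ha, ?_⟩
    rintro ⟨X, Y, hX, ⟨e⟩⟩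
    have r : Ret X N' := ((Ret.inl X X).trans (Ret.inl _ Y)).trans (.iso e.symm)
    refine hr.len_ne (fun hz => hX (r.zero hz)) (le_antisymm (by simpa using hn) zero_le)
  | succ n ih =>
    intro N' hr ha hn
    by_cases hb : IsBasic N'
    · exact ⟨N', hr, ha, hb⟩
    obtain ⟨X, Y, hX, ⟨e⟩⟩ := not_not.1 hb
    have e' : N' ≅ X ⊞ (X ⊞ Y) := e ≪≫ (asc _ _ _).symm
    have r : Ret X N' := (Ret.inl X _).trans (.iso e'.symm)
    have r' : Ret (X ⊞ Y) N' := (Ret.inr X _).trans (.iso e'.symm)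
    refine ih (X ⊞ Y) (r'.trans hr) (addc.trans ?_ ha) (len_drop hN e' (r.trans hr) hX n hn)
    exact .retr e'.hom e'.inv e'.hom_inv_id
      (.add (.retr biprod.inl biprod.fst (by simp) .self) .self)

lemma exists_basic {N : T} (hN : FLs N) : ∃ N', Ret N' N ∧ addc N' N ∧ IsBasic N' := by
  obtain ⟨n, hn⟩ := ENat.ne_top_iff_exists.1 (hN N)
  exact exists_basic_aux hN n N (.refl N) .self hn.ge

end KS

/-- part two -/
lemma part2 [IsIdempotentComplete T] {D : Set T} {M N : T} (GM : Good D M) (GN : Good D N)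
    (bM : IsBasic M) (bN : IsBasic N) {S S' : Set T} (hS : heartSimplesReps M S)
    (hS' : heartSimplesReps N S') (h : isoEq S S') : Nonempty (M ≅ N) := by
  have key : ∀ L, heartSimple (heartM N) L ↔ heartSimple (heartM M) L := by
    intro L
    constructor
    · intro hL
      obtain ⟨Y, hY, ⟨e⟩⟩ := hS'.2.1 L hL
      obtain ⟨X, hX, ⟨e'⟩⟩ := h.2 Y hY
      exact simple_iso (e' ≪≫ e) (hS.1 X hX)
    · intro hL
      obtain ⟨Y, hY, ⟨e⟩⟩ := hS.2.1 L hL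
      obtain ⟨X, hX, ⟨e'⟩⟩ := h.1 Y hY
      exact simple_iso (e'.symm ≪≫ e) (hS'.1 X hX)
  exact ks GM.fl GN.fl bM bN (addc_of_simples GM GN key)
    (addc_of_simples GN GM fun L => (key L).symm)


lemma approxF (F : CohF.{w} T) (Z : T) (K : Submodule (CatCenter T) (F.obj Z)) (hK : K.FG) :
    ∃ (P : T) (z : F.obj P), Sums {Z} P ∧ (∀ x ∈ K, ∃ φ : P ⟶ Z, F.map φ z = x) ∧
      z ∈ AddSubgroup.closure {u : F.obj P | ∃ x ∈ K, ∃ φ : Z ⟶ P, u = F.map φ x} := by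
  classical
  obtain ⟨s, rfl⟩ := hK
  induction s using Finset.induction_on with
  | empty =>
    refine ⟨Limits.HasZeroObject.zero' T |>.zero, 0, .zero (isZero_zero T), ?_, zero_mem _⟩
    intro φ hφ
    simp only [Finset.coe_empty, Submodule.span_empty, Submodule.mem_bot] at hφ
    exact ⟨0, by rw [map_zero]; exact hφ.symm⟩
  | insert a s ha ih =>
    obtain ⟨P, z, hP, h1, h2⟩ := ih
    have hs : Submodule.span (CatCenter T) (s : Set (F.obj Z)) ≤
      Submodule.span (CatCenter T) ((insert a s : Finset _) : Set (F.obj Z)) :=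
      Submodule.span_mono (by rw [Finset.coe_insert]; exact Set.subset_insert _ _)
    refine ⟨P ⊞ Z, F.map biprod.inl z + F.map biprod.inr a, hP.add rfl, ?_, ?_⟩
    · intro φ hφ
      rw [Finset.coe_insert, Submodule.mem_span_insert] at hφ
      obtain ⟨r, b, hb, rfl⟩ := hφ
      obtain ⟨ψ, rfl⟩ := h1 b hb
      refine ⟨biprod.desc ψ (r.app Z), ?_⟩
      rw [_root_.map_add, ← F.map_comp, ← F.map_comp, biprod.inl_desc, biprod.inr_desc, add_comm]
      rfl
    · refine add_mem ?_ (AddSubgroup.subset_closure ⟨a, Submodule.subset_span (by simp), _, rfl⟩)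
      clear h1
      induction h2 using AddSubgroup.closure_induction with
      | mem u hu =>
        obtain ⟨x, hx, φ, rfl⟩ := hu
        exact AddSubgroup.subset_closure ⟨x, hs hx, φ ≫ biprod.inl, by rw [F.map_comp]⟩
      | zero => rw [map_zero]; exact zero_mem _
      | add u v _ _ iu iv => rw [_root_.map_add]; exact add_mem iu iv
      | neg u _ iu => rw [map_neg]; exact neg_mem iu

section brown
variable {Φ : CohF.{w} T} {Y : T}

/-- evaluation is onto -/
def Ep (Φ : CohF.{w} T) {Y : T} (y : Φ.obj Y) (Z : T) : Prop := ∀ x : Φ.obj Z, ∃ f : Y ⟶ Z, Φ.map f y = x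
/-- evaluation is injective -/
def Mo (Φ : CohF.{w} T) {Y : T} (y : Φ.obj Y) (Z : T) : Prop := ∀ f : Y ⟶ Z, Φ.map f y = 0 → f = 0

lemma Ep.iso {y : Φ.obj Y} {Z Z' : T} (e : Z ≅ Z') (h : Ep Φ y Z) : Ep Φ y Z' := by
  intro x
  obtain ⟨f, hf⟩ := h (Φ.map e.inv x)
  exact ⟨f ≫ e.hom, by rw [Φ.map_comp, hf, Φ.map_hom]⟩

lemma Mo.iso {y : Φ.obj Y} {Z Z' : T} (e : Z ≅ Z') (h : Mo Φ y Z) : Mo Φ y Z' := by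
  intro f hf
  have := h (f ≫ e.inv) (by rw [Φ.map_comp, hf, map_zero])
  rw [← Category.comp_id f, ← e.inv_hom_id, reassoc_of% this, zero_comp]

lemma Ep.sums {y : Φ.obj Y} {Z Q : T} (k : ℤ) (h : Ep Φ y (Z⟦k⟧)) (hQ : Sums {Z} Q) :
    Ep Φ y (Q⟦k⟧) := by
  induction hQ with
  | zero hz => intro x; exact ⟨0, ((Φ.vn_zero (Functor.map_isZero _ hz)) _).trans
      ((Φ.vn_zero (Functor.map_isZero _ hz)) _).symm⟩
  | @add B Q hB hQ ih =>
    obtain rfl : Q = Z := hQ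
    intro x
    obtain ⟨f, hf⟩ := ih (Φ.map ((biprod.fst : B ⊞ Q ⟶ B)⟦k⟧') x)
    obtain ⟨f', hf'⟩ := h (Φ.map ((biprod.snd : B ⊞ Q ⟶ Q)⟦k⟧') x)
    refine ⟨f ≫ biprod.inl⟦k⟧' + f' ≫ biprod.inr⟦k⟧', ?_⟩
    rw [Φ.map_add, Φ.map_comp, Φ.map_comp, hf, hf', ← Φ.map_comp, ← Φ.map_comp, ← Φ.map_add,
      ← Functor.map_comp, ← Functor.map_comp, ← Functor.map_add, biprod.total,
      CategoryTheory.Functor.map_id, Φ.map_id]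

lemma Mo.sums {y : Φ.obj Y} {Z Q : T} (k : ℤ) (h : Mo Φ y (Z⟦k⟧)) (hQ : Sums {Z} Q) :
    Mo Φ y (Q⟦k⟧) := by
  induction hQ with
  | zero hz => intro x _; exact (Functor.map_isZero _ hz).eq_of_tgt _ _
  | @add B Q hB hQ ih =>
    obtain rfl : Q = Z := hQ
    intro f hf
    have h1 := ih (f ≫ (biprod.fst : B ⊞ Q ⟶ B)⟦k⟧') (by rw [Φ.map_comp, hf, map_zero])
    have h2 := h (f ≫ (biprod.snd : B ⊞ Q ⟶ Q)⟦k⟧') (by rw [Φ.map_comp, hf, map_zero])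
    rw [← Category.comp_id f, ← CategoryTheory.Functor.map_id, ← biprod.total, Functor.map_add,
      Preadditive.comp_add, Functor.map_comp, Functor.map_comp, reassoc_of% h1, reassoc_of% h2,
      zero_comp, zero_comp, add_zero]

lemma sums_le' {M P : T} (hp : Pres M) (d l : ℤ) (h : -d ≤ l) (hP : Sums {M⟦d⟧} P) :
    P ∈ tleMn M l := by
  intro k hk
  refine van_filt (homF M) ?_ hP.filt
  intro s hs
  obtain rfl : s = M⟦d⟧ := hs
  exact (V_tgt M M d k _ rfl).2 (hp _ (by lia))

/-- kernel of evaluation -/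
def kerEv (Φ : CohF.{w} T) {Y : T} (y : Φ.obj Y) (Z : T) :
    Submodule (CatCenter T) ((homF Y).obj Z) where
  carrier := {f | Φ.map (show Y ⟶ Z from f) y = 0}
  add_mem' := by
    intro a b ha hb
    exact (Φ.map_add _ _ _).trans (by erw [ha, hb]; rw [add_zero])
  zero_mem' := Φ.map_zero' _
  smul_mem' := by
    intro z f hf
    exact (Φ.map_comp _ _ _).trans (by erw [hf]; rw [map_zero])

lemma brown_step {M : T} (hp : Pres M) (hfl : FLs M) (hΦ : ∀ Z, Φ.FL Z) (d : ℤ)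
    (h : ∃ (Y : T) (y : Φ.obj Y), thick {M} Y ∧ Y ∈ tleMn M (-d) ∧
      (∀ j, d ≤ j → Ep Φ y (M⟦j⟧)) ∧ (∀ j, d + 1 ≤ j → Mo Φ y (M⟦j⟧))) :
    ∃ (Y : T) (y : Φ.obj Y), thick {M} Y ∧ Y ∈ tleMn M (-(d-1)) ∧
      (∀ j, d - 1 ≤ j → Ep Φ y (M⟦j⟧)) ∧ (∀ j, d ≤ j → Mo Φ y (M⟦j⟧)) := by
  obtain ⟨Y, y, hY, hYl, hE, hM⟩ := h
  have fY : FLs Y := FLs_thick (by rintro s hs; obtain rfl : s = M := hs; exact hfl) hY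
  have n1 := (fY (M⟦d⟧)).noeth
  obtain ⟨P, g, hP, hφ, hg⟩ := approxF (homF Y) (M⟦d⟧) (kerEv Φ y _) (IsNoetherian.noetherian _)
  change Y ⟶ P at g
  have hg0 : Φ.map g y = 0 := by
    change (Φ.mapHom y : (Y ⟶ P) →+ _) g = 0
    rw [← AddMonoidHom.mem_ker]
    refine (AddSubgroup.closure_le _).2 ?_ hg
    rintro _ ⟨x, hx, φ, rfl⟩
    change Φ.map ((show Y ⟶ M⟦d⟧ from x) ≫ φ) y = 0
    rw [Φ.map_comp]
    erw [hx]
    rw [map_zero]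
  obtain ⟨Y1, f, h, H⟩ := exists_fib g
  obtain ⟨y1, rfl⟩ := Φ.exact f g h H y hg0
  have tP : thick {M} P := thick_trans (by
    rintro s hs; obtain rfl : s = M⟦d⟧ := hs; exact (thick.of (Set.mem_singleton M)).shift d) hP.filt.thick
  have t1 : thick {M} Y1 := thick_one H hY tP
  have l1 : Y1 ∈ tleMn M (-(d-1)) := le_one H (le_mono (by lia) hYl) (sums_le' hp d _ (by lia) hP)
  have m1 : ∀ j, d ≤ j → Mo Φ y1 (M⟦j⟧) := by
    intro j hj φ h0
    obtain ⟨u, v, H'⟩ := H.irot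
    have hv : V0 (P⟦(-1:ℤ)⟧) (M⟦j⟧) := by
      change V _ M j
      rw [V_src P M (-1) j (j+1) (by ring)]
      refine V_filt_src ?_ hP.filt
      intro s hs
      obtain rfl : s = M⟦d⟧ := hs
      exact (V_src M M d _ (j+1-d) (by ring)).2 (hp _ (by lia))
    obtain ⟨ψ, rfl⟩ := H'.desc φ (hv _)
    rw [Φ.map_comp] at h0
    rcases eq_or_lt_of_le hj with rfl | hj
    · obtain ⟨χ, hχ⟩ := hφ ψ h0
      change g ≫ χ = ψ at hχ
      rw [← hχ, ← Category.assoc, H.zero12, zero_comp]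
    · rw [hM j (by lia) ψ h0, comp_zero]
  have e1 : ∀ j, d ≤ j → Ep Φ y1 (M⟦j⟧) := by
    intro j hj x
    obtain ⟨φ, rfl⟩ := hE j hj x
    exact ⟨f ≫ φ, Φ.map_comp _ _ _⟩
  have n2 := (hΦ (M⟦d-1⟧)).noeth
  obtain ⟨P', z, hP', hz, -⟩ := approxF Φ (M⟦d-1⟧) ⊤ (IsNoetherian.noetherian _)
  have tP' : thick {M} P' := thick_trans (by
    rintro s hs; obtain rfl : s = M⟦d-1⟧ := hs; exact (thick.of (Set.mem_singleton M)).shift _) hP'.filt.thick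
  refine ⟨Y1 ⊞ P', Φ.map biprod.inl y1 + Φ.map biprod.inr z, .ext _ _ _ (biprod_DT _ _) t1 tP',
    le_mid (biprod_DT _ _) l1 (sums_le' hp _ _ (by lia) hP'), ?_, ?_⟩
  · intro j hj x
    rcases eq_or_lt_of_le hj with rfl | hj
    · obtain ⟨φ, rfl⟩ := hz x trivial
      exact ⟨biprod.snd ≫ φ, by rw [_root_.map_add, ← Φ.map_comp, ← Φ.map_comp]; simp⟩
    · obtain ⟨φ, rfl⟩ := e1 j (by lia) x
      exact ⟨biprod.fst ≫ φ, by rw [_root_.map_add, ← Φ.map_comp, ← Φ.map_comp]; simp⟩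
  · intro j hj φ h0
    have hb : biprod.inr ≫ φ = 0 := by
      have : V P' M j := by
        refine V_filt_src ?_ hP'.filt
        intro s hs
        obtain rfl : s = M⟦d-1⟧ := hs
        exact (V_src M M (d-1) _ (j+1-d) (by ring)).2 (hp _ (by lia))
      exact this _
    rw [_root_.map_add, ← Φ.map_comp, ← Φ.map_comp, hb, Φ.map_zero', add_zero] at h0
    have ha := m1 j hj _ h0
    apply biprod.hom_ext'
    · rw [ha, comp_zero]
    · rw [hb, comp_zero]

open scoped ZeroObject in
lemma brown_tower {M : T} (hp : Pres M) (hfl : FLs M) (hΦ : ∀ Z, Φ.FL Z) (c : ℤ)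
    (h1 : ∀ Z ∈ tleMn M (-c), Φ.vn Z) (k : ℕ) : 
    ∃ (Y : T) (y : Φ.obj Y), thick {M} Y ∧ Y ∈ tleMn M (-(c-k)) ∧
      (∀ j, c - k ≤ j → Ep Φ y (M⟦j⟧)) ∧ (∀ j, c - k + 1 ≤ j → Mo Φ y (M⟦j⟧)) := by
  induction k with
  | zero =>
    refine ⟨0, 0, .zero (isZero_zero T), le_zero _ (isZero_zero T), ?_, ?_⟩
    · intro j hj x
      refine ⟨0, ?_⟩
      rw [map_zero]
      refine (h1 _ ?_ x).symm
      exact (le_sh j _ rfl).2 (fun k hk => hp k (by simp at hj; lia))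
    · intro j hj f _
      exact (isZero_zero T).eq_of_src _ _
  | succ k ih =>
    have := brown_step hp hfl hΦ (c - k) ih
    have e : c - ((k+1 : ℕ) : ℤ) = c - k - 1 := by push_cast; ring
    rw [e]
    simpa using this

lemma brown_epi {M Y : T} (hp : Pres M) (hfl : FLs M) (y : Φ.obj Y) (d b : ℤ)
    (h1 : ∀ Z ∈ tleMn M (-b), Φ.vn Z)
    (hE : ∀ j, d ≤ j → Ep Φ y (M⟦j⟧)) (hM : ∀ j, d + 1 ≤ j → Mo Φ y (M⟦j⟧)) (k : ℕ) :
    ∀ Z a, a ≤ -d → a ≤ -b + k → Z ∈ tleMn M a → Ep Φ y Z := by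
  induction k with
  | zero => 
    intro Z a _ ha hZ x
    exact ⟨0, by rw [Φ.map_zero', h1 Z (le_mono (by simpa using ha) hZ) x]⟩
  | succ k ih =>
    intro Z a hd ha hZ x
    obtain ⟨Q, Z', p, g, h, H, hQ, hZ'⟩ := apx hp hfl hZ
    obtain ⟨ζ', h'⟩ := ih Z' (a-1) (by lia) (by push_cast at ha; lia) hZ' (Φ.map g x)
    have m1 : Mo Φ y (Q⟦(1:ℤ)⟧) := Mo.sums 1 (Mo.iso ((shiftFunctorAdd' T (-a) 1 (-a+1) rfl).app M)
      (hM _ (by lia))) hQ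
    have e1 : Ep Φ y Q := Ep.iso ((shiftFunctorZero T ℤ).app Q) (Ep.sums 0
      (Ep.iso ((shiftFunctorAdd' T (-a) 0 (-a) (by ring)).app M) (hE _ (by lia))) hQ)
    have z1 := m1 (ζ' ≫ h) (by rw [Φ.map_comp, h', Φ.map_comp_zero _ _ H.zero23])
    obtain ⟨ζ, rfl⟩ := H.rot.lift ζ' z1
    obtain ⟨q, hq⟩ := Φ.exact p g h H (x - Φ.map ζ y) (by
      rw [map_sub, ← Φ.map_comp, h', sub_self])
    obtain ⟨ξ, rfl⟩ := e1 q
    exact ⟨ζ + ξ ≫ p, by rw [Φ.map_add, Φ.map_comp ξ, hq]; abel⟩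

lemma brown_mono {M Y : T} (hp : Pres M) (hfl : FLs M) (y : Φ.obj Y) (d b : ℤ)
    (h1 : ∀ Z ∈ tleMn M (-b), V0 Y Z)
    (hE : ∀ Z, Z ∈ tleMn M (-d) → Ep Φ y Z) (hM : ∀ j, d + 1 ≤ j → Mo Φ y (M⟦j⟧)) (k : ℕ) :
    ∀ Z a, a ≤ -d - 1 → a ≤ -b + k → Z ∈ tleMn M a → Mo Φ y Z := by
  induction k with
  | zero => 
    intro Z a _ ha hZ x _
    exact h1 Z (le_mono (by simpa using ha) hZ) x
  | succ k ih =>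
    intro Z a hd ha hZ ζ hζ
    obtain ⟨Q, Z', p, g, h, H, hQ, hZ'⟩ := apx hp hfl hZ
    have z1 := ih Z' (a-1) (by lia) (by push_cast at ha; lia) hZ' (ζ ≫ g) (by
      rw [Φ.map_comp, hζ, map_zero])
    obtain ⟨ξ, rfl⟩ := H.lift ζ z1
    have m1 : Mo Φ y Q := Mo.iso ((shiftFunctorZero T ℤ).app Q) (Mo.sums 0
      (Mo.iso ((shiftFunctorAdd' T (-a) 0 (-a) (by ring)).app M) (hM _ (by lia))) hQ)
    obtain ⟨u, v, H'⟩ := H.irot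
    rw [Φ.map_comp] at hζ
    obtain ⟨x, hx⟩ := Φ.exact _ _ _ H' _ hζ
    obtain ⟨ω, rfl⟩ := hE (Z'⟦(-1:ℤ)⟧) ((le_sh (-1) (-d-1) (by ring)).2 (le_mono (by lia) hZ')) x
    have := m1 (ξ - ω ≫ u) (by rw [Φ.map_sub', Φ.map_comp ω, hx, sub_self])
    rw [sub_eq_zero.1 this, Category.assoc, H'.zero12, comp_zero]

/-- representability -/
theorem brown [IsIdempotentComplete T] {D : Set T} {M : T} (G : Good D M) (hΦ : ∀ Z, Φ.FL Z)
    (c l : ℤ) (h1 : ∀ Z ∈ tleMn M c, Φ.vn Z) (h2 : ∀ Z ∈ tgeMn M l, Φ.vn Z) :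
    ∃ (N : T) (n : Φ.obj N), thick {M} N ∧ ∀ Z, Ep Φ n Z ∧ Mo Φ n Z := by
  have hp := G.pres
  have hfl := G.fl
  -- choose k with -(-c-k) = l+1
  obtain ⟨k, hk⟩ : ∃ k : ℕ, l ≤ c + k := ⟨(l - c).toNat, by lia⟩
  obtain ⟨Y, y, tY, lY, hE, hM⟩ := brown_tower hp hfl hΦ (-c) (by simpa using h1) (k+1)
  obtain ⟨b, hb, hgap⟩ := gap tY
  have E : ∀ Z, Z ∈ tleMn M (-(-c - ((k+1:ℕ):ℤ))) → Ep Φ y Z := fun Z hZ =>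
    brown_epi hp hfl y _ (-c) (by simpa using h1) hE hM (k+1) Z _ le_rfl (by lia) hZ
  have Mn : ∀ Z, Z ∈ tleMn M (c + k) → Mo Φ y Z := fun Z hZ =>
    brown_mono hp hfl y _ (b+1) (fun Z hZ => (V_zero_iff _ _).1 (hgap Z 0 (fun i h _ => hZ i (by lia))))
      E hM (c + k + b+1).toNat Z (c + k) (by push_cast; lia) (by lia) hZ
  replace E : ∀ Z, Z ∈ tleMn M (c + k) → Ep Φ y Z := fun Z hZ =>
    E Z (le_mono (by push_cast; lia) hZ)
  obtain ⟨A, B, i, g, h, H, hA, hB⟩ := G.trunc Y (c+k)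
  obtain ⟨a, ha⟩ := Φ.exact i g h H y (h2 _ (ge_mono (by lia) hB) _)
  obtain ⟨u, hu⟩ := E A hA a
  have huu : u ≫ i ≫ u = u := by
    rw [← sub_eq_zero]
    apply Mn A hA
    rw [Φ.map_sub', Φ.map_comp, Φ.map_comp, hu, ha, hu, sub_self]
  obtain ⟨N, σ, ρ, e1, e2⟩ := IsIdempotentComplete.idempotents_split Y (u ≫ i) (by
    rw [Category.assoc, reassoc_of% huu])
  have lN : N ∈ tleMn M (c+k) := by
    refine le_retr (σ ≫ u) (i ≫ ρ) ?_ hA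
    rw [Category.assoc, ← Category.assoc u, ← e2, Category.assoc, e1, Category.comp_id, e1]
  have hn : Φ.map σ (Φ.map ρ y) = y := by
    rw [← Φ.map_comp, e2, Φ.map_comp, hu, ha]
  have E' : ∀ Z, Z ∈ tleMn M (c + k) → Ep Φ (Φ.map ρ y) Z := by
    intro Z hZ x
    obtain ⟨f, rfl⟩ := E Z hZ x
    exact ⟨σ ≫ f, by rw [Φ.map_comp, hn]⟩
  have M' : ∀ Z, Z ∈ tleMn M (c + k) → Mo Φ (Φ.map ρ y) Z := by
    intro Z hZ f hf
    rw [← Φ.map_comp] at hf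
    have := Mn Z hZ _ hf
    rw [← Category.id_comp f, ← e1, Category.assoc, this, comp_zero]
  refine ⟨N, Φ.map ρ y, thick.smd σ ρ e1 tY, fun Z => ?_⟩
  obtain ⟨A', B', i', g', h', H', hA', hB'⟩ := G.trunc Z (c+k)
  constructor
  · intro x
    obtain ⟨x', rfl⟩ := Φ.exact _ _ _ H' x (h2 _ (ge_mono (by lia) hB') _)
    obtain ⟨f, rfl⟩ := E' A' hA' x'
    exact ⟨f ≫ i', Φ.map_comp _ _ _⟩
  · intro f hf
    obtain ⟨f', rfl⟩ := H'.lift f (G.hom lN hB' (by lia) _)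
    rw [Φ.map_comp] at hf
    obtain ⟨u', v', H2⟩ := H'.irot
    obtain ⟨w', hw⟩ := Φ.exact _ _ _ H2 _ hf
    rw [h2 _ ((ge_sh (-1) (l-1) (by ring)).2 (ge_mono (by lia) hB')) w', map_zero] at hw
    rw [M' A' hA' f' hw.symm, zero_comp]

end brown


section colim
variable (P : ℕᵒᵖ ⥤ T)

/-- transition maps -/
def trH (Z : T) (i j : ℕ) (h : i ≤ j) :
    (P.obj (Opposite.op i) ⟶ Z) →+ (P.obj (Opposite.op j) ⟶ Z) :=
  AddMonoidHom.mk' (fun f => P.map (homOfLE h).op ≫ f) (fun _ _ => Preadditive.comp_add _ _ _ _ _ _)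

lemma trH_apply (Z : T) (i j : ℕ) (h : i ≤ j) (f : P.obj (Opposite.op i) ⟶ Z) :
    trH P Z i j h f = P.map (homOfLE h).op ≫ f := rfl

instance trH_sys (Z : T) : DirectedSystem (fun i : ℕ => P.obj (Opposite.op i) ⟶ Z)
    (fun i j h => trH P Z i j h) where
  map_self i x := by
    change P.map (𝟙 _) ≫ x = x
    rw [CategoryTheory.Functor.map_id, Category.id_comp]
  map_map i j k hij hjk x := by
    change P.map _ ≫ P.map _ ≫ x = P.map _ ≫ x
    rw [← Category.assoc, ← Functor.map_comp]
    rfl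

/-- colimit of representables -/
abbrev cObj (Z : T) := AddCommGroup.DirectLimit (fun i : ℕ => P.obj (Opposite.op i) ⟶ Z) (trH P Z)

/-- map into the colimit -/
noncomputable def cOf (n : ℕ) (Z : T) : (P.obj (Opposite.op n) ⟶ Z) →+ cObj P Z :=
  AddCommGroup.DirectLimit.of (fun i : ℕ => P.obj (Opposite.op i) ⟶ Z) (trH P Z) n

lemma cOf_tr {i j : ℕ} (h : i ≤ j) (Z : T) (f : P.obj (Opposite.op i) ⟶ Z) :
    cOf P j Z (P.map (homOfLE h).op ≫ f) = cOf P i Z f :=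
  AddCommGroup.DirectLimit.of_f (f := trH P Z) h f

lemma cOf_surj {Z : T} (z : cObj P Z) : ∃ (n : ℕ) (f : P.obj (Opposite.op n) ⟶ Z), cOf P n Z f = z :=
  AddCommGroup.DirectLimit.induction_on z (fun i x => ⟨i, x, rfl⟩)

lemma cOf_zero {Z : T} (n : ℕ) (f : P.obj (Opposite.op n) ⟶ Z) (h : cOf P n Z f = 0) :
    ∃ (j : ℕ) (hj : n ≤ j), P.map (homOfLE hj).op ≫ f = 0 :=
  AddCommGroup.DirectLimit.of.zero_exact (f := trH P Z) n f h

/-- functoriality -/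
noncomputable def cMap {Z Z' : T} (g : Z ⟶ Z') : cObj P Z →+ cObj P Z' :=
  AddCommGroup.DirectLimit.lift _ _ _
    (fun i => (cOf P i Z').comp (AddMonoidHom.mk' (fun f => f ≫ g)
      (fun _ _ => Preadditive.add_comp _ _ _ _ _ _))) (fun i j h f => by
        change cOf P j Z' ((P.map (homOfLE h).op ≫ f) ≫ g) = cOf P i Z' (f ≫ g)
        rw [Category.assoc, cOf_tr])

lemma cMap_of {Z Z' : T} (g : Z ⟶ Z') (n : ℕ) (f : P.obj (Opposite.op n) ⟶ Z) :
    cMap P g (cOf P n Z f) = cOf P n Z' (f ≫ g) :=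
  AddCommGroup.DirectLimit.lift_of (f := trH P Z) _ _ _ n f

/-- the colimit functor -/
noncomputable def colimF : CohF T where
  obj Z := cObj P Z
  grp Z := inferInstance
  map g := cMap P g
  map_id x := by
    obtain ⟨n, f, rfl⟩ := cOf_surj P x
    rw [cMap_of, Category.comp_id]
  map_comp g g' x := by
    obtain ⟨n, f, rfl⟩ := cOf_surj P x
    rw [cMap_of, cMap_of, cMap_of, Category.assoc]
  map_add g g' x := by
    obtain ⟨n, f, rfl⟩ := cOf_surj P x
    rw [cMap_of, cMap_of, cMap_of, Preadditive.comp_add, map_add]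
  exact f g h H x hx := by
    obtain ⟨n, a, rfl⟩ := cOf_surj P x
    rw [cMap_of] at hx
    obtain ⟨j, hj, h0⟩ := cOf_zero P n _ hx
    rw [← Category.assoc] at h0
    obtain ⟨b, hb⟩ := H.lift _ h0
    exact ⟨cOf P j _ b, by rw [cMap_of, hb, cOf_tr]⟩

lemma colimF_vn {Z : T} : (colimF P).vn Z ↔ ∀ (n : ℕ) (f : P.obj (Opposite.op n) ⟶ Z),
    ∃ (j : ℕ) (hj : n ≤ j), P.map (homOfLE hj).op ≫ f = 0 := by
  constructor
  · intro h n f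
    exact cOf_zero P n f (h _)
  · intro h x
    obtain ⟨n, f, rfl⟩ := cOf_surj P x
    obtain ⟨j, hj, h0⟩ := h n f
    rw [← cOf_tr P hj, h0, map_zero]
    rfl

lemma colimF_FL {Z : T} (h : (homF (P.obj (Opposite.op 0))).FL Z)
    (hs : ∀ (n : ℕ) (f : P.obj (Opposite.op n) ⟶ Z), ∃ f', P.map (homOfLE (Nat.zero_le n)).op ≫ f' = f) :
    (colimF P).FL Z := by
  refine ne_top_of_le_ne_top h (Module.length_le_of_surjective
    (natL (homF (P.obj (Opposite.op 0))) (colimF P) (fun X => cOf P 0 X)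
      (fun g x => (cMap_of P g 0 x).symm) Z) ?_)
  intro x
  obtain ⟨n, f, rfl⟩ := cOf_surj P x
  obtain ⟨f', rfl⟩ := hs n f
  exact ⟨f', (cOf_tr P _ _ _).symm⟩
end colim

section fin
variable {D : Set T} {N : T} (G : Good D N)
include G

lemma Good.fin_aux {X : T} (hX : filt {Y | heartSimple (heartM N) Y} X) : ∃ Fs : Set T, Fs.Finite ∧
    (∀ L ∈ Fs, heartSimple (heartM N) L) ∧
    ∀ L, heartSimple (heartM N) L → (∀ L' ∈ Fs, ¬ Nonempty (L' ≅ L)) → V0 X L := by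
  induction hX with
  | @of X h =>
    refine ⟨{X}, Set.finite_singleton X, fun L hL => ?_, fun L hL h' f => ?_⟩
    · obtain rfl : L = X := hL
      exact h
    · by_contra hf
      have := G.schur h hL f hf
      exact h' X rfl ⟨asIso f⟩
  | zero h => exact ⟨∅, Set.finite_empty, fun L hL => hL.elim, fun L _ _ f => h.eq_of_src _ _⟩
  | ext f g h hT hA hB iA iB =>
    obtain ⟨F1, a1, b1, c1⟩ := iA
    obtain ⟨F2, a2, b2, c2⟩ := iB
    exact ⟨F1 ∪ F2, a1.union a2, fun L hL => hL.elim (b1 L) (b2 L), fun L hL h' =>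
      V0_mid' hT L (c1 L hL fun L' h'' => h' L' (Or.inl h''))
        (c2 L hL fun L' h'' => h' L' (Or.inr h''))⟩

lemma Good.fin_simples : ∃ Fs : Set T, Fs.Finite ∧ (∀ L ∈ Fs, heartSimple (heartM N) L) ∧
    ∀ L, heartSimple (heartM N) L → ∃ L' ∈ Fs, Nonempty (L' ≅ L) := by
  obtain ⟨A, B, f, g, h, H, hA, hB⟩ := G.trunc N (-1)
  have hN : N ∈ tleMn N 0 := fun k hk => G.pres k hk
  have hB' : B ∈ heartM N := ⟨le_three H hN (le_mono (by lia) hA), by simpa using hB⟩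
  obtain ⟨Fs, a, b, c⟩ := G.fin_aux (G.heart_filt hB')
  refine ⟨Fs, a, b, fun L hL => ?_⟩
  by_contra h'
  push Not at h'
  have h1 := c L hL (fun L' hL' hh => (h' L' hL').elim hh.some)
  have h2 : V0 A L := G.hom hA hL.1.2 (by lia)
  exact hL.2.1 (G.heart_zero hL.1 (V0_mid' H L h2 h1))

lemma Good.van_dev (F : CohF.{w} T) {a' a k : ℤ} {X : T} (h1 : X ∈ tgeMn N a') (h2 : X ∈ tleMn N a)
    (h : ∀ L, heartSimple (heartM N) L → ∀ i, a' ≤ i → i ≤ a → F.van L (k - i)) : F.van X k := by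
  refine van_filt F ?_ (G.dev h1 h2)
  rintro s ⟨i, hi, hi', hs⟩
  have := h _ hs i hi hi'
  rwa [F.van_shift' s i (k-i) k (by ring)] at this

lemma Good.smc_fin {S : Set T} (hS : IsSMCof D S) : ∃ S₀ ⊆ S, S₀.Finite ∧ IsSMCof D S₀ := by
  obtain ⟨Fs, a, b, c⟩ := G.fin_simples
  have h1 : ∀ L ∈ Fs, ∃ S₀ ⊆ S, S₀.Finite ∧ thick S₀ L := fun L hL =>
    thick_fin ((hS.generates L).1 ((G.eqD L).2 ⟨0, (b L hL).1.2⟩))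
  choose! F f1 f2 f3 using h1
  have sub : (⋃ L ∈ Fs, F L) ⊆ S := Set.iUnion₂_subset f1
  refine ⟨⋃ L ∈ Fs, F L, sub, a.biUnion f2, ?_⟩
  refine ⟨sub.trans hS.subset, fun X hX Y hY => hS.negVanish X (sub hX) Y (sub hY),
    fun X hX => hS.nonzero X (sub hX), fun X hX => hS.endo X (sub hX),
    fun X hX Y hY => hS.noHom X (sub hX) Y (sub hY), fun X => ⟨fun hX => ?_, fun hX =>
      (hS.generates X).2 (thick_mono sub hX)⟩⟩
  obtain ⟨n, hn⟩ := (G.eqD X).1 hX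
  obtain ⟨m, hm⟩ := G.bdd X
  refine thick_trans ?_ (G.dev hn hm).thick
  rintro s ⟨i, -, -, hs⟩
  obtain ⟨L, hL, ⟨e⟩⟩ := c _ hs
  exact thick_unshift i (thick_iso e (thick_mono (Set.subset_biUnion_of_mem hL) (f3 L hL)))

lemma Good.FL_D_aux {Y : T} {b : ℤ} (hY : Y ∈ tgeMn N b) (k : ℕ) : ∀ X a, a ≤ b - 1 + k →
    X ∈ tleMn N a → (homF X).FL Y := by
  induction k with
  | zero => intro X a ha hX; exact (homF X).FL_vn (G.hom hX hY (by simp at ha; lia))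
  | succ k ih =>
    intro X a ha hX
    obtain ⟨Q, X', p, g, h, H, hQ, hX'⟩ := apx G.pres G.fl hX
    refine FL_mid' H Y (FLs_thick ?_ hQ.filt.thick Y) (ih X' (a-1) (by push_cast at ha; lia) hX')
    intro s hs
    obtain rfl : s = N⟦-a⟧ := hs
    exact fun X => FL_shift _ _ _ (G.fl _)

lemma Good.FL_D (X : T) {Y : T} (hY : Y ∈ D) : (homF X).FL Y := by
  obtain ⟨b, hb⟩ := (G.eqD Y).1 hY
  obtain ⟨a, ha⟩ := G.bdd X
  exact G.FL_D_aux hb (a + 1 - b).toNat X a (by lia) ha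

lemma Good.D_shift {X : T} (h : X ∈ D) (n : ℤ) : X⟦n⟧ ∈ D :=
  G.D_thick (S := D) subset_rfl ((thick.of h).shift n)

end fin

lemma Sums.ret_mono {S : Set T} {X : T} (h : Sums S X) {S' : Set T} (hs : S ⊆ S') : Sums S' X := by
  induction h with
  | zero h => exact .zero h
  | add hB hQ ih => exact .add ih (hs hQ)

open scoped ZeroObject in
lemma exists_U {S : Set T} (hS : S.Finite) : ∃ U, Sums S U ∧ ∀ s ∈ S, Ret s U := by
  induction S, hS using Set.Finite.induction_on with
  | empty => exact ⟨0, .zero (isZero_zero T), fun s hs => hs.elim⟩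
  | @insert a S ha hS ih =>
    obtain ⟨U, h1, h2⟩ := ih
    refine ⟨U ⊞ a, .add (h1.ret_mono (Set.subset_insert _ _)) (Set.mem_insert _ _), ?_⟩
    rintro s (rfl | hs)
    · exact Ret.inr _ _
    · exact (h2 s hs).trans (Ret.inl _ _)

lemma len_biprod_src (A B Y : T) : (homF (A ⊞ B)).len Y = (homF B).len Y + (homF A).len Y := by
  refine Module.length_eq_add_of_exact (preL biprod.snd Y) (preL biprod.inl Y) ?_ ?_ ?_
  · refine Function.LeftInverse.injective (g := preL biprod.inr Y) fun (x : B ⟶ Y) => ?_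
    change biprod.inr ≫ biprod.snd ≫ x = x
    simp
  · refine Function.RightInverse.surjective (g := preL biprod.fst Y) fun (x : A ⟶ Y) => ?_
    change biprod.inl ≫ biprod.fst ≫ x = x
    simp
  · intro (x : A ⊞ B ⟶ Y)
    change biprod.inl ≫ x = 0 ↔ _
    constructor
    · intro h
      refine ⟨(biprod.inr ≫ x : B ⟶ Y), ?_⟩
      change biprod.snd ≫ biprod.inr ≫ x = x
      apply biprod.hom_ext' <;> simp [h]
    · rintro ⟨y, rfl⟩
      exact (biprod.inl_snd_assoc _).trans zero_comp


lemma Sums.inj_tgt {S : Set T} {U : T} (h : Sums S U) {W Q : T} (q : W ⟶ Q)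
    (hq : ∀ s ∈ S, ∀ φ : Q ⟶ s, q ≫ φ = 0 → φ = 0) (φ : Q ⟶ U) (h0 : q ≫ φ = 0) : φ = 0 := by
  induction h with
  | zero h => exact h.eq_of_tgt _ _
  | @add B s hB hs ih =>
    have h1 := ih (φ ≫ biprod.fst) (by rw [← Category.assoc, h0, zero_comp])
    have h2 := hq s hs (φ ≫ biprod.snd) (by rw [← Category.assoc, h0, zero_comp])
    apply biprod.hom_ext
    · rw [h1, zero_comp]
    · rw [h2, zero_comp]

section apx
variable {D S : Set T} (hS : IsSMCof D S)
include hS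

open scoped ZeroObject in
lemma leftApx_aux (W U : T) (hU : ∀ s ∈ S, Ret s U) (n : ℕ) :
    ∃ (Q : T) (q : W ⟶ Q), Sums S Q ∧ (∀ s ∈ S, ∀ φ : Q ⟶ s, q ≫ φ = 0 → φ = 0) ∧
      ((∀ s ∈ S, ∀ f : W ⟶ s, ∃ φ : Q ⟶ s, q ≫ φ = f) ∨ (n : ℕ∞) ≤ (homF Q).len U) := by
  induction n with
  | zero => 
    exact ⟨0, 0, .zero (isZero_zero T), fun s _ φ _ => (isZero_zero T).eq_of_src _ _, Or.inr (by simp)⟩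
  | succ n ih =>
    obtain ⟨Q, q, hQ, hi, hs | hn⟩ := ih
    · exact ⟨Q, q, hQ, hi, Or.inl hs⟩
    by_cases hs : ∀ s ∈ S, ∀ f : W ⟶ s, ∃ φ : Q ⟶ s, q ≫ φ = f
    · exact ⟨Q, q, hQ, hi, Or.inl hs⟩
    push Not at hs
    obtain ⟨s, hs, f, hf⟩ := hs
    refine ⟨Q ⊞ s, biprod.lift q f, hQ.add hs, ?_, Or.inr ?_⟩
    · intro s' hs' φ h0
      have e : q ≫ biprod.inl ≫ φ + f ≫ biprod.inr ≫ φ = 0 := by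
        rw [← h0, biprod.lift_eq]; simp
      have h2 : biprod.inr ≫ φ = 0 := by
        by_cases hss : s = s'
        · subst hss
          rcases hS.endo s hs (biprod.inr ≫ φ) with h | h
          · exact h
          · exfalso
            refine hf ((-(biprod.inl ≫ φ)) ≫ inv (biprod.inr ≫ φ)) ?_
            rw [← cancel_mono (biprod.inr ≫ φ), Category.assoc, Category.assoc,
              IsIso.inv_hom_id, Category.comp_id, Preadditive.comp_neg]
            exact neg_eq_of_add_eq_zero_right e
        · exact hS.noHom s hs s' hs' hss _
      rw [h2, comp_zero, add_zero] at e
      have h1 := hi s' hs' _ e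
      apply biprod.hom_ext'
      · rw [h1, comp_zero]
      · rw [h2, comp_zero]
    · rw [len_biprod_src]
      push_cast
      rw [add_comm ((n:ℕ∞)) 1]
      have : (homF s).len U ≠ 0 := by
        rw [Ne, CohF.len_eq_zero]
        intro h
        obtain ⟨i, r, hir⟩ := hU s hs
        refine hS.nonzero s hs (isZero_of_id fun x => ?_)
        rw [← Category.comp_id x, ← hir, show i = (0 : s ⟶ U) from h i, zero_comp, comp_zero]
      exact add_le_add (Order.one_le_iff_pos.2 (pos_iff_ne_zero.2 this)) hn

lemma leftApx (hfin : S.Finite) (W : T) (hW : ∀ Y, Sums S Y → (homF W).FL Y) :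
    ∃ (Q : T) (q : W ⟶ Q), Sums S Q ∧ (∀ s ∈ S, ∀ φ : Q ⟶ s, q ≫ φ = 0 → φ = 0) ∧
      (∀ s ∈ S, ∀ f : W ⟶ s, ∃ φ : Q ⟶ s, q ≫ φ = f) := by
  obtain ⟨U, hU, hr⟩ := exists_U hfin
  obtain ⟨n, hn⟩ := ENat.ne_top_iff_exists.1 (hW U hU)
  obtain ⟨Q, q, hQ, hi, hs | hl⟩ := leftApx_aux hS W U hr (n+1)
  · exact ⟨Q, q, hQ, hi, hs⟩
  · exfalso
    have : (homF Q).len U ≤ (homF W).len U := Module.length_le_of_injective (preL q U) (by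
      rw [injective_iff_map_eq_zero]
      intro a ha
      exact hU.inj_tgt q hi a ha)
    rw [← hn] at this
    have := hl.trans this
    norm_cast at this
    lia

/-- positivity -/
def Pos (S : Set T) (X : T) : Prop := ∀ Z, (∀ s ∈ S, ∀ t : ℤ, 0 ≤ t → V0 (s⟦t⟧) Z) → V0 X Z

lemma Pos.sums {Q : T} (hQ : Sums S Q) (t : ℤ) (ht : 0 ≤ t) : Pos S (Q⟦t⟧) := by
  intro Z hZ
  rw [V0_src Q Z t (-t) (by ring)]
  refine V_filt_src ?_ hQ.filt
  intro s hs
  rw [← V0_src s Z t (-t) (by ring)]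
  exact hZ s hs t ht

lemma towStep (hfin : S.Finite) (hFL : ∀ X, ∀ Y ∈ D, (homF X).FL Y) (hD : ∀ X, thick S X → X ∈ D)
    (X : T) (m : ℤ) (hm : 1 ≤ m) :
    ∃ (X' : T) (π : X' ⟶ X), (∀ s ∈ S, ∀ f : X ⟶ s⟦m⟧, π ≫ f = 0) ∧
      (∀ s ∈ S, ∀ i : ℤ, i ≤ 0 → ∀ f : X ⟶ s⟦i⟧, π ≫ f = 0 → f = 0) ∧
      (∀ s ∈ S, ∀ i : ℤ, i ≤ 0 → ∀ f : X' ⟶ s⟦i⟧, ∃ f', π ≫ f' = f) ∧ (Pos S X → Pos S X') := by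
  obtain ⟨Q, q, hQ, hi, hs⟩ := leftApx hS hfin (X⟦-m⟧) (fun Y hY => hFL _ _ (hD _ hY.filt.thick))
  let e := (shiftFunctorCompIsoId T (-m) m (by ring)).app X
  obtain ⟨X', π, h, H⟩ := exists_fib (e.inv ≫ q⟦m⟧')
  have inj : ∀ s ∈ S, ∀ φ : Q⟦m⟧ ⟶ s⟦m⟧, (e.inv ≫ q⟦m⟧') ≫ φ = 0 → φ = 0 := by
    intro s hs φ h0
    obtain ⟨φ, rfl⟩ := (shiftFunctor T m).map_surjective φ
    rw [Category.assoc, Preadditive.IsIso.comp_left_eq_zero, ← Functor.map_comp] at h0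
    rw [hi s hs φ ((shiftFunctor T m).map_injective (by rw [h0, Functor.map_zero])), Functor.map_zero]
  have surj : ∀ s ∈ S, ∀ f : X ⟶ s⟦m⟧, ∃ φ : Q⟦m⟧ ⟶ s⟦m⟧, (e.inv ≫ q⟦m⟧') ≫ φ = f := by
    intro s hs' f
    obtain ⟨g, hg⟩ := (shiftFunctor T m).map_surjective (e.hom ≫ f)
    obtain ⟨φ, rfl⟩ := hs s hs' g
    refine ⟨φ⟦m⟧', ?_⟩
    rw [Category.assoc, ← Functor.map_comp, hg, e.inv_hom_id_assoc]
  have VQ : ∀ s ∈ S, ∀ j : ℤ, j < 0 → V Q s j := fun s hs j hj => V_filt_src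
    (fun s' hs' => hS.negVanish s' hs' s hs j hj) hQ.filt
  refine ⟨X', π, ?_, ?_, ?_, ?_⟩
  · intro s hs' f
    obtain ⟨φ, rfl⟩ := surj s hs' f
    rw [← Category.assoc, H.zero12, zero_comp]
  · intro s hs' i hi' f h0
    obtain ⟨φ, rfl⟩ := H.desc f h0
    have : V (Q⟦m⟧) s i := (V_src _ _ m i (i-m) (by ring)).2 (VQ s hs' _ (by lia))
    rw [this φ, comp_zero]
  · intro s hs' i hi' f
    have h0 : h ≫ f⟦(1:ℤ)⟧' = 0 := by
      let a := (shiftFunctorAdd' T i 1 (i+1) rfl).app s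
      have h1 : (e.inv ≫ q⟦m⟧') ≫ (h ≫ f⟦(1:ℤ)⟧') = 0 := by
        rw [← Category.assoc, H.zero23, zero_comp]
      rcases eq_or_lt_of_le (show i + 1 ≤ m by lia) with rfl | hlt
      · have := inj s hs' ((h ≫ f⟦(1:ℤ)⟧') ≫ a.inv) (by rw [← Category.assoc, h1, zero_comp])
        rwa [Preadditive.IsIso.comp_right_eq_zero] at this
      · have : V (Q⟦m⟧) s (i+1) := (V_src _ _ m _ (i+1-m) (by ring)).2 (VQ s hs' _ (by lia))
        have := this ((h ≫ f⟦(1:ℤ)⟧') ≫ a.inv)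
        rwa [Preadditive.IsIso.comp_right_eq_zero] at this
    obtain ⟨g, hg⟩ := H.rot.rot.desc _ h0
    obtain ⟨g', rfl⟩ := (shiftFunctor T (1:ℤ)).map_surjective g
    refine ⟨-g', (shiftFunctor T (1:ℤ)).map_injective ?_⟩
    rw [← hg, Functor.map_comp, Functor.map_neg, Preadditive.neg_comp, Preadditive.comp_neg]
  · intro hP Z hZ
    obtain ⟨u, v, H'⟩ := H.irot
    refine V0_mid' H' Z ?_ (hP Z hZ)
    exact V0_iso_src ((shiftFunctorAdd' T m (-1) (m-1) (by ring)).app Q)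
      (Pos.sums hS hQ (m-1) (by lia) Z hZ)

/-- the functor of the tower -/
lemma exists_tower (hfin : S.Finite) (hFL : ∀ X, ∀ Y ∈ D, (homF X).FL Y)
    (hD : ∀ X, thick S X → X ∈ D) : ∃ P : ℕᵒᵖ ⥤ T, 
      (∀ s ∈ S, ∀ i : ℤ, i ≠ 0 → (colimF P).van s i) ∧ (∀ s ∈ S, ¬ (colimF P).vn s) ∧
      (∀ s ∈ S, (colimF P).FL s) ∧
      (∀ Z, (∀ s ∈ S, ∀ t : ℤ, 0 ≤ t → V0 (s⟦t⟧) Z) → (colimF P).vn Z) := by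
  obtain ⟨U, hU, hr⟩ := exists_U hfin
  have st := fun (X : T) (k : ℕ) => towStep hS hfin hFL hD X ((k.unpair.1 : ℤ) + 1) (by lia)
  choose nx π p1 p2 p3 p4 using st
  let X : ℕ → T := fun n => Nat.rec U (fun k X => nx X k) n
  let P : ℕᵒᵖ ⥤ T := Functor.ofOpSequence (X := X) (fun n => π (X n) n)
  have hP : ∀ n, P.obj (Opposite.op n) = X n := fun n => rfl
  have hPm : ∀ n, P.map (homOfLE (Nat.le_add_right n 1)).op = π (X n) n := fun n =>
    Functor.ofOpSequence_map_homOfLE_succ _ n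
  have p1' : ∀ k : ℕ, ∀ s ∈ S, ∀ f : P.obj (Opposite.op k) ⟶ s⟦((k.unpair.1 : ℤ) + 1)⟧,
      P.map (homOfLE (Nat.le_add_right k 1)).op ≫ f = 0 := fun k s hs f => 
    (congrArg (fun z => z ≫ f) (hPm k)).trans (p1 (X k) k s hs f)
  have p2' : ∀ k : ℕ, ∀ s ∈ S, ∀ i : ℤ, i ≤ 0 → ∀ f : P.obj (Opposite.op k) ⟶ s⟦i⟧,
      P.map (homOfLE (Nat.le_add_right k 1)).op ≫ f = 0 → f = 0 := fun k s hs i hi f h0 => 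
    p2 (X k) k s hs i hi f ((congrArg (fun z => z ≫ f) (hPm k)).symm.trans h0)
  have p3' : ∀ k : ℕ, ∀ s ∈ S, ∀ i : ℤ, i ≤ 0 → ∀ f : P.obj (Opposite.op (k+1)) ⟶ s⟦i⟧,
      ∃ f', P.map (homOfLE (Nat.le_add_right k 1)).op ≫ f' = f := fun k s hs i hi f => by
    obtain ⟨f', h⟩ := p3 (X k) k s hs i hi f
    exact ⟨f', (congrArg (fun z => z ≫ f') (hPm k)).trans h⟩
  have hcomp : ∀ n k (h : n ≤ k), P.map (homOfLE (h.trans (Nat.le_add_right k 1))).op =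
      P.map (homOfLE (Nat.le_add_right k 1)).op ≫ P.map (homOfLE h).op := by
    intro n k h
    rw [← Functor.map_comp]; rfl
  have q2 : ∀ s ∈ S, ∀ i : ℤ, i ≤ 0 → ∀ n k (h : n ≤ k) (f : P.obj (Opposite.op n) ⟶ s⟦i⟧),
      P.map (homOfLE h).op ≫ f = 0 → f = 0 := by
    intro s hs i hi n k h f
    induction k, h using Nat.le_induction with
    | base => 
      intro h0
      rw [show (homOfLE (le_refl n)).op = 𝟙 (Opposite.op n) from rfl, CategoryTheory.Functor.map_id,
        Category.id_comp] at h0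
      exact h0
    | succ k h ih =>
      intro h0
      rw [hcomp n k h, Category.assoc] at h0
      exact ih (p2' k s hs i hi _ h0)
  have q3 : ∀ s ∈ S, ∀ i : ℤ, i ≤ 0 → ∀ n (f : P.obj (Opposite.op n) ⟶ s⟦i⟧),
      ∃ f', P.map (homOfLE (Nat.zero_le n)).op ≫ f' = f := by
    intro s hs i hi n
    induction n with
    | zero => 
      intro f
      refine ⟨f, ?_⟩
      rw [show (homOfLE (Nat.zero_le 0)).op = 𝟙 (Opposite.op 0) from rfl,
        CategoryTheory.Functor.map_id, Category.id_comp]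
    | succ n ih =>
      intro f
      obtain ⟨g, rfl⟩ := p3' n s hs i hi f
      obtain ⟨g', rfl⟩ := ih g
      refine ⟨g', ?_⟩
      rw [hcomp 0 n (Nat.zero_le n), Category.assoc]
  refine ⟨P, ?_, ?_, ?_, ?_⟩
  · intro s hs i hi
    refine (colimF_vn P).2 ?_
    intro n f
    rcases lt_or_gt_of_ne hi with hi | hi
    · obtain ⟨f', rfl⟩ := q3 s hs i hi.le n f
      have : V U s i := V_filt_src (fun s' hs' => hS.negVanish s' hs' s hs i hi) hU.filt
      exact ⟨n, le_rfl, by rw [show f' = 0 from this f', comp_zero, comp_zero]⟩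
    · let k := Nat.pair (i-1).toNat n
      have hk : n ≤ k := Nat.right_le_pair _ _
      refine ⟨k+1, by lia, ?_⟩
      rw [hcomp n k hk, Category.assoc]
      have := p1' k s hs
      have e : (((Nat.unpair k).1 : ℤ) + 1) = i := by simp [k]; lia
      rw [e] at this
      exact this _
  · intro s hs h
    rw [← CohF.van_zero_iff] at h
    have h' := (colimF_vn P).1 h
    obtain ⟨i, r, hir⟩ := hr s hs
    obtain ⟨j, hj, h0⟩ := h' 0 (r ≫ (shiftFunctorZero T ℤ).inv.app s)
    have : r ≫ (shiftFunctorZero T ℤ).inv.app s = (0 : U ⟶ _) := q2 s hs 0 le_rfl 0 j hj _ h0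
    rw [Preadditive.IsIso.comp_right_eq_zero] at this
    refine hS.nonzero s hs ((IsZero.iff_id_eq_zero s).2 ?_)
    rw [← hir, this, comp_zero]
  · intro s hs
    refine (colimF P).FL_iso ((shiftFunctorZero T ℤ).app s).symm (colimF_FL P ?_ (q3 s hs 0 le_rfl))
    exact hFL _ _ (hD _ ((thick.of hs).shift 0))
  · intro Z hZ
    refine (colimF_vn P).2 ?_
    intro n f
    have : ∀ n, Pos S (X n) := by
      intro n
      induction n with
      | zero => 
        intro Z hZ
        exact V0_iso_src ((shiftFunctorZero T ℤ).app U) (Pos.sums hS hU 0 le_rfl Z hZ)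
      | succ n ih => exact p4 _ _ ih
    exact ⟨n, le_rfl, by rw [show f = 0 from this n Z hZ f, comp_zero]⟩

end apx


lemma five_surj (F : CohF.{w} T) {A Z B A' Z' B' : T} {f : A ⟶ Z} {g : Z ⟶ B} {h : B ⟶ A⟦(1:ℤ)⟧}
    (H : DT f g h) {f' : A' ⟶ Z'} {g' : Z' ⟶ B'} {h' : B' ⟶ A'⟦(1:ℤ)⟧} (H' : DT f' g' h')
    (a : A ⟶ A') (b : Z ⟶ Z') (c : B ⟶ B') (e1 : f ≫ b = a ≫ f') (e2 : g ≫ c = b ≫ g')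
    (e3 : h ≫ a⟦(1:ℤ)⟧' = c ≫ h') (ha : ∀ x, ∃ y, F.map a y = x) (hc : ∀ x, ∃ y, F.map c y = x)
    (hi : ∀ y, F.map (a⟦(1:ℤ)⟧') y = 0 → y = 0) (x : F.obj Z') : ∃ y, F.map b y = x := by
  obtain ⟨y, hy⟩ := hc (F.map g' x)
  have h0 := hi (F.map h y) (by
    rw [← F.map_comp, e3, F.map_comp, hy, F.map_comp_zero _ _ H'.zero23])
  obtain ⟨z, rfl⟩ := F.exact _ _ _ H.rot y h0
  obtain ⟨x', hx'⟩ := F.exact _ _ _ H' (x - F.map b z) (by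
    rw [_root_.map_sub, ← F.map_comp b, ← e2, F.map_comp, hy, sub_self])
  obtain ⟨w, rfl⟩ := ha x'
  refine ⟨z + F.map f w, ?_⟩
  rw [_root_.map_add, ← F.map_comp f, e1, F.map_comp, hx']
  abel

lemma five_inj (F : CohF.{w} T) {A Z B A' Z' B' : T} {f : A ⟶ Z} {g : Z ⟶ B} {h : B ⟶ A⟦(1:ℤ)⟧}
    (H : DT f g h) {f' : A' ⟶ Z'} {g' : Z' ⟶ B'} {h' : B' ⟶ A'⟦(1:ℤ)⟧} (H' : DT f' g' h')
    (a : A ⟶ A') (b : Z ⟶ Z') (c : B ⟶ B') (e1 : f ≫ b = a ≫ f') (e2 : g ≫ c = b ≫ g')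
    (e3 : h ≫ a⟦(1:ℤ)⟧' = c ≫ h') (ha : ∀ x, ∃ y, F.map a y = x)
    (hb : ∀ y, F.map b y = 0 → y = 0)
    (hi : ∀ y, F.map (a⟦(1:ℤ)⟧') y = 0 → y = 0) (y : F.obj B) (hy : F.map c y = 0) : y = 0 := by
  have h0 := hi (F.map h y) (by
    rw [← F.map_comp, e3, F.map_comp, hy, _root_.map_zero])
  obtain ⟨z, rfl⟩ := F.exact _ _ _ H.rot y h0
  obtain ⟨x', hx'⟩ := F.exact _ _ _ H' (F.map b z) (by
    rw [← F.map_comp b, ← e2, F.map_comp, hy])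
  obtain ⟨w, rfl⟩ := ha x'
  have := hb (z - F.map f w) (by
    rw [_root_.map_sub, ← F.map_comp f, e1, F.map_comp, hx', sub_self])
  rw [sub_eq_zero.1 this, F.map_comp_zero _ _ H.zero12]

section ext
variable {D : Set T} {M : T} (G : Good D M)
include G

/-- truncation data -/
lemma exists_ext (Ψ : CohF.{w} T) (b : ℤ) (hFL : ∀ Z ∈ D, Ψ.FL Z)
    (hA : ∀ Z ∈ D, Z ∈ tleMn M (-b) → Ψ.vn Z) (hB : ∀ Z ∈ tgeMn M b, Ψ.vn Z) :
    ∃ Φ : CohF.{w} T, (∀ Z, Φ.FL Z) ∧ (∀ Z ∈ tleMn M (-b-1), Φ.vn Z) ∧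
      (∀ Z ∈ tgeMn M b, Φ.vn Z) ∧ ∀ Z ∈ D, (Φ.vn Z ↔ Ψ.vn Z) := by
  obtain ⟨n, hn⟩ : ∃ n : ℤ, n = -b-1 := ⟨_, rfl⟩
  choose A B i p h H hAl hBg using fun Z => G.trunc Z n
  have BD : ∀ Z, B Z ∈ D := fun Z => (G.eqD _).2 ⟨_, hBg Z⟩
  have uniq : ∀ (Z W : T) (x y : B Z ⟶ W), W ∈ tgeMn M (n+1) → p Z ≫ x = p Z ≫ y → x = y := by
    intro Z W x y hW hxy
    obtain ⟨z, hz⟩ := (H Z).rot.desc (x - y) (by rw [Preadditive.comp_sub, hxy, sub_self])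
    have : z = 0 := G.hom (a := n-1) ((le_sh 1 n (by ring)).2 (hAl Z)) hW (by lia) z
    rw [this, comp_zero] at hz
    exact sub_eq_zero.1 hz.symm
  have fac : ∀ (Z W : T) (f : Z ⟶ W), W ∈ tgeMn M (n+1) → ∃ x, p Z ≫ x = f := by
    intro Z W f hW
    exact (H Z).desc f (G.hom (hAl Z) hW (by lia) _)
  have ex : ∀ (Z Z' : T) (f : Z ⟶ Z'), ∃ t : B Z ⟶ B Z', p Z ≫ t = f ≫ p Z' := 
    fun Z Z' f => fac _ _ _ (hBg Z')
  choose t ht using ex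
  have key : ∀ (Z1 Z2 Z3 : T) (f : Z1 ⟶ Z2) (g : Z2 ⟶ Z3) (h : Z3 ⟶ Z1⟦(1:ℤ)⟧), DT f g h →
      ∀ x : Ψ.obj (B Z2), Ψ.map (t _ _ g) x = 0 → ∃ y, Ψ.map (t _ _ f) y = x := by
    intro Z1 Z2 Z3 f g h' H0 x hx
    obtain ⟨W, j, k', HW⟩ := exists_fib (t _ _ g)
    obtain ⟨y, rfl⟩ := Ψ.exact _ _ _ HW x hx
    have hW : W ∈ tgeMn M (n+1) := ge_one HW (hBg _) (ge_mono (by lia) (hBg _))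
    obtain ⟨u, e1, e3⟩ := H0.tr3' HW (p Z2) (p Z3) (ht _ _ g).symm
    obtain ⟨u', rfl⟩ := fac _ _ u hW
    have eu : u' ≫ j = t _ _ f := uniq _ _ _ _ (hBg _) (by rw [ht, e1, Category.assoc])
    obtain ⟨E, q, r, HE⟩ := exists_cone u'
    have i0 : ∀ Z k, n < k → ∀ y : (shiftF (homF M) k).obj Z, (shiftF (homF M) k).map (p Z) y = 0 → 
        y = 0 := fun Z k hk => CohF.inj_g (F := homF M) (H Z) k (hAl Z k hk)
    have s0 : ∀ Z k, n < k → ∀ x : (shiftF (homF M) k).obj (B Z),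
        ∃ y, (shiftF (homF M) k).map (p Z) y = x := 
      fun Z k hk => CohF.surj_g (F := homF M) (H Z) k (hAl Z _ (by lia))
    have i1 : ∀ Z k, n < k → ∀ y : (shiftF (homF M) k).obj (Z⟦(1:ℤ)⟧),
        (shiftF (homF M) k).map ((p Z)⟦(1:ℤ)⟧') y = 0 → y = 0 := 
      fun Z k hk => CohF.inj_g (F := homF M) ((H Z).sh 1) k
        ((V_tgt M _ 1 k (1+k) rfl).2 (hAl Z _ (by lia)))
    have s1 : ∀ Z k, n < k → ∀ x : (shiftF (homF M) k).obj ((B Z)⟦(1:ℤ)⟧),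
        ∃ y, (shiftF (homF M) k).map ((p Z)⟦(1:ℤ)⟧') y = x := 
      fun Z k hk => CohF.surj_g (F := homF M) ((H Z).sh 1) k
        ((V_tgt M _ 1 (k+1) (1+(k+1)) rfl).2 (hAl Z _ (by lia)))
    have e4 : (-f⟦(1:ℤ)⟧') ≫ (p Z2)⟦(1:ℤ)⟧' = (p Z1 ≫ u')⟦(1:ℤ)⟧' ≫ (-j⟦(1:ℤ)⟧') := by
      rw [Preadditive.neg_comp, Preadditive.comp_neg, ← Functor.map_comp, e1, Functor.map_comp]
    have iu : ∀ k, n < k → ∀ y : (shiftF (homF M) k).obj ((B Z1)⟦(1:ℤ)⟧),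
        (shiftF (homF M) k).map (u'⟦(1:ℤ)⟧') y = 0 → y = 0 := by
      intro k hk y hy
      obtain ⟨z, rfl⟩ := s1 Z1 k hk y
      rw [← CohF.map_comp, ← Functor.map_comp] at hy
      rw [five_inj (shiftF (homF M) k) H0.rot HW.rot (p Z2) (p Z3) _ (ht _ _ g).symm e3 e4
        (s0 _ k hk) (i0 _ k hk) (i1 _ k hk) z hy, _root_.map_zero]
    have su : ∀ k, n < k → ∀ x : (shiftF (homF M) k).obj (W⟦(1:ℤ)⟧),
        ∃ y, (shiftF (homF M) k).map (u'⟦(1:ℤ)⟧') y = x := by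
      intro k hk x
      have e5 : (-g⟦(1:ℤ)⟧') ≫ (p Z3)⟦(1:ℤ)⟧' = (p Z2)⟦(1:ℤ)⟧' ≫ (-(t _ _ g)⟦(1:ℤ)⟧') := by
        rw [Preadditive.neg_comp, Preadditive.comp_neg, ← Functor.map_comp, ← ht, Functor.map_comp]
      obtain ⟨y, rfl⟩ := five_surj (shiftF (homF M) k) H0.rot.rot HW.rot.rot (p Z3) _ _ e3 e4 e5
        (s0 _ k hk) (s1 _ k hk) (i1 _ k hk) x
      rw [Functor.map_comp, CohF.map_comp]
      exact ⟨_, rfl⟩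
    have hE : E ∈ tleMn M (n+1) := by
      intro k hk
      obtain ⟨a1, a2, H1⟩ := (HE.sh 1).irot
      have := CohF.van_fib (F := homF M) H1 k (iu k (by lia)) (su (k-1) (by lia))
      rw [CohF.van_shift' _ _ _ _ (k-1) (by ring), CohF.van_shift' _ _ _ _ k (by ring)] at this
      exact this
    have hE' : E ∈ D := (G.eqD _).2 ⟨n, ge_three HE (ge_mono (by lia) hW) (hBg _)⟩
    obtain ⟨z, rfl⟩ := Ψ.exact _ _ _ HE y (hA E hE' (le_mono (by lia) hE) _)
    exact ⟨z, by rw [← eu, Ψ.map_comp]⟩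
  let Φ : CohF.{w} T := 
    { obj := fun Z => Ψ.obj (B Z)
      grp := fun Z => inferInstance
      map := fun f => Ψ.map (t _ _ f)
      map_id := fun {X} x => by
        rw [show t _ _ (𝟙 X) = 𝟙 _ from uniq _ _ _ _ (hBg _) (by rw [ht]; simp), Ψ.map_id]
      map_comp := fun {X Y Z} f g x => by
        rw [show t _ _ (f ≫ g) = t _ _ f ≫ t _ _ g from uniq _ _ _ _ (hBg _) (by
          rw [ht, ← Category.assoc (p _), ht, Category.assoc, Category.assoc, ht]), Ψ.map_comp]
      map_add := fun {X Y} f g x => by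
        rw [show t _ _ (f + g) = t _ _ f + t _ _ g from uniq _ _ _ _ (hBg _) (by
          rw [ht, Preadditive.comp_add, ht, ht, Preadditive.add_comp]), Ψ.map_add]
      exact := fun f g h H => key _ _ _ f g h H }
  have eq : ∀ Z ∈ D, (Φ.vn Z ↔ Ψ.vn Z) := by
    intro Z hZ
    obtain ⟨m, hm⟩ := (G.eqD _).1 hZ
    have AD : A Z ∈ D := (G.eqD _).2 ⟨min m (n+2), ge_one (H Z) (ge_mono (by lia) hm)
      (ge_mono (by lia) (hBg Z))⟩
    have vA : Ψ.vn (A Z) := hA _ AD (le_mono (by lia) (hAl Z))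
    have vA1 : Ψ.vn ((A Z)⟦(1:ℤ)⟧) := hA _ (G.D_shift AD 1)
      ((le_sh 1 (-b+1) rfl).2 (le_mono (by lia) (hAl Z)))
    exact ⟨fun hv => Ψ.vn_mid (H Z) vA hv, fun hv => Ψ.vn_mid (H Z).rot hv vA1⟩
  have fl : ∀ Z, Φ.FL Z := by
    intro Z
    let φ : Φ.obj Z →ₗ[CatCenter T] Ψ.obj (B Z) :=
      { toFun := fun x => x
        map_add' := fun _ _ => rfl
        map_smul' := fun z x => by
          have e : t _ _ (z.app Z) = z.app (B Z) := uniq _ _ _ _ (hBg _) (by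
            rw [ht]; exact (z.naturality (p Z)).symm)
          exact congrArg (fun f => Ψ.map f x) e }
    exact ne_top_of_le_ne_top (hFL _ (BD Z)) (Module.length_le_of_injective φ (fun _ _ h => h))
  refine ⟨Φ, fl, ?_, ?_, eq⟩
  · intro Z hZ
    refine Ψ.vn_zero (isZero_of_id (G.hom (a := n) (le_three (H Z) (hn ▸ hZ) 
      (le_mono (by lia) (hAl Z))) (hBg Z) (by lia)))
  · intro Z hZ
    exact (eq Z ((G.eqD _).2 ⟨_, hZ⟩)).2 (hB Z hZ)

end ext


lemma FL_thick_all (F : CohF.{w} T) {S : Set T} (h : ∀ s ∈ S, ∀ k : ℤ, F.FL (s⟦k⟧)) {X : T}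
    (hX : thick S X) : ∀ k : ℤ, F.FL (X⟦k⟧) := by
  induction hX with
  | of hX => exact h _ hX
  | zero hX => exact fun k => F.FL_vn (F.van_zero hX k)
  | shift hX n ih => exact fun k => F.FL_iso ((shiftFunctorAdd T n k).app _).symm (ih _)
  | ext f g h hT hA hB iA iB =>
    exact fun k => F.FL_mid (DT.sh (f := f) (g := g) (h := h) hT k) (iA k) (iB k)
  | smd i r hir hY ih =>
    exact fun k => F.FL_retr (i⟦k⟧') (r⟦k⟧') (by
      rw [← Functor.map_comp, hir, CategoryTheory.Functor.map_id]) (ih k)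

lemma bd_thick (F : CohF.{w} T) {S : Set T} (h : ∀ s ∈ S, ∀ k : ℤ, k ≠ 0 → F.van s k) {X : T}
    (hX : thick S X) : ∃ b : ℕ, ∀ k : ℤ, (b < k ∨ k < -b) → F.van X k := by
  induction hX with
  | of hX => exact ⟨0, fun k hk => h _ hX k (by lia)⟩
  | zero hX => exact ⟨0, fun k hk => F.van_zero hX k⟩
  | shift hX n ih =>
    obtain ⟨b, hb⟩ := ih
    exact ⟨b + n.natAbs, fun k hk => (F.van_shift _ _ _).2 (hb _ (by lia))⟩
  | ext f g h hT hA hB iA iB =>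
    obtain ⟨b, hb⟩ := iA
    obtain ⟨b', hb'⟩ := iB
    exact ⟨b + b', fun k hk => CohF.van_mid hT k (hb k (by lia)) (hb' k (by lia))⟩
  | smd i r hir hY ih =>
    obtain ⟨b, hb⟩ := ih
    exact ⟨b, fun k hk => F.van_retr i r hir k (hb k hk)⟩

lemma fin_bound {α : Type*} {s : Set α} (hs : s.Finite) (P : α → ℕ → Prop)
    (hP : ∀ a ∈ s, ∃ b, P a b) (hm : ∀ a b c, b ≤ c → P a b → P a c) : ∃ b, ∀ a ∈ s, P a b := by
  induction s, hs using Set.Finite.induction_on with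
  | empty => exact ⟨0, by simp⟩
  | @insert a s _ _ ih =>
    obtain ⟨b, hb⟩ := ih (fun a' h => hP a' (Set.mem_insert_of_mem _ h))
    obtain ⟨b', hb'⟩ := hP a (Set.mem_insert _ _)
    refine ⟨b + b', ?_⟩
    intro x hx
    rcases hx with rfl | hx
    · exact hm _ _ _ (by lia) hb'
    · exact hm _ _ _ (by lia) (hb x hx)

lemma exists_N [IsIdempotentComplete T] {D S : Set T} {M : T} (G : Good D M) (hS : IsSMCof D S)
    (hfin : S.Finite) : ∃ N, thick {M} N ∧ (∀ s ∈ S, ∀ i : ℤ, i ≠ 0 → V N s i) ∧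
      (∀ s ∈ S, ¬ V0 N s) ∧
      (∀ Z ∈ D, (∀ s ∈ S, ∀ t : ℤ, 0 ≤ t → V0 (s⟦t⟧) Z) → V0 N Z) := by
  obtain ⟨P, h1, h2, h3, h4⟩ := exists_tower hS hfin (fun X Y hY => G.FL_D X hY)
    (fun X hX => (hS.generates X).2 hX)
  generalize colimF P = Ψ at h1 h2 h3 h4
  have flD : ∀ Z ∈ D, Ψ.FL Z := by
    intro Z hZ
    refine Ψ.FL_iso ((shiftFunctorZero T ℤ).app Z).symm
      (FL_thick_all Ψ (fun s hs k => ?_) ((hS.generates Z).1 hZ) 0)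
    by_cases hk : k = 0
    · subst hk
      exact Ψ.FL_iso ((shiftFunctorZero T ℤ).app s) (h3 s hs)
    · exact Ψ.FL_vn (h1 s hs k hk)
  obtain ⟨Fs, hFs, hsim, hall⟩ := G.fin_simples
  obtain ⟨b, hb⟩ := fin_bound hFs (fun L b => ∀ k : ℤ, ((b:ℤ) < k ∨ k < -(b:ℤ)) → Ψ.van L k)
    (fun L hL => bd_thick Ψ h1 ((hS.generates L).1 ((G.eqD L).2 ⟨0, (hsim L hL).1.2⟩)))
    (fun L b c hbc h k hk => h k (by lia))
  have hb' : ∀ L, heartSimple (heartM M) L → ∀ k : ℤ, ((b:ℤ) < k ∨ k < -(b:ℤ)) → Ψ.van L k := by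
    intro L hL k hk
    obtain ⟨L', hL', ⟨e⟩⟩ := hall L hL
    exact Ψ.van_iso e.symm k (hb L' hL' k hk)
  obtain ⟨Φ, f1, f2, f3, f4⟩ := exists_ext G Ψ (b+1) flD (by
      intro Z hZ hl
      obtain ⟨m, hm⟩ := (G.eqD Z).1 hZ
      rw [← Ψ.van_zero_iff]
      exact G.van_dev Ψ hm hl (fun L hL i hi hi' => hb' L hL _ (by lia))) (by
      intro Z hZ
      obtain ⟨m, hm⟩ := G.bdd Z
      rw [← Ψ.van_zero_iff]
      exact G.van_dev Ψ hZ hm (fun L hL i hi hi' => hb' L hL _ (by lia)))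
  obtain ⟨N, n, hN, hn⟩ := brown G f1 _ _ f2 f3
  have V1 : ∀ Z ∈ D, Ψ.vn Z → V0 N Z := fun Z hZ hv f => (hn Z).2 f ((f4 Z hZ).2 hv _)
  refine ⟨N, hN, ?_, ?_, ?_⟩
  · intro s hs i hi
    exact V1 _ (G.D_shift (hS.subset hs) i) (h1 s hs i hi)
  · intro s hs hv
    refine h2 s hs ((f4 s (hS.subset hs)).1 fun x => ?_)
    obtain ⟨f, rfl⟩ := (hn s).1 x
    rw [hv f, Φ.map_zero']
  · intro Z hZ hv
    exact V1 Z hZ (h4 Z hv)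


/-- the conclusion of the Brown step -/
structure NData (D S : Set T) (M N : T) : Prop where
  good : Good D M
  smc : IsSMCof D S
  fin : S.Finite
  thk : thick {M} N
  f1 : ∀ s ∈ S, ∀ i : ℤ, i ≠ 0 → V N s i
  f2 : ∀ s ∈ S, ¬ V0 N s
  f3 : ∀ Z ∈ D, ∀ p : ℤ, (∀ s ∈ S, ∀ i : ℤ, i ≤ p → V s Z i) → V N Z p

lemma exists_NData [IsIdempotentComplete T] {D S : Set T} {M : T} (G : Good D M) (hS : IsSMCof D S)
    (hfin : S.Finite) : ∃ N, NData D S M N := by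
  obtain ⟨N, h0, h1, h2, h3⟩ := exists_N G hS hfin
  refine ⟨N, G, hS, hfin, h0, h1, h2, ?_⟩
  intro Z hZ p h
  refine h3 _ (G.D_shift hZ p) ?_
  intro s hs t ht
  rw [V0_src _ _ t (-t) (by ring), V_tgt _ _ p (-t) (p-t) (by ring)]
  exact h s hs _ (by lia)

namespace NData
variable {D S : Set T} {M N : T} (K : NData D S M N)
include K

lemma fls : FLs N := FLs_thick (S := {M}) (fun s hs => by
  obtain rfl : s = M := hs; exact K.good.fl) K.thk

lemma f1' {s : T} (hs : s ∈ S) (t j : ℤ) (h : j ≠ t) : V N (s⟦-t⟧) j := by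
  rw [V_tgt _ _ (-t) j (j-t) (by ring)]
  exact K.f1 s hs _ (by lia)

lemma f2' {s : T} (hs : s ∈ S) (t : ℤ) : ¬ V N (s⟦-t⟧) t := by
  rw [V_tgt _ _ (-t) t 0 (by ring), V_zero_iff]
  exact K.f2 s hs

lemma exists_le : ∃ l : ℤ, ∀ s ∈ S, s ∈ tleMn M l := by
  obtain ⟨b, hb⟩ := fin_bound K.fin (fun s (b : ℕ) => s ∈ tleMn M b) (fun s _ => by
    obtain ⟨n, hn⟩ := K.good.bdd s
    exact ⟨n.toNat, le_mono (by lia) hn⟩) (fun a b c h => le_mono (by exact_mod_cast h))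
  exact ⟨b, hb⟩

lemma exists_ge : ∃ l : ℤ, ∀ s ∈ S, s ∈ tgeMn M l := by
  obtain ⟨b, hb⟩ := fin_bound K.fin (fun s (b : ℕ) => s ∈ tgeMn M (-(b:ℤ))) (fun s hs => by
    obtain ⟨n, hn⟩ := (K.good.eqD s).1 (K.smc.subset hs)
    exact ⟨(-n).toNat, ge_mono (by lia) hn⟩) (fun a b c h => ge_mono (by lia))
  exact ⟨_, hb⟩

/-- first step in the tower of an object -/
lemma step {Z : T} (hZ : Z ∈ D) (hz : ¬ IsZero Z) : ∃ (s : T) (t : ℤ) (Z1 : T) (f : s⟦-t⟧ ⟶ Z)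
    (g : Z ⟶ Z1) (h : Z1 ⟶ s⟦-t⟧⟦(1:ℤ)⟧), s ∈ S ∧ DT f g h ∧ Z1 ∈ D ∧ (∀ i, i < t → V N Z i) ∧
      (∀ i, i < t → V N Z1 i) := by
  have G := K.good
  obtain ⟨l, hl⟩ := K.exists_le
  obtain ⟨m, hm⟩ := (G.eqD Z).1 hZ
  have ne : ∃ t : ℤ, ∃ s ∈ S, ¬ V s Z t := by
    by_contra h
    push Not at h
    exact hz (isZero_of_id ((V_zero_iff _ _).1
      (V_thick_src (fun s hs k => h k s hs) ((K.smc.generates Z).1 hZ) 0)))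
  obtain ⟨t, ⟨s, hs, hf⟩, hmin⟩ := Int.exists_least_of_bdd ⟨m - l, fun t ⟨s, hs, h⟩ => by
    by_contra hlt
    exact h (G.hom (hl s hs) ((ge_sh t m (by ring : m - t + t = m)).2 hm) (by lia))⟩ ne
  have hlow : ∀ s ∈ S, ∀ i, i < t → V s Z i := by
    intro s hs i hi
    by_contra h
    have := hmin i ⟨s, hs, h⟩
    lia
  have hf' : ¬ V0 (s⟦-t⟧) Z := by rwa [V0_src _ _ (-t) t (by ring)]
  unfold V0 at hf'
  push Not at hf'
  obtain ⟨f, hf0⟩ := hf'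
  obtain ⟨Z1, g, h, H⟩ := exists_cone f
  have hZ1 : Z1 ∈ D := G.D_thick (S := D) subset_rfl
    (thick.ext g h _ H.rot (thick.of hZ) (((thick.of (K.smc.subset hs)).shift _).shift _))
  have hlow1 : ∀ s' ∈ S, ∀ i, i < t → V s' Z1 i := by
    intro s' hs' i hi
    by_cases hit : i + 1 < t
    · refine V_three H s' i (hlow s' hs' i hi) ?_
      rw [V_tgt _ _ (-t) (i+1) (i+1-t) (by ring)]
      exact K.smc.negVanish s' hs' s hs _ (by lia)
    obtain rfl : i = t - 1 := by lia
    obtain ⟨u, v, H'⟩ := H.irot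
    have := CohF.van_fib (F := homF s') H' t ?_ ?_
    · rwa [CohF.van_shift' _ _ _ _ (t-1) (by ring)] at this
    · intro y hy
      change s' ⟶ s⟦-t⟧⟦t⟧ at y
      have hy : y ≫ f⟦t⟧' = 0 := hy
      let e := (shiftFunctorCompIsoId T (-t) t (by ring)).app s
      by_cases hss : s' = s
      · subst hss
        rcases K.smc.endo s' hs' (y ≫ e.hom) with h0 | h0
        · exact (Preadditive.IsIso.comp_right_eq_zero y e.hom).1 h0
        · exfalso
          have : IsIso y := IsIso.of_isIso_comp_right y e.hom
          rw [Preadditive.IsIso.comp_left_eq_zero] at hy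
          exact hf0 ((shiftFunctor T t).map_injective (by rw [hy, Functor.map_zero]))
      · exact (Preadditive.IsIso.comp_right_eq_zero y e.hom).1 (K.smc.noHom s' hs' s hs hss _)
    · intro x
      exact ⟨0, by rw [_root_.map_zero]; exact (hlow s' hs' (t-1) (by lia) x).symm⟩
  refine ⟨s, t, Z1, f, g, h, hs, H, hZ1, ?_, ?_⟩
  · exact fun i hi => K.f3 Z hZ i (fun s' hs' j hj => hlow s' hs' j (by lia))
  · exact fun i hi => K.f3 Z1 hZ1 i (fun s' hs' j hj => hlow1 s' hs' j (by lia))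

lemma tow_aux {P : T → Prop} (h0 : ∀ Z, IsZero Z → P Z)
    (h1 : ∀ (Z Z1 s : T) (t : ℤ) (f : s⟦-t⟧ ⟶ Z) (g : Z ⟶ Z1) (h : Z1 ⟶ s⟦-t⟧⟦(1:ℤ)⟧), Z ∈ D →
      s ∈ S → DT f g h → Z1 ∈ D → (∀ i, i < t → V N Z i) → (∀ i, i < t → V N Z1 i) →
      (∀ i, V N Z i → V N Z1 i) → ¬ V N Z t → P Z1 → P Z) (lo hi : ℤ) (n : ℕ) : 
    ∀ Z ∈ D, (∀ i, (i < lo ∨ hi < i) → V N Z i) →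
      ∑ m ∈ Finset.Icc lo hi, (homF N).len (Z⟦m⟧) ≤ n → P Z := by
  induction n with
  | zero => 
    intro Z hZ hb hn
    by_cases hz : IsZero Z
    · exact h0 Z hz
    exfalso
    obtain ⟨s, t, Z1, f, g, h, hs, H, hZ1, a1, a2⟩ := K.step hZ hz
    refine K.f2' hs t (V_one H N t ?_ (a2 _ (by lia)))
    by_cases ht : t < lo ∨ hi < t
    · exact hb t ht
    · simp only [CharP.cast_eq_zero, nonpos_iff_eq_zero, Finset.sum_eq_zero_iff, CohF.len_eq_zero] at hn
      exact hn t (by simp; lia)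
  | succ n ih =>
    intro Z hZ hb hn
    by_cases hz : IsZero Z
    · exact h0 Z hz
    obtain ⟨s, t, Z1, f, g, h, hs, H, hZ1, a1, a2⟩ := K.step hZ hz
    have hV : ¬ V N Z t := fun hv => K.f2' hs t (V_one H N t hv (a2 _ (by lia)))
    have ht : t ∈ Finset.Icc lo hi := by
      by_contra ht
      exact hV (hb t (by simp at ht; lia))
    have hv : ∀ i, V N Z i → V N Z1 i := by
      intro i hi
      by_cases hit : i < t
      · exact a2 i hit
      · exact V_three H N i hi (K.f1' hs t _ (by lia))
    refine h1 Z Z1 s t f g h hZ hs H hZ1 a1 a2 hv hV (ih Z1 hZ1 (fun i hi => hv i (hb i hi)) ?_)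
    have hle : ∀ m : ℤ, (homF N).len (Z1⟦m⟧) ≤ (homF N).len (Z⟦m⟧) := by
      intro m
      by_cases hm : m < t
      · rw [(homF N).len_eq_zero.2 (a2 m hm)]; exact bot_le
      · exact Module.length_le_of_surjective ((homF N).lmap (g⟦m⟧'))
          (CohF.surj_g (F := homF N) H m (K.f1' hs t _ (by lia)))
    have heq : (homF N).len (Z⟦t⟧) = (homF N).len (s⟦-t⟧⟦t⟧) + (homF N).len (Z1⟦t⟧) := by
      refine (homF N).len_ses (H.sh t) ?_ ?_
      · exact ((homF N).van_shift' _ t 1 (t+1) rfl).2 (K.f1' hs t _ (by lia))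
      · exact ((homF N).van_shift' _ t (-1) (t-1) rfl).2 (a2 _ (by lia))
    have hne : 1 ≤ (homF N).len (s⟦-t⟧⟦t⟧) := by
      rw [Order.one_le_iff_pos, pos_iff_ne_zero, Ne, CohF.len_eq_zero]
      exact K.f2' hs t
    have hsum : 1 + ∑ m ∈ Finset.Icc lo hi, (homF N).len (Z1⟦m⟧) ≤
        ∑ m ∈ Finset.Icc lo hi, (homF N).len (Z⟦m⟧) := by
      rw [← Finset.add_sum_erase _ _ ht, ← Finset.add_sum_erase _ _ ht, heq, ← add_assoc]
      exact add_le_add (add_le_add hne le_rfl) (Finset.sum_le_sum fun m _ => hle m)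
    have := hsum.trans hn
    rw [add_comm] at this
    push_cast at this
    exact (ENat.add_le_add_iff_right (by simp)).1 this

lemma bd : ∃ b : ℤ, 0 ≤ b ∧ (∀ X n m, n + b ≤ m → X ∈ tleMn M n → X ∈ tleMn N m) ∧
    (∀ X n m, m + b ≤ n → X ∈ tgeMn M n → X ∈ tgeMn N m) := by
  obtain ⟨b, h0, h1, h2, -⟩ := gap_lege K.thk
  exact ⟨b, h0, h1, h2⟩

lemma tow {P : T → Prop} (h0 : ∀ Z, IsZero Z → P Z)
    (h1 : ∀ (Z Z1 s : T) (t : ℤ) (f : s⟦-t⟧ ⟶ Z) (g : Z ⟶ Z1) (h : Z1 ⟶ s⟦-t⟧⟦(1:ℤ)⟧), Z ∈ D →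
      s ∈ S → DT f g h → Z1 ∈ D → (∀ i, i < t → V N Z i) → (∀ i, i < t → V N Z1 i) →
      (∀ i, V N Z i → V N Z1 i) → ¬ V N Z t → P Z1 → P Z) {Z : T} (hZ : Z ∈ D) : P Z := by
  obtain ⟨b, hb0, hb1, hb2⟩ := K.bd
  obtain ⟨m, hm⟩ := (K.good.eqD Z).1 hZ
  obtain ⟨a, ha⟩ := K.good.bdd Z
  have hfin : ∑ m ∈ Finset.Icc (m-b) (a+b), (homF N).len (Z⟦m⟧) ≠ ⊤ := by
    rw [Ne, ENat.sum_eq_top]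
    rintro ⟨j, -, hj⟩
    exact K.fls (Z⟦j⟧) hj
  obtain ⟨n, hn⟩ := ENat.ne_top_iff_exists.1 hfin
  refine K.tow_aux h0 h1 (m-b) (a+b) n Z hZ ?_ hn.ge
  rintro i (hi | hi)
  · exact hb2 Z m (m-b) (by lia) hm i hi
  · exact hb1 Z a (a+b) (by lia) ha i hi

lemma gam {l : ℤ} (hl : ∀ s ∈ S, s ∈ tleMn M l) {Z : T} (hZ : Z ∈ D) :
    ∀ p, (∀ j, p < j → V N Z j) → Z ∈ tleMn M (l + p) := by
  refine K.tow (P := fun Z => ∀ p, (∀ j, p < j → V N Z j) → Z ∈ tleMn M (l + p)) ?_ ?_ hZ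
  · intro Z hz p _
    exact le_zero _ hz
  · intro Z Z1 s t f g h hZ hs H hZ1 a1 a2 hv hV ih p hp
    have htp : t ≤ p := by
      by_contra h
      exact hV (hp t (by lia))
    refine le_mid H ((le_sh (-t) (l + p - t) rfl).2 (le_mono (by lia) (hl s hs))) 
      (ih p fun j hj => hv j (hp j hj))

lemma zero_of {Z : T} (hZ : Z ∈ D) (h : ∀ j, V N Z j) : IsZero Z := by
  obtain ⟨l, hl⟩ := K.exists_le
  exact K.good.zero_of fun k => K.gam hl hZ (k - l - 1) (fun j _ => h j) k (by lia)

lemma beta' {Z : T} (hZ : Z ∈ D) : ∀ p, ¬ V N Z p → (∀ j, p < j → V N Z j) →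
    ∃ s ∈ S, ¬ V Z s (-p) := by
  refine K.tow (P := fun Z => ∀ p, ¬ V N Z p → (∀ j, p < j → V N Z j) → ∃ s ∈ S, ¬ V Z s (-p)) ?_ ?_ hZ
  · intro Z hz p hp
    exact absurd ((homF N).van_zero hz p) hp
  · intro Z Z1 s t f g h hZ hs H hZ1 a1 a2 hv hV ih p hp hj
    have htp : t ≤ p := by
      by_contra h
      exact hV (hj t (by lia))
    by_cases h1 : V N Z1 p
    · obtain rfl : p = t := by
        by_contra hne
        exact hp (V_mid H N p (K.f1' hs t p hne) h1)
      have hz := K.zero_of hZ1 (fun j => by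
        rcases lt_trichotomy j p with hlt | rfl | hlt
        · exact a2 j hlt
        · exact h1
        · exact hv j (hj j hlt))
      have := H.isZero3 hz
      refine ⟨s, hs, fun h0 => ?_⟩
      have h2 := V_iso_src (asIso f).symm s (-p) h0
      rw [V_src _ _ (-p) (-p) 0 (by ring), V_zero_iff] at h2
      exact K.smc.nonzero s hs (isZero_of_id h2)
    · obtain ⟨s', hs', hn⟩ := ih p h1 (fun j hj' => hv j (hj j hj'))
      refine ⟨s', hs', fun h0 => hn (V_three' H s' (-p) h0 ?_)⟩
      rw [V_src _ _ (-t) (-p-1) (-p-1+t) (by ring)]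
      exact K.smc.negVanish s hs s' hs' _ (by lia)

lemma beta {Z : T} (hZ : Z ∈ D) (h : ∀ s ∈ S, ∀ i : ℤ, i ≤ 0 → V Z s i) : ∀ j : ℤ, 0 ≤ j → V N Z j := by
  intro j hj
  by_contra hn
  obtain ⟨b, hb0, hb1, hb2⟩ := K.bd
  obtain ⟨a, ha⟩ := K.good.bdd Z
  obtain ⟨p, ⟨hp0, hp⟩, hmax⟩ := Int.exists_greatest_of_bdd (P := fun j => 0 ≤ j ∧ ¬ V N Z j) ⟨a + b, fun j hj => by
    by_contra hlt
    exact hj.2 (hb1 Z a (a+b) le_rfl ha j (by lia))⟩ ⟨j, hj, hn⟩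
  obtain ⟨s, hs, h'⟩ := K.beta' hZ p hp (fun j hj => by
    by_contra h
    have := hmax j ⟨by lia, h⟩
    lia)
  exact h' (h s hs _ (by lia))

lemma pres : Pres N := by
  intro m hm
  obtain ⟨b, hb0, hb1, hb2⟩ := K.bd
  obtain ⟨l, hl⟩ := K.exists_ge
  obtain ⟨n, hn1, hn2⟩ : ∃ n : ℤ, n + b < 0 ∧ n ≤ l := ⟨min (-b-1) l, by lia, by lia⟩
  obtain ⟨A, B, f, g, h, H, hA, hB⟩ := K.good.trunc (N⟦m⟧) n
  have h1 : V N A 0 := hb1 A n (n+b) le_rfl hA 0 hn1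
  have h2 : V N B 0 := by
    refine K.beta ((K.good.eqD _).2 ⟨_, hB⟩) ?_ 0 le_rfl
    intro s hs i hi
    refine V_three' H s i ?_ ?_
    · rw [V_src _ _ m i (i-m) (by ring)]
      exact K.f1 s hs _ (by lia)
    · exact K.good.hom hA ((ge_sh (i-1) l (by ring : l - (i-1) + (i-1) = l)).2 (hl s hs)) (by lia)
  exact (V_zero_iff _ _).1 (V_mid H N 0 h1 h2)

end NData


/-- one step of the construction of left approximations by thick(N) -/
lemma fib_step {N M F X : T} (hp : Pres N) (hf : FLs N) {f : F ⟶ M} {g : M ⟶ X} {d : X ⟶ F⟦(1:ℤ)⟧}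
    (H : DT f g d) (hF : thick {N} F) (a : ℤ) (hX : ∀ j, a < j → V N X j) :
    ∃ (F' X' : T) (f' : F' ⟶ M) (g' : M ⟶ X') (d' : X' ⟶ F'⟦(1:ℤ)⟧), DT f' g' d' ∧ thick {N} F' ∧
      ∀ j, a - 1 < j → V N X' j := by
  obtain ⟨Q, Y, p, q, r, HQ, hQ, hY, hQV⟩ := coneApx hp hf X a
  obtain ⟨F', u, v, HF⟩ := exists_mid (p ≫ d)
  obtain ⟨b, e1, e2⟩ : ∃ b : F' ⟶ M, u ≫ b = f ∧ v ≫ p = b ≫ g := by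
    obtain ⟨b, e1, e2⟩ := complete_distinguished_triangle_morphism₂ _ _ HF H (𝟙 F) p (by
      change (p ≫ d) ≫ (𝟙 F)⟦(1:ℤ)⟧' = p ≫ d
      rw [CategoryTheory.Functor.map_id, Category.comp_id])
    exact ⟨b, e1.trans (Category.id_comp _), e2⟩
  obtain ⟨X', g', d', H'⟩ := exists_cone b
  refine ⟨F', X', b, g', d', H', ?_, ?_⟩
  · refine thick.ext u v _ HF hF (thick_trans ?_ hQ.filt.thick)
    intro s hs
    obtain rfl : s = N⟦-a⟧ := hs
    exact (thick.of (Set.mem_singleton N)).shift _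
  intro k hk
  have ps : ∀ x : (shiftF (homF N) k).obj X, ∃ y, (shiftF (homF N) k).map p y = x := by
    intro x
    refine (shiftF (homF N) k).exact _ _ _ HQ x ?_
    rcases eq_or_lt_of_le (show a ≤ k by lia) with rfl | hk'
    · exact hY _
    · have : x = 0 := hX k hk' x
      rw [this, _root_.map_zero]
  have idi : ∀ (Z : T) (y : (shiftF (homF N) k).obj Z), (shiftF (homF N) k).map (𝟙 Z) y = 0 → y = 0 := by
    intro Z y hy
    rwa [CohF.map_id] at hy
  have s1 : ∀ x : (shiftF (homF N) k).obj M, ∃ y, (shiftF (homF N) k).map b y = x := by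
    refine five_surj (shiftF (homF N) k) HF H (𝟙 F) b p (by rw [e1, Category.id_comp]) e2 ?_ (fun x => ⟨x, CohF.map_id _ _⟩) ps ?_
    · rw [CategoryTheory.Functor.map_id, Category.comp_id]
    · rw [CategoryTheory.Functor.map_id]; exact idi _
  have i1 : ∀ y, (shiftF (homF N) k).map (b⟦(1:ℤ)⟧') y = 0 → y = 0 := by
    refine five_inj (shiftF (homF N) k) HF.rot.rot H.rot.rot p (𝟙 _) (b⟦(1:ℤ)⟧') ?_ ?_ ?_ ps (idi _) ?_
    · rw [Category.comp_id]
    · rw [Category.id_comp, Preadditive.neg_comp, ← Functor.map_comp, e1]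
    · rw [Preadditive.neg_comp, Preadditive.comp_neg, ← Functor.map_comp, ← Functor.map_comp, e2]
    · intro y _
      exact ((homF N).van_shift' Q 1 k (k+1) (by ring)).2 (hQV _ (by lia)) y
  intro x
  have h00 : d' ≫ b⟦(1:ℤ)⟧' = 0 := by
    have := H'.rot.zero23
    rwa [Preadditive.comp_neg, neg_eq_zero] at this
  have h0 := i1 ((shiftF (homF N) k).map d' x) ((shiftF (homF N) k).map_comp_zero _ _ h00 x)
  obtain ⟨y, hy⟩ := (shiftF (homF N) k).exact _ _ _ H'.rot x h0
  obtain ⟨z, rfl⟩ := s1 y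
  rw [← hy]
  exact (shiftF (homF N) k).map_comp_zero _ _ H'.zero12 z

namespace NData
variable {D S : Set T} {M N : T} (K : NData D S M N)
include K

lemma thk' : thick {N} M := by
  obtain ⟨b, hb0, hb1, hb2⟩ := K.bd
  obtain ⟨l, hl⟩ := K.exists_le
  have key : ∀ n : ℕ, ∃ (F X : T) (f : F ⟶ M) (g : M ⟶ X) (d : X ⟶ F⟦(1:ℤ)⟧), DT f g d ∧
      thick {N} F ∧ ∀ j, b - n < j → V N X j := by
    intro n
    induction n with
    | zero =>
      obtain ⟨F, f, d, H⟩ := exists_fib (𝟙 M)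
      refine ⟨F, M, f, _, d, H, thick.zero ?_, ?_⟩
      · exact Triangle.isZero₁_of_isIso₂ _ H (inferInstanceAs (IsIso (𝟙 M)))
      · intro j hj
        exact hb1 M 0 b (by lia) K.good.le_self j (by lia)
    | succ n ih =>
      obtain ⟨F, X, f, g, d, H, hF, hX⟩ := ih
      obtain ⟨F', X', f', g', d', H', hF', hX'⟩ := fib_step K.pres K.fls H hF _ hX
      exact ⟨F', X', f', g', d', H', hF', fun j hj => hX' j (by push_cast at hj; lia)⟩
  obtain ⟨F, X, f, g, d, H, hF, hX⟩ := key (b + l + 1).toNat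
  replace hX : ∀ j, - l - 1 < j → V N X j := fun j hj => hX j (by lia)
  obtain ⟨n, hn1, hn2⟩ : ∃ n : ℤ, n ≤ -1 ∧ n + b ≤ - l - 1 := ⟨min (-1) (-l-1-b), by lia, by lia⟩
  obtain ⟨A, B, i, q, w, HX, hA, hB⟩ := K.good.trunc X n
  have hBD : B ∈ D := (K.good.eqD _).2 ⟨_, hB⟩
  have hB' : B ∈ tleMn M (l + (-l-1)) := K.gam hl hBD _ fun j hj =>
    V_three HX N j (hX j hj) (hb1 A n (n+b) le_rfl hA (j+1) (by lia))
  have hXM : X ∈ tleMn M (-1) := le_mid HX (le_mono hn1 hA) (le_mono (by lia) hB')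
  have hg : g = 0 := (V_zero_iff M X).1 (hXM 0 (by lia)) g
  obtain ⟨r, hr⟩ := H.retr_of_g_zero hg
  exact thick.smd r f hr hF

lemma goodN : Good D N := good_transfer K.good K.pres K.thk K.thk'

lemma mem_heart {s : T} (hs : s ∈ S) : s ∈ heartM N :=
  ⟨fun k hk => K.f1 s hs k (by lia), fun k hk => K.f1 s hs k (by lia)⟩

lemma exists_map {A : T} (hA : A ∈ heartM N) (hz : ¬ IsZero A) : ∃ s ∈ S, ∃ f : s ⟶ A, f ≠ 0 := by
  by_contra h
  push Not at h
  refine hz (K.goodN.heart_zero hA ((V_zero_iff _ _).1 (K.f3 A ((K.goodN.eqD _).2 ⟨0, hA.2⟩) 0 ?_)))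
  intro s hs i hi
  rcases eq_or_lt_of_le hi with rfl | hi
  · exact (V_zero_iff _ _).2 (h s hs)
  · exact K.goodN.simple_negV (K.mem_heart hs) hA i hi

lemma isSimple {s : T} (hs : s ∈ S) : heartSimple (heartM N) s := by
  refine ⟨K.mem_heart hs, K.smc.nonzero s hs, ?_⟩
  intro A B f g h H hA hB
  by_cases hz : IsZero A
  · exact Or.inl hz
  right
  replace H : DT f g h := H
  obtain ⟨s', hs', u, hu⟩ := K.exists_map hA hz
  have huf : u ≫ f ≠ 0 := by
    intro h0
    obtain ⟨v, w, H'⟩ := H.irot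
    obtain ⟨y, hy⟩ := H'.lift u h0
    have : y = 0 := K.goodN.simple_negV (K.mem_heart hs') hB (-1) (by lia) y
    rw [this, zero_comp] at hy
    exact hu hy.symm
  have hss : s' = s := by
    by_contra hne
    exact huf (K.smc.noHom s' hs' s hs hne _)
  subst hss
  have hi : IsIso (u ≫ f) := (K.smc.endo s' hs (u ≫ f)).resolve_left huf
  have hg : g = 0 := by
    have h0 : (u ≫ f) ≫ g = 0 := by
      have := H.zero12
      rw [Category.assoc, this, comp_zero]
    exact (Preadditive.IsIso.comp_left_eq_zero _ _).1 h0
  refine K.goodN.heart_zero hB ?_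
  intro x
  obtain ⟨y, hy⟩ := H.rot.lift x (hA.1 1 (by lia) _)
  rw [← hy, hg, comp_zero]

lemma reps : heartSimplesReps N S := by
  refine ⟨fun s hs => K.isSimple hs, ?_, ?_⟩
  · intro Y hY
    obtain ⟨s, hs, f, hf⟩ := K.exists_map hY.1 hY.2.1
    have := K.goodN.schur (K.isSimple hs) hY f hf
    exact ⟨s, hs, ⟨asIso f⟩⟩
  · intro X hX Y hY hne
    refine ⟨fun e => K.smc.nonzero X hX ?_⟩
    rw [IsZero.iff_id_eq_zero, ← e.hom_inv_id, K.smc.noHom X hX Y hY hne e.hom, zero_comp]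

lemma eq_of_subset {S' : Set T} (h : S ⊆ S') (hS' : IsSMCof D S') : S' = S := by
  refine Set.Subset.antisymm (fun X hX => ?_) h
  by_contra hn
  have h1 : X ∈ tgeMn N 0 := by
    intro k hk
    refine K.f3 X (hS'.subset hX) k fun s hs i hi => ?_
    exact hS'.negVanish s (h hs) X hX i (by lia)
  have h2 : X⟦(-1:ℤ)⟧ ∈ tleMn N 0 := by
    refine K.goodN.le_of_simples fun L hL j hj => ?_
    obtain ⟨s, hs, ⟨e⟩⟩ := K.reps.2.1 L hL
    rw [V_src X L (-1) j (j+1) (by ring)]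
    refine (homF X).van_iso e.symm (j+1) ?_
    change V X s (j+1)
    rcases eq_or_lt_of_le (show j + 1 ≤ 0 by lia) with h0 | h0
    · rw [h0, V_zero_iff]
      exact hS'.noHom X hX s (h hs) (fun he => hn (he ▸ hs))
    · exact hS'.negVanish X hX s (h hs) _ h0
  have h3 : X ∈ tleMn N (-1) := (le_sh (-1) (-1) (by ring : (0:ℤ) + -1 = -1)).1 h2
  exact hS'.nonzero X hX (isZero_of_id (K.goodN.hom h3 h1 (by lia)))

end NData

lemma heart_addc {N N' : T} (h1 : Ret N' N) (h2 : addc N' N) : heartM N' = heartM N := by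
  obtain ⟨i, r, h⟩ := h1
  ext X
  constructor
  · rintro ⟨a, b⟩
    exact ⟨fun k hk => h2.V (a k hk), fun k hk => h2.V (b k hk)⟩
  · rintro ⟨a, b⟩
    exact ⟨fun k hk => V_retr_src i r h X k (a k hk), fun k hk => V_retr_src i r h X k (b k hk)⟩

lemma part3 [IsIdempotentComplete T] {D S : Set T} {M : T} (G : Good D M) (hS : IsSMCof D S) :
    ∃ N, IsBasic N ∧ Pres N ∧ thick {M} N ∧ thick {N} M ∧ heartSimplesReps N S := by
  obtain ⟨S₀, h0, hfin, hS0⟩ := G.smc_fin hS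
  obtain ⟨N, K⟩ := exists_NData G hS0 hfin
  obtain rfl := K.eq_of_subset h0 hS
  obtain ⟨N', h1, h2, hb⟩ := exists_basic K.fls
  have hh := heart_addc h1 h2
  obtain ⟨i, r, h⟩ := h1
  have a1 : thick {N} N' := thick.smd i r h (thick.of (Set.mem_singleton N))
  refine ⟨N', hb, ?_, ?_, ?_, ?_⟩
  · intro n hn
    refine V_retr_src i r h N' n ?_
    exact (homF N).van_retr i r h n (K.pres n hn)
  · exact thick_trans (fun s hs => by obtain rfl : s = N := hs; exact K.thk) a1
  · exact thick_trans (fun s hs => by obtain rfl : s = N := hs; exact h2.thick) K.thk'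
  · have := K.reps
    unfold heartSimplesReps at this ⊢
    rwa [hh]

lemma silt_good {R : Type*} [CommRing R] [IsArtinianRing R] [CategoryTheory.Linear R T]
    {C D : Set T} {M₀ M : T} (h : IsSTTriple R C D M₀) (hM : IsSiltingOfC C M) : Good D M :=
  good_transfer (good_of_ST h) hM.2.1 ((h.generates M).1 hM.1) ((hM.2.2 M₀).1 h.memC)


/-- for an ST-pair `(C, D)` inside an algebraic triangulated category, the map
sending a basic silting object `M` of `C` to the simple objects of the heart `T_M^0` is a
bijection between isomorphism classes of basic silting objects of `C` and isomorphism classes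
of simple-minded collections of `D`. -/
theorem stmt17 {R : Type*} [CommRing R] [IsArtinianRing R] [CategoryTheory.Linear R T]
    [HasFiniteBiproducts T] [IsIdempotentComplete T]
    (C D : Set T) (hST : ∃ M₀ : T, IsSTTriple R C D M₀) :
    (∀ M : T, IsBasic M → IsSiltingOfC C M →
      ∀ S : Set T, heartSimplesReps M S → IsSMCof D S) ∧
    (∀ M N : T, IsBasic M → IsSiltingOfC C M → IsBasic N → IsSiltingOfC C N →
      ∀ S S' : Set T, heartSimplesReps M S → heartSimplesReps N S' →
        isoEq S S' → Nonempty (M ≅ N)) ∧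
    (∀ S : Set T, IsSMCof D S →
      ∃ (M : T) (S' : Set T), IsBasic M ∧ IsSiltingOfC C M ∧
        heartSimplesReps M S' ∧ isoEq S S') := by
  obtain ⟨M₀, h⟩ := hST
  refine ⟨?_, ?_, ?_⟩
  · intro M _ hM S hS
    exact (silt_good h hM).smc hS
  · intro M N bM hM bN hN S S' hS hS' e
    exact part2 (silt_good h hM) (silt_good h hN) bM bN hS hS' e
  · intro S hS
    obtain ⟨N, hb, hp, h1, h2, hr⟩ := part3 (good_of_ST h) hS
    refine ⟨N, S, hb, ⟨(h.generates N).2 h1, hp, fun X => ?_⟩, hr,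
      ⟨fun X hX => ⟨X, hX, ⟨Iso.refl X⟩⟩, fun X hX => ⟨X, hX, ⟨Iso.refl X⟩⟩⟩⟩
    rw [h.generates X]
    constructor
    · exact fun hX => thick_trans (fun s hs => by obtain rfl : s = M₀ := hs; exact h2) hX
    · exact fun hX => thick_trans (fun s hs => by obtain rfl : s = N := hs; exact h1) hX

end STPaper
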